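/- Let k ≥ 2 and suppose nonnegative integers n ≥ m ≥ l ≥ 0, d ≥ 2, 1 ≤ a ≤ 9 satisfy L_n^{(k)} · L_m^{(k)} · L_l^{(k)} = a·(10^d − 1)/9, with n ≥ k + 1 and max{k, n} > 25. Then n < 1.8 · 10^{45} · k^{12} · (log k)^7. -/

import Mathlib

/-- The `k`-generalized Lucas sequence: `L 0 = 2`, `L 1 = 1`, and for `n ≥ 2`,
`L n = L (n-1) + L (n-2) + ⋯ + L (n-k)`, where terms with negative index count as `0`. -/
def lucasK (k : ℕ) : ℕ → ℕ
  | 0 => 2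
  | 1 => 1
  | n + 2 => ∑ j ∈ Finset.range k, if _ : j ≤ n + 1 then lucasK k (n + 1 - j) else 0
termination_by n => n
decreasing_by omega

section

open MvPolynomial

theorem zz_card_pairs (D : ℕ) :
    2 * (((Finset.range (D+1)).sigma (fun i => Finset.range (D + 1 - i))).card) = (D+1)*(D+2) := by
  rw [Finset.card_sigma]
  simp only [Finset.card_range]
  induction D with
  | zero => simp
  | succ n ih =>
    rw [Finset.sum_range_succ']
    have : ∀ i ∈ Finset.range (n+1), n + 1 + 1 - (i+1) = n + 1 - i := by
      intro i hi; omega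
    rw [Finset.sum_congr rfl this, mul_add, ih]
    simp; ring

theorem zz_finrank (D : ℕ) :
    2 * Module.finrank ℝ (restrictTotalDegree (Fin 2) ℝ D) = (D+1)*(D+2) := by
  rw [← zz_card_pairs D]
  congr 1
  have b := basisRestrictSupport ℝ {n : Fin 2 →₀ ℕ | (n.sum fun _ e => e) ≤ D}
  have h1 : Module.finrank ℝ (restrictTotalDegree (Fin 2) ℝ D) =
    Nat.card {n : Fin 2 →₀ ℕ | (n.sum fun _ e => e) ≤ D} := Module.finrank_eq_nat_card_basis b
  rw [h1]
  rw [← Fintype.card_coe, ← Nat.card_eq_fintype_card]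
  refine Nat.card_congr ?_
  refine ⟨fun n => ⟨⟨n.1 0, n.1 1⟩, ?_⟩, fun p => ⟨Finsupp.equivFunOnFinite.symm ![p.1.1, p.1.2], ?_⟩, ?_, ?_⟩
  · have := n.2
    simp only [Set.mem_ofPred_eq] at this
    rw [Finsupp.sum_fintype _ _ (by simp), Fin.sum_univ_two] at this
    simp; omega
  · have := p.2
    simp only [Finset.mem_sigma, Finset.mem_range] at this
    simp only [Set.mem_ofPred_eq]
    rw [Finsupp.sum_fintype _ _ (by simp), Fin.sum_univ_two]
    simp; omega
  · intro n
    ext i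
    fin_cases i <;> simp
  · intro p
    simp

theorem zz_interp (A : Finset (Fin 2 → ℝ)) (p : Fin 2 → ℝ) :
    ∃ e : MvPolynomial (Fin 2) ℝ, e.totalDegree ≤ A.card ∧ eval p e = 1 ∧
      ∀ q ∈ A, q ≠ p → eval q e = 0 := by
  classical
  have h : ∀ q : Fin 2 → ℝ, ∃ i : Fin 2, q ≠ p → q i ≠ p i := by
    intro q
    by_cases hq : q = p
    · exact ⟨0, fun h => absurd hq h⟩
    · obtain ⟨i, hi⟩ := Function.ne_iff.mp hq
      exact ⟨i, fun _ => hi⟩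
  choose i hi using h
  refine ⟨∏ q ∈ A.erase p, (C ((p (i q) - q (i q))⁻¹) * (X (i q) - C (q (i q)))), ?_, ?_, ?_⟩
  · refine (totalDegree_finsetProd _ _).trans ?_
    refine (Finset.sum_le_card_nsmul _ _ 1 ?_).trans ?_
    · intro q _
      refine (totalDegree_mul _ _).trans ?_
      rw [totalDegree_C, zero_add]
      refine (totalDegree_sub_C_le _ _).trans ?_
      rw [totalDegree_X]
    · simp [Finset.card_erase_le]
  · rw [map_prod]
    apply Finset.prod_eq_one
    intro q hq
    have := hi q (Finset.ne_of_mem_erase hq)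
    simp
    apply inv_mul_cancel₀
    intro h; apply this; linarith
  · intro q hq hqp
    rw [map_prod]
    apply Finset.prod_eq_zero (Finset.mem_erase.mpr ⟨hqp, hq⟩)
    simp

theorem zz_bezout (f g : MvPolynomial (Fin 2) ℝ) (hf : Irreducible f) (hg : g ≠ 0)
    (hfg : ¬ f ∣ g) (A : Finset (Fin 2 → ℝ)) (hA : ∀ p ∈ A, eval p f = 0 ∧ eval p g = 0) :
    A.card ≤ f.totalDegree * g.totalDegree := by
  classical
  set a := f.totalDegree with ha
  set b := g.totalDegree with hb
  set m := A.card with hm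
  set D := a + b + m with hD
  have hf0 : f ≠ 0 := hf.ne_zero
  set V := fun D => restrictTotalDegree (Fin 2) ℝ D with hV
  let mf : MvPolynomial (Fin 2) ℝ →ₗ[ℝ] MvPolynomial (Fin 2) ℝ := LinearMap.mulLeft ℝ f
  let mg : MvPolynomial (Fin 2) ℝ →ₗ[ℝ] MvPolynomial (Fin 2) ℝ := LinearMap.mulLeft ℝ g
  have imf : Function.Injective mf := fun x y h => mul_left_cancel₀ hf0 h
  have img : Function.Injective mg := fun x y h => mul_left_cancel₀ hg h
  let U1 := (V (b + m)).map mf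
  let U2 := (V (a + m)).map mg
  have r1 : Module.finrank ℝ U1 = Module.finrank ℝ (V (b+m)) :=
    (LinearEquiv.finrank_eq (Submodule.equivMapOfInjective mf imf _)).symm
  have r2 : Module.finrank ℝ U2 = Module.finrank ℝ (V (a+m)) :=
    (LinearEquiv.finrank_eq (Submodule.equivMapOfInjective mg img _)).symm
  have hinf : U1 ⊓ U2 ≤ ((V m).map mf).map mg := by
    rintro x ⟨⟨p, hp, rfl⟩, ⟨q, hq, hx⟩⟩
    have hx' : g * q = f * p := hx
    have : f ∣ q := by
      have : f ∣ g * q := ⟨p, hx'⟩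
      exact (hf.prime.dvd_or_dvd this).resolve_left hfg
    obtain ⟨s, rfl⟩ := this
    have hs : s ∈ V m := by
      by_cases hs0 : s = 0
      · rw [hs0]; exact Submodule.zero_mem _
      have hq' := (mem_restrictTotalDegree _ _ _).mp hq
      rw [totalDegree_mul_of_isDomain hf0 hs0] at hq'
      exact (mem_restrictTotalDegree _ _ _).mpr (by omega)
    exact ⟨f * s, ⟨s, hs, rfl⟩, hx⟩
  have fV : ∀ D, FiniteDimensional ℝ (V D) := fun D => by
    show Module.Finite ℝ (restrictTotalDegree (Fin 2) ℝ D); infer_instance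
  have : FiniteDimensional ℝ U1 := Module.Finite.map _ _
  have : FiniteDimensional ℝ U2 := Module.Finite.map _ _
  have : FiniteDimensional ℝ (((V m).map mf).map mg) := by
    have : FiniteDimensional ℝ ((V m).map mf) := Module.Finite.map _ _
    exact Module.Finite.map _ _
  have r3 : Module.finrank ℝ (((V m).map mf).map mg : Submodule ℝ _) = Module.finrank ℝ (V m) := by
    rw [← (LinearEquiv.finrank_eq (Submodule.equivMapOfInjective mg img _)),
      ← (LinearEquiv.finrank_eq (Submodule.equivMapOfInjective mf imf _))]
  have r4 : Module.finrank ℝ (U1 ⊓ U2 : Submodule ℝ _) ≤ Module.finrank ℝ (V m) := by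
    rw [← r3]; exact Submodule.finrank_mono hinf
  have r5 := Submodule.finrank_sup_add_finrank_inf_eq U1 U2
  let ev : MvPolynomial (Fin 2) ℝ →ₗ[ℝ] (A → ℝ) :=
    LinearMap.pi (fun p => (aeval (p : Fin 2 → ℝ) : MvPolynomial (Fin 2) ℝ →ₐ[ℝ] ℝ).toLinearMap)
  have hev : ∀ x (p : A), ev x p = eval (p : Fin 2 → ℝ) x := by
    intro x p
    simp [ev, aeval_eq_eval]
  let ev' := ev.domRestrict (V D)
  have hsurj : Function.Surjective ev' := by
    intro w
    choose e he1 he2 he3 using fun p => zz_interp A p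
    refine ⟨⟨∑ p : A, w p • e p, ?_⟩, ?_⟩
    · refine Submodule.sum_mem _ (fun p _ => Submodule.smul_mem _ _ ?_)
      exact (mem_restrictTotalDegree _ _ _).mpr ((he1 p).trans (by omega))
    · funext q
      show ev _ q = _
      rw [hev]; show eval _ (∑ p : A, w p • e p) = _
      rw [map_sum]
      rw [Finset.sum_eq_single q]
      · rw [smul_eval, he2, mul_one]
      · intro p _ hpq
        rw [smul_eval, he3 p q q.2 (fun h => hpq (Subtype.ext h.symm)), mul_zero]
      · simp
  have r6 := LinearMap.finrank_range_add_finrank_ker ev'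
  rw [LinearMap.range_eq_top.mpr hsurj, finrank_top, Module.finrank_fintype_fun_eq_card,
    Fintype.card_coe] at r6
  have hle : U1 ⊔ U2 ≤ (LinearMap.ker ev').map (V D).subtype := by
    refine sup_le ?_ ?_
    · rintro x ⟨p, hp, rfl⟩
      have hp' := (mem_restrictTotalDegree _ _ _).mp hp
      refine ⟨⟨f * p, ?_⟩, ?_, rfl⟩
      · exact (mem_restrictTotalDegree _ _ _).mpr ((totalDegree_mul _ _).trans (by omega))
      · rw [SetLike.mem_coe, LinearMap.mem_ker]
        funext q
        show ev _ q = 0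
        rw [hev]; show eval _ (_ * _) = _; rw [map_mul, (hA q q.2).1, zero_mul]
    · rintro x ⟨p, hp, rfl⟩
      have hp' := (mem_restrictTotalDegree _ _ _).mp hp
      refine ⟨⟨g * p, ?_⟩, ?_, rfl⟩
      · exact (mem_restrictTotalDegree _ _ _).mpr ((totalDegree_mul _ _).trans (by omega))
      · rw [SetLike.mem_coe, LinearMap.mem_ker]
        funext q
        show ev _ q = 0
        rw [hev]; show eval _ (_ * _) = _; rw [map_mul, (hA q q.2).2, zero_mul]
  have r7 : Module.finrank ℝ (U1 ⊔ U2 : Submodule ℝ _) ≤ Module.finrank ℝ (LinearMap.ker ev') := by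
    refine (Submodule.finrank_mono hle).trans ?_
    exact Submodule.finrank_map_le _ _
  have c1 := zz_finrank D
  have c2 := zz_finrank (a+m)
  have c3 := zz_finrank (b+m)
  have c4 := zz_finrank m
  have e0 : Module.finrank ℝ (V D) + Module.finrank ℝ (V m) ≥ m + Module.finrank ℝ (V (a+m)) + Module.finrank ℝ (V (b+m)) := by omega
  have e1 : 2 * Module.finrank ℝ (V D) = (D+1)*(D+2) := c1
  have e2 : 2 * Module.finrank ℝ (V (a+m)) = (a+m+1)*(a+m+2) := c2
  have e3 : 2 * Module.finrank ℝ (V (b+m)) = (b+m+1)*(b+m+2) := c3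
  have e4 : 2 * Module.finrank ℝ (V m) = (m+1)*(m+2) := c4
  have : (D+1)*(D+2) + (m+1)*(m+2) ≥ 2 * m + (a+m+1)*(a+m+2) + (b+m+1)*(b+m+2) := by omega
  rw [hD] at this
  nlinarith

end

section

open MvPolynomial

noncomputable def ztr (v : Fin 2 → ℝ) : MvPolynomial (Fin 2) ℝ →ₐ[ℝ] MvPolynomial (Fin 2) ℝ :=
  aeval (fun i => X i + C (v i))

theorem ztr_eval (v p : Fin 2 → ℝ) (f : MvPolynomial (Fin 2) ℝ) :
    eval p (ztr v f) = eval (p + v) f := by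
  have : (eval p).comp (ztr v : MvPolynomial (Fin 2) ℝ →+* MvPolynomial (Fin 2) ℝ) = eval (p + v) := by
    apply MvPolynomial.ringHom_ext
    · intro r; simp [ztr]
    · intro i; simp [ztr]
  exact congrArg (fun h => h f) this

theorem ztr_ztr (v w : Fin 2 → ℝ) (f : MvPolynomial (Fin 2) ℝ) :
    ztr v (ztr w f) = ztr (v + w) f := by
  apply MvPolynomial.funext
  intro p
  rw [ztr_eval, ztr_eval, ztr_eval, add_assoc]

theorem ztr_zero (f : MvPolynomial (Fin 2) ℝ) : ztr 0 f = f := by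
  apply MvPolynomial.funext
  intro p
  rw [ztr_eval, add_zero]

theorem zz_totalDegree_aeval_le {τ : Type*} (g : Fin 2 → MvPolynomial τ ℝ)
    (hg : ∀ i, (g i).totalDegree ≤ 1) (f : MvPolynomial (Fin 2) ℝ) :
    (aeval g f).totalDegree ≤ f.totalDegree := by
  conv_lhs => rw [f.as_sum, map_sum]
  refine totalDegree_finsetSum_le ?_
  intro s hs
  rw [aeval_monomial]
  refine (totalDegree_mul _ _).trans ?_
  rw [algebraMap_eq, totalDegree_C, zero_add]
  refine le_trans ?_ (le_totalDegree hs)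
  rw [Finsupp.prod, Finsupp.sum]
  refine (totalDegree_finsetProd _ _).trans (Finset.sum_le_sum ?_)
  intro i _
  refine (totalDegree_pow _ _).trans ?_
  have := hg i
  nlinarith [Nat.zero_le (s i)]

theorem ztr_totalDegree (v : Fin 2 → ℝ) (f : MvPolynomial (Fin 2) ℝ) :
    (ztr v f).totalDegree ≤ f.totalDegree := by
  apply zz_totalDegree_aeval_le
  intro i
  refine (totalDegree_add _ _).trans ?_
  simp

noncomputable def ztrEquiv (v : Fin 2 → ℝ) : MvPolynomial (Fin 2) ℝ ≃* MvPolynomial (Fin 2) ℝ where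
  toFun := ztr v
  invFun := ztr (-v)
  left_inv f := by rw [ztr_ztr, neg_add_cancel, ztr_zero]
  right_inv f := by rw [ztr_ztr, add_neg_cancel, ztr_zero]
  map_mul' := map_mul _

theorem ztr_irred (v : Fin 2 → ℝ) (f : MvPolynomial (Fin 2) ℝ) (hf : Irreducible f) :
    Irreducible (ztr v f) :=
  (MulEquiv.irreducible_iff (ztrEquiv v)).mpr hf

noncomputable def zln (p u : Fin 2 → ℝ) : MvPolynomial (Fin 2) ℝ →ₐ[ℝ] Polynomial ℝ :=
  aeval (fun i => Polynomial.C (p i) + Polynomial.C (u i) * Polynomial.X)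

theorem zln_eval (p u : Fin 2 → ℝ) (s : ℝ) (f : MvPolynomial (Fin 2) ℝ) :
    (zln p u f).eval s = eval (p + s • u) f := by
  have : (Polynomial.evalRingHom s).comp (zln p u : MvPolynomial (Fin 2) ℝ →+* Polynomial ℝ)
      = eval (p + s • u) := by
    apply MvPolynomial.ringHom_ext
    · intro r; simp [zln]
    · intro i; simp [zln]; ring
  exact congrArg (fun h => h f) this

theorem zln_natDegree (p u : Fin 2 → ℝ) (f : MvPolynomial (Fin 2) ℝ) :
    (zln p u f).natDegree ≤ f.totalDegree := by
  unfold zln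
  conv_lhs => rw [f.as_sum, map_sum]
  refine Polynomial.natDegree_sum_le_of_forall_le _ _ ?_
  intro s hs
  rw [aeval_monomial]
  refine (Polynomial.natDegree_mul_le).trans ?_
  rw [Polynomial.algebraMap_eq, Polynomial.natDegree_C, zero_add]
  refine le_trans ?_ (le_totalDegree hs)
  rw [Finsupp.prod, Finsupp.sum]
  refine (Polynomial.natDegree_prod_le _ _).trans (Finset.sum_le_sum ?_)
  intro i _
  refine (Polynomial.natDegree_pow_le).trans ?_
  have : (Polynomial.C (p i) + Polynomial.C (u i) * Polynomial.X).natDegree ≤ 1 := by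
    rw [add_comm]; exact Polynomial.natDegree_linear_le
  nlinarith [Nat.zero_le (s i)]

theorem zz_line (f : MvPolynomial (Fin 2) ℝ) (u p : Fin 2 → ℝ) (h : f ∣ ztr u f)
    (hp : eval p f = 0) (s : ℝ) : eval (p + s • u) f = 0 := by
  have key : ∀ m : ℕ, eval (p + (m : ℝ) • u) f = 0 := by
    intro m
    induction m with
    | zero => simpa using hp
    | succ n ih =>
      obtain ⟨c, hc⟩ := h
      have := congrArg (eval (p + (n : ℝ) • u)) hc
      rw [ztr_eval, map_mul, ih, zero_mul] at this
      rw [← this]; congr 2; push_cast; rw [add_smul, one_smul, add_assoc]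
  have : zln p u f = 0 := by
    apply Polynomial.eq_zero_of_infinite_isRoot
    refine Set.infinite_of_injective_forall_mem (f := fun m : ℕ => (m : ℝ)) Nat.cast_injective ?_
    intro m
    show Polynomial.IsRoot _ _
    rw [Polynomial.IsRoot, zln_eval, key]
  rw [← zln_eval, this, Polynomial.eval_zero]

theorem zz_factor (n : ℕ) : ∀ (G : MvPolynomial (Fin 2) ℝ), G ≠ 0 → G.totalDegree = n →
    ∀ (A : Finset (Fin 2 → ℝ)), A.Nonempty → (∀ p ∈ A, eval p G = 0) →
    ∃ f, Irreducible f ∧ f ∣ G ∧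
      A.card * f.totalDegree ≤ (A.filter (fun p => eval p f = 0)).card * n := by
  classical
  induction n using Nat.strong_induction_on with
  | _ n ih =>
  intro G hG hdeg A hA hz
  have hu : ¬ IsUnit G := by
    intro hu
    obtain ⟨p, hp⟩ := hA
    have := hu.map (eval p)
    rw [hz p hp] at this
    exact not_isUnit_zero this
  obtain ⟨f, hf, g, rfl⟩ := WfDvdMonoid.exists_irreducible_factor hu hG
  have hf0 := hf.ne_zero
  have hg0 : g ≠ 0 := right_ne_zero_of_mul hG
  have hd := totalDegree_mul_of_isDomain hf0 hg0
  have hfd : 0 < f.totalDegree := by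
    rcases Nat.eq_zero_or_pos f.totalDegree with h0 | h0
    · exfalso
      have h1 := (totalDegree_eq_zero_iff_eq_C).mp h0
      have h2 : coeff 0 f ≠ 0 := by
        intro h; rw [h, map_zero] at h1; exact hf0 h1
      apply hf.not_isUnit
      rw [h1]
      exact (isUnit_iff_ne_zero.mpr h2).map C
    · exact h0
  by_cases hc : A.card * f.totalDegree ≤ (A.filter (fun p => eval p f = 0)).card * n
  · exact ⟨f, hf, dvd_mul_right _ _, hc⟩
  push Not at hc
  set B := A.filter (fun p => eval p g = 0) with hB
  have hAB : A.card ≤ (A.filter (fun p => eval p f = 0)).card + B.card := by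
    rw [hB]
    refine le_trans (Finset.card_le_card ?_) (Finset.card_union_le _ _)
    intro p hp
    have := hz p hp
    rw [map_mul, mul_eq_zero] at this
    simp only [Finset.mem_union, Finset.mem_filter]
    tauto
  have hBcard : A.card * g.totalDegree ≤ B.card * n := by
    have e : n = f.totalDegree + g.totalDegree := by rw [← hdeg, hd]
    nlinarith
  have hn : 0 < n := by omega
  have hBne : B.Nonempty := by
    rw [← Finset.card_pos]
    by_contra hb
    have hb0 : B.card = 0 := by omega
    rw [hb0] at hAB
    have e : n = f.totalDegree + g.totalDegree := by rw [← hdeg, hd]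
    nlinarith [Finset.card_pos.mpr hA]
  obtain ⟨f', hf', hd', hc'⟩ := ih g.totalDegree (by omega) g hg0 rfl B hBne
    (fun p hp => (Finset.mem_filter.mp hp).2)
  refine ⟨f', hf', hd'.trans (dvd_mul_left _ _), ?_⟩
  have hsub : (B.filter (fun p => eval p f' = 0)).card ≤ (A.filter (fun p => eval p f' = 0)).card := by
    apply Finset.card_le_card
    apply Finset.filter_subset_filter
    exact Finset.filter_subset _ _
  have hgd : 0 < g.totalDegree := by
    rcases Nat.eq_zero_or_pos g.totalDegree with h0 | h0
    · exfalso
      obtain ⟨p, hp⟩ := hBne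
      have h1 := (totalDegree_eq_zero_iff_eq_C).mp h0
      have h2 := (Finset.mem_filter.mp hp).2
      rw [h1, eval_C] at h2
      rw [h2, map_zero] at h1
      exact hg0 h1
    · exact h0
  have k1 : A.card * f'.totalDegree * g.totalDegree ≤
      (A.filter (fun p => eval p f' = 0)).card * n * g.totalDegree := by
    calc A.card * f'.totalDegree * g.totalDegree = (A.card * g.totalDegree) * f'.totalDegree := by ring
      _ ≤ (B.card * n) * f'.totalDegree := Nat.mul_le_mul_right _ hBcard
      _ = (B.card * f'.totalDegree) * n := by ring
      _ ≤ ((B.filter (fun p => eval p f' = 0)).card * g.totalDegree) * n := Nat.mul_le_mul_right _ hc'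
      _ ≤ ((A.filter (fun p => eval p f' = 0)).card * g.totalDegree) * n :=
        Nat.mul_le_mul_right _ (Nat.mul_le_mul_right _ hsub)
      _ = _ := by ring
  exact Nat.le_of_mul_le_mul_right k1 hgd

theorem zz_lines (f : MvPolynomial (Fin 2) ℝ) (hf : f ≠ 0) (u : Fin 2 → ℝ) (hu : u ≠ 0)
    (h : f ∣ ztr u f) (F : Finset (Fin 2 → ℝ)) (hF : F.Nonempty) (hz : ∀ p ∈ F, eval p f = 0) :
    ∃ c : ℝ, F.card ≤ (F.filter (fun p => u 1 * p 0 - u 0 * p 1 = c)).card * f.totalDegree := by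
  classical
  set cr : (Fin 2 → ℝ) → ℝ := fun p => u 1 * p 0 - u 0 * p 1 with hcr
  have hn : 0 < u 0 ^ 2 + u 1 ^ 2 := by
    by_contra hcon
    apply hu
    have h0 : u 0 = 0 := by nlinarith [sq_nonneg (u 0), sq_nonneg (u 1)]
    have h1 : u 1 = 0 := by nlinarith [sq_nonneg (u 0), sq_nonneg (u 1)]
    ext i; fin_cases i
    · exact h0
    · exact h1
  obtain ⟨p0, hp0⟩ : ∃ p0, eval p0 f ≠ 0 := by
    by_contra hcon
    push Not at hcon
    apply hf
    apply MvPolynomial.funext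
    intro x; rw [hcon x, map_zero]
  set w : Fin 2 → ℝ := ![u 1, - u 0] with hw
  have hln : zln p0 w f ≠ 0 := by
    intro h0
    apply hp0
    have := zln_eval p0 w 0 f
    rw [h0] at this
    simpa using this.symm
  have himg : (F.image cr).card ≤ f.totalDegree := by
    have hinj : Function.Injective (fun c : ℝ => (c - cr p0) / (u 0 ^ 2 + u 1 ^ 2)) := by
      intro c c' hcc
      simp only at hcc
      rw [div_left_inj' hn.ne'] at hcc
      linarith
    calc (F.image cr).card = ((F.image cr).image (fun c : ℝ => (c - cr p0) / (u 0 ^ 2 + u 1 ^ 2))).card :=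
          (Finset.card_image_of_injective _ hinj).symm
      _ ≤ (zln p0 w f).roots.toFinset.card := by
          apply Finset.card_le_card
          intro s hs
          rw [Finset.mem_image] at hs
          obtain ⟨c, hc, rfl⟩ := hs
          obtain ⟨q, hq, rfl⟩ := Finset.mem_image.mp hc
          rw [Multiset.mem_toFinset, Polynomial.mem_roots hln, Polynomial.IsRoot, zln_eval]
          set s := (cr q - cr p0) / (u 0 ^ 2 + u 1 ^ 2) with hs
          have hs' : s * (u 0 ^ 2 + u 1 ^ 2) = cr q - cr p0 := by
            rw [hs]; field_simp
          have : p0 + s • w = q + (((p0 0 - q 0) * u 0 + (p0 1 - q 1) * u 1) / (u 0 ^ 2 + u 1 ^ 2)) • u := by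
            simp only [hcr] at hs'
            ext i; fin_cases i
            · simp [hw]; field_simp; linear_combination (u 1) * hs'
            · simp [hw]; field_simp; linear_combination (- u 0) * hs'
          rw [this]
          exact zz_line f u q h (hz q hq) _
      _ ≤ (zln p0 w f).roots.card := Multiset.toFinset_card_le _
      _ ≤ (zln p0 w f).natDegree := Polynomial.card_roots' _
      _ ≤ f.totalDegree := zln_natDegree _ _ _
  by_contra hcon
  push Not at hcon
  have hsum := Finset.card_eq_sum_card_image cr F
  have : F.card * f.totalDegree < F.card * (F.image cr).card := by
    conv_lhs => rw [hsum, Finset.sum_mul]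
    rw [mul_comm, ← smul_eq_mul, ← Finset.sum_const]
    apply Finset.sum_lt_sum_of_nonempty (hF.image _)
    intro c _
    exact hcon c
  have := Nat.lt_of_mul_lt_mul_left this
  omega

theorem zz_moment {β γ : Type*} [DecidableEq β] [DecidableEq γ] (I : Finset β) (S : Finset γ)
    (A : γ → Finset β) (φ B : ℕ) (hA : ∀ g ∈ S, A g ⊆ I) (hφ : ∀ g ∈ S, (A g).card = φ)
    (hB : ∀ g ∈ S, ∀ g' ∈ S, g ≠ g' → (A g ∩ A g').card ≤ B) :
    (S.card * φ) ^ 2 ≤ I.card * (S.card * φ + S.card ^ 2 * B) := by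
  have h1 : S.card * φ = ∑ p ∈ I, ∑ g ∈ S, (if p ∈ A g then 1 else 0) := by
    rw [Finset.sum_comm, ← smul_eq_mul, ← Finset.sum_const]
    apply Finset.sum_congr rfl
    intro g hg
    rw [← hφ g hg, Finset.sum_ite_mem, Finset.inter_eq_right.mpr (hA g hg)]
    simp
  have h2 : ∑ p ∈ I, (∑ g ∈ S, (if p ∈ A g then 1 else 0)) ^ 2 ≤ S.card * φ + S.card ^ 2 * B := by
    have : ∀ p ∈ I, (∑ g ∈ S, (if p ∈ A g then 1 else 0)) ^ 2 =
        ∑ g ∈ S, ∑ g' ∈ S, (if p ∈ A g ∩ A g' then 1 else 0) := by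
      intro p _
      rw [sq, Finset.sum_mul_sum]
      refine Finset.sum_congr rfl fun g _ => Finset.sum_congr rfl fun g' _ => ?_
      by_cases h : p ∈ A g <;> by_cases h' : p ∈ A g' <;> simp [h, h']
    rw [Finset.sum_congr rfl this, Finset.sum_comm]
    have : ∀ g ∈ S, ∑ p ∈ I, ∑ g' ∈ S, (if p ∈ A g ∩ A g' then 1 else 0) ≤ φ + S.card * B := by
      intro g hg
      rw [Finset.sum_comm]
      calc _ ≤ ∑ g' ∈ S, ((if g = g' then φ else 0) + B) := by
            apply Finset.sum_le_sum
            intro g' hg'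
            rw [Finset.sum_ite_mem]
            rw [Finset.inter_eq_right.mpr (Finset.inter_subset_left.trans (hA g hg))]
            rw [Finset.sum_const, smul_eq_mul, mul_one]
            split_ifs with h
            · subst h; rw [Finset.inter_self, hφ g hg]; omega
            · have := hB g hg g' hg' h; omega
        _ ≤ _ := by
            rw [Finset.sum_add_distrib, Finset.sum_ite_eq, if_pos hg, Finset.sum_const, smul_eq_mul]
    refine (Finset.sum_le_sum this).trans ?_
    rw [Finset.sum_const, smul_eq_mul]
    nlinarith
  rw [h1]
  refine (sq_sum_le_card_mul_sum_sq).trans ?_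
  rw [← h1]
  exact Nat.mul_le_mul_left _ h2

end

section

open MvPolynomial

theorem zz_rich (A A' Sh : Finset (Fin 2 → ℝ)) (G : MvPolynomial (Fin 2) ℝ) (Γ : ℕ)
    (hsh : ∀ g ∈ Sh, ∀ p ∈ A, p + g ∈ A') (hG : G ≠ 0) (hdeg : G.totalDegree ≤ Γ)
    (hz : ∀ p ∈ A, eval p G = 0) (hA : A.Nonempty)
    (hM : 0 < Sh.card) (h1 : 10 * Γ * A'.card ≤ Sh.card * A.card)
    (h2 : 10 * Γ ^ 2 * A'.card < 9 * A.card ^ 2) :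
    ∃ g ∈ Sh, ∃ g' ∈ Sh, g ≠ g' ∧ ∃ c : ℝ,
      A.card ≤ (A.filter (fun p => (g - g') 1 * p 0 - (g - g') 0 * p 1 = c)).card * Γ := by
  classical
  obtain ⟨f, hf, hfG, hcard⟩ := zz_factor _ G hG rfl A hA hz
  set F := A.filter (fun p => eval p f = 0) with hF
  set δ := f.totalDegree with hδ
  have hδ0 : 1 ≤ δ := by
    by_contra hcon
    have h0 : f.totalDegree = 0 := by omega
    rw [totalDegree_eq_zero_iff_eq_C] at h0
    apply hf.not_isUnit
    rw [h0]
    apply IsUnit.map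
    rw [isUnit_iff_ne_zero]
    intro hc
    apply hf.ne_zero
    rw [h0, hc, C_0]
  have hFΓ : A.card * δ ≤ F.card * Γ := hcard.trans (Nat.mul_le_mul_left _ hdeg)
  have hApos : 0 < A.card := hA.card_pos
  have hFpos : 0 < F.card := by
    rcases Nat.eq_zero_or_pos F.card with h | h
    · rw [h] at hFΓ
      have := Nat.mul_pos hApos hδ0
      omega
    · exact h
  have key : ∃ g ∈ Sh, ∃ g' ∈ Sh, g ≠ g' ∧
      δ ^ 2 < ((F.image (· + g)) ∩ (F.image (· + g'))).card := by
    by_contra hcon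
    push Not at hcon
    have hm := zz_moment A' Sh (fun g => F.image (· + g)) F.card (δ ^ 2)
      (by
        intro g hg q hq
        simp only [Finset.mem_image] at hq
        obtain ⟨p, hp, rfl⟩ := hq
        exact hsh g hg p (Finset.mem_filter.mp hp).1)
      (fun g hg => Finset.card_image_of_injective _ (add_left_injective g))
      (fun g hg g' hg' hne => hcon g hg g' hg' hne)
    generalize F.card = φ at *
    generalize A.card = a at *
    generalize A'.card = a' at *
    generalize Sh.card = M at *
    have e1 : M * φ ^ 2 ≤ a' * φ + a' * M * δ ^ 2 := by
      have : M * (M * φ ^ 2) ≤ M * (a' * φ + a' * M * δ ^ 2) := by nlinarith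
      exact Nat.le_of_mul_le_mul_left this hM
    have e2 : 10 * Γ * (a' * φ) ≤ Γ * (M * φ ^ 2) := by
      calc 10 * Γ * (a' * φ) = (10 * Γ * a') * φ := by ring
        _ ≤ (M * a) * φ := Nat.mul_le_mul_right _ h1
        _ ≤ (M * (a * δ)) * φ := by
            apply Nat.mul_le_mul_right
            apply Nat.mul_le_mul_left
            nlinarith
        _ ≤ (M * (φ * Γ)) * φ := by
            apply Nat.mul_le_mul_right
            apply Nat.mul_le_mul_left
            exact hFΓ
        _ = _ := by ring
    have hΓ : 0 < Γ := by
      rcases Nat.eq_zero_or_pos Γ with h | h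
      · subst h; have := Nat.mul_pos hApos hδ0; omega
      · exact h
    have e3 : 10 * (a' * φ) ≤ M * φ ^ 2 := by
      have : Γ * (10 * (a' * φ)) ≤ Γ * (M * φ ^ 2) := by linarith
      exact Nat.le_of_mul_le_mul_left this hΓ
    have e4 : M * (9 * φ ^ 2) ≤ M * (10 * a' * δ ^ 2) := by nlinarith
    have e5 : 9 * φ ^ 2 ≤ 10 * a' * δ ^ 2 := Nat.le_of_mul_le_mul_left e4 hM
    have e6 : (a * δ) ^ 2 ≤ (φ * Γ) ^ 2 := Nat.pow_le_pow_left hFΓ 2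
    have e7 : δ ^ 2 * (9 * a ^ 2) ≤ δ ^ 2 * (10 * Γ ^ 2 * a') := by nlinarith [Nat.mul_le_mul_right (Γ ^ 2) e5]
    have := Nat.le_of_mul_le_mul_left e7 (by positivity)
    omega
  obtain ⟨g, hg, g', hg', hne, hov⟩ := key
  refine ⟨g, hg, g', hg', hne, ?_⟩
  have hdiv : f ∣ ztr (g - g') f := by
    by_contra hnd
    have hb := zz_bezout f (ztr (g - g') f) hf (ztr_irred _ _ hf).ne_zero hnd
      (((F.image (· + g)) ∩ (F.image (· + g'))).image (· - g)) (by
        intro p hp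
        simp only [Finset.mem_image, Finset.mem_inter] at hp
        obtain ⟨q, ⟨⟨p1, hp1, rfl⟩, ⟨p2, hp2, h⟩⟩, rfl⟩ := hp
        rw [ztr_eval]
        have e : p1 + g - g + (g - g') = p2 := by rw [add_sub_cancel_right, ← add_sub_assoc, ← h, add_sub_cancel_right]
        rw [e, add_sub_cancel_right]
        exact ⟨(Finset.mem_filter.mp hp1).2, (Finset.mem_filter.mp hp2).2⟩)
    rw [Finset.card_image_of_injective _ (sub_left_injective)] at hb
    have : δ * (ztr (g - g') f).totalDegree ≤ δ * δ := Nat.mul_le_mul_left _ (ztr_totalDegree _ _)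
    nlinarith
  obtain ⟨c, hc⟩ := zz_lines f hf.ne_zero (g - g') (sub_ne_zero.mpr hne) hdiv F
    (Finset.card_pos.mp hFpos) (fun p hp => (Finset.mem_filter.mp hp).2)
  refine ⟨c, ?_⟩
  set Fc := F.filter (fun p => (g - g') 1 * p 0 - (g - g') 0 * p 1 = c)
  set Ac := A.filter (fun p => (g - g') 1 * p 0 - (g - g') 0 * p 1 = c)
  have hle : Fc.card ≤ Ac.card := Finset.card_le_card (Finset.filter_subset_filter _ (Finset.filter_subset _ _))
  have : δ * A.card ≤ δ * (Ac.card * Γ) := by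
    calc δ * A.card ≤ F.card * Γ := by linarith
      _ ≤ (Fc.card * δ) * Γ := Nat.mul_le_mul_right _ hc
      _ ≤ (Ac.card * δ) * Γ := by gcongr
      _ = _ := by ring
  exact Nat.le_of_mul_le_mul_left this hδ0

end

section

open MvPolynomial

theorem lmn_vander (q : ℕ) (f : Fin q → ℕ) (hf : Function.Injective f) (θ : ℝ) (h0 : 0 < θ)
    (h1 : θ ≠ 1) (c : Fin q → ℝ) (hc : ∀ j, c j ≠ 0) :
    (Matrix.of (fun i j : Fin q => c j * θ ^ ((i : ℕ) * f j))).det ≠ 0 := by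
  have e : (Matrix.of (fun i j : Fin q => c j * θ ^ ((i : ℕ) * f j))).det
      = (∏ j, c j) * (Matrix.vandermonde (fun j => θ ^ f j)).transpose.det := by
    rw [← Matrix.det_mul_row]
    congr 1
    ext i j
    simp [Matrix.vandermonde_apply, ← pow_mul, mul_comm]
  rw [e, Matrix.det_transpose]
  apply mul_ne_zero
  · exact Finset.prod_ne_zero_iff.mpr fun j _ => hc j
  · rw [Matrix.det_vandermonde_ne_zero_iff]
    intro a b hab
    apply hf
    exact pow_right_injective₀ h0 h1 hab

theorem lmn_one (q : ℕ) (f : Fin q → ℕ) (hf : Function.Injective f) (θ : ℝ) (h0 : 0 < θ)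
    (h1 : θ ≠ 1) (Q : Fin q → Polynomial ℝ) (hQ : ∀ j, Q j ≠ 0) :
    (Matrix.of (fun i j : Fin q => (Q j).comp (Polynomial.X + Polynomial.C ((i : ℕ) : ℝ)) *
      Polynomial.C (θ ^ ((i : ℕ) * f j)))).det ≠ 0 := by
  intro hdet
  set D := ∑ j, (Q j).natDegree with hD
  have hle : ∀ j, (Q j).natDegree ≤ D := fun j =>
    Finset.single_le_sum (f := fun j => (Q j).natDegree) (fun _ _ => Nat.zero_le _) (Finset.mem_univ j)
  set A : Matrix (Fin q) (Fin q) (Polynomial ℝ) := Matrix.of (fun i j : Fin q =>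
    Polynomial.X ^ (D - (Q j).natDegree) * ((Q j).comp (Polynomial.X + Polynomial.C ((i : ℕ) : ℝ)) *
      Polynomial.C (θ ^ ((i : ℕ) * f j)))) with hA
  have hA0 : A.det = 0 := by
    have := Matrix.det_mul_row (fun j => Polynomial.X ^ (D - (Q j).natDegree)) (Matrix.of (fun i j : Fin q => (Q j).comp (Polynomial.X + Polynomial.C ((i : ℕ) : ℝ)) *
      Polynomial.C (θ ^ ((i : ℕ) * f j))))
    rw [hdet, mul_zero] at this
    exact this
  have hnd : ∀ i j, (A i j).natDegree ≤ D := by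
    intro i j
    simp only [hA, Matrix.of_apply]
    refine Polynomial.natDegree_mul_le.trans ?_
    have e1 := (Polynomial.natDegree_mul_C_le ((Q j).comp (Polynomial.X + Polynomial.C ((i : ℕ) : ℝ))) (θ ^ ((i : ℕ) * f j)))
    rw [Polynomial.natDegree_comp, Polynomial.natDegree_X_add_C, mul_one] at e1
    have := hle j
    rw [Polynomial.natDegree_X_pow]
    omega
  have hco : ∀ i j, (A i j).coeff D = (Q j).leadingCoeff * θ ^ ((i : ℕ) * f j) := by
    intro i j
    simp only [hA, Matrix.of_apply]
    rw [← mul_assoc, Polynomial.coeff_mul_C]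
    congr 1
    have := hle j
    conv_lhs => rw [show D = (Q j).natDegree + (D - (Q j).natDegree) by omega]
    rw [Nat.add_sub_cancel_left, Polynomial.coeff_X_pow_mul]
    have e2 := Polynomial.leadingCoeff_comp (p := Q j) (q := Polynomial.X + Polynomial.C ((i : ℕ) : ℝ)) (by rw [Polynomial.natDegree_X_add_C]; exact one_ne_zero)
    rw [Polynomial.leadingCoeff_X_add_C, one_pow, mul_one] at e2
    rw [← e2, Polynomial.leadingCoeff, Polynomial.natDegree_comp, Polynomial.natDegree_X_add_C, mul_one]
  have hc : A.det.coeff (q * D) = (Matrix.of (fun i j : Fin q => (Q j).leadingCoeff * θ ^ ((i : ℕ) * f j))).det := by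
    rw [Matrix.det_apply, Matrix.det_apply, Polynomial.finsetSum_coeff]
    apply Finset.sum_congr rfl
    intro σ _
    rw [Polynomial.coeff_smul]
    congr 1
    have := Polynomial.coeff_prod_of_natDegree_le (s := Finset.univ) (fun i => A (σ i) i) D (fun i _ => hnd _ _)
    rw [Finset.card_univ, Fintype.card_fin] at this
    rw [this]
    exact Finset.prod_congr rfl fun i _ => hco _ _
  rw [hA0, Polynomial.coeff_zero] at hc
  exact lmn_vander q f hf θ h0 h1 _ (fun j => Polynomial.leadingCoeff_ne_zero.mpr (hQ j)) hc.symm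

/-- kernel vector -/
theorem lmn_vanish {q : ℕ} (f : Fin q → ℕ) (S : Finset ℕ) (hf : Function.Injective f)
    (hS : S = Finset.univ.image f) (hq : 0 < q) (θ v : ℝ) (hv : 0 < v) (a : ℕ → ℕ → ℝ)
    (hz : ∀ i < q, ∑ l ∈ S, a i l * (v * θ ^ i) ^ l = 0) :
    (Matrix.of (fun i j : Fin q => a i (f j) * θ ^ ((i : ℕ) * f j))).det = 0 := by
  rw [← Matrix.exists_mulVec_eq_zero_iff]
  refine ⟨fun j => v ^ f j, ?_, ?_⟩
  · intro h
    have := congrFun h ⟨0, hq⟩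
    simp at this
    exact hv.ne' this.1
  · ext i
    have := hz i i.2
    rw [hS, Finset.sum_image (fun _ _ _ _ h => hf h)] at this
    simp only [Matrix.mulVec, dotProduct, Matrix.of_apply, Pi.zero_apply]
    rw [← this]
    apply Finset.sum_congr rfl
    intro j _
    rw [mul_pow, ← pow_mul]
    ring

end

section

open MvPolynomial

theorem lmn_enum (S : Finset ℕ) : ∃ f : Fin S.card → ℕ, Function.Injective f ∧ S = Finset.univ.image f := by
  refine ⟨S.orderEmbOfFin rfl, (S.orderEmbOfFin rfl).injective, ?_⟩
  ext x
  rw [Finset.mem_image]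
  have := Finset.range_orderEmbOfFin S rfl
  constructor
  · intro h
    have h2 : x ∈ Set.range (S.orderEmbOfFin rfl) := by rw [this]; exact h
    obtain ⟨i, hi⟩ := h2
    exact ⟨i, Finset.mem_univ _, hi⟩
  · rintro ⟨i, _, rfl⟩
    exact Finset.orderEmbOfFin_mem S rfl i

theorem lmn_two (P : ℕ → MvPolynomial (Fin 2) ℝ) (L D : ℕ) (hP : ∃ l < L, P l ≠ 0)
    (hD : ∀ l < L, (P l).totalDegree ≤ D) (θ : ℝ) (h0 : 0 < θ) (h1 : θ ≠ 1)
    (e : Fin 2 → ℝ) :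
    ∃ G : MvPolynomial (Fin 2) ℝ, G ≠ 0 ∧ G.totalDegree ≤ L * D ∧
      ∀ (p : Fin 2 → ℝ) (v : ℝ), 0 < v →
        (∀ i < L, ∑ l ∈ Finset.range L, eval (p + (i : ℝ) • e) (P l) * (v * θ ^ i) ^ l = 0) →
        eval p G = 0 := by
  classical
  set S := (Finset.range L).filter (fun l => P l ≠ 0) with hS
  obtain ⟨f, hf, hfS⟩ := lmn_enum S
  have hmem : ∀ j, f j ∈ S := by
    intro j; rw [hfS]; exact Finset.mem_image_of_mem _ (Finset.mem_univ _)
  have hcardL : S.card ≤ L := by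
    calc S.card ≤ (Finset.range L).card := Finset.card_filter_le _ _
      _ = L := Finset.card_range L
  have hpos : 0 < S.card := by
    obtain ⟨l, hl, hl2⟩ := hP
    exact Finset.card_pos.mpr ⟨l, by simp [hS, hl, hl2]⟩
  set M : Matrix (Fin S.card) (Fin S.card) (MvPolynomial (Fin 2) ℝ) :=
    Matrix.of (fun i j => ztr (((i : ℕ) : ℝ) • e) (P (f j)) * C (θ ^ ((i : ℕ) * f j))) with hM
  refine ⟨M.det, ?_, ?_, ?_⟩
  · intro hdet
    have hprod : (∏ j, P (f j)) ≠ 0 := Finset.prod_ne_zero_iff.mpr fun j _ => by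
      have := hmem j
      simp only [hS, Finset.mem_filter] at this
      exact this.2
    obtain ⟨p, hp⟩ : ∃ p, eval p (∏ j, P (f j)) ≠ 0 := by
      by_contra hcon
      push Not at hcon
      apply hprod
      apply MvPolynomial.funext
      intro p; rw [hcon p, map_zero]
    rw [map_prod, Finset.prod_ne_zero_iff] at hp
    have hQ : ∀ j, zln p e (P (f j)) ≠ 0 := by
      intro j h
      have := zln_eval p e 0 (P (f j))
      rw [h, Polynomial.eval_zero, zero_smul, add_zero] at this
      exact hp j (Finset.mem_univ _) this.symm
    apply lmn_one S.card f hf θ h0 h1 _ hQ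
    have h2 := congrArg (zln p e) hdet
    rw [map_zero, AlgHom.map_det] at h2
    rw [← h2]
    congr 1
    ext1 i j
    simp only [hM, Matrix.of_apply, AlgHom.mapMatrix_apply, Matrix.map_apply, map_mul]
    congr 1
    · apply Polynomial.funext
      intro s
      rw [zln_eval, ztr_eval, Polynomial.eval_comp, zln_eval]
      congr 2
      simp [add_smul, add_assoc]
    · simp [zln, algebraMap_eq, Polynomial.algebraMap_eq]
  · rw [Matrix.det_apply]
    refine totalDegree_finsetSum_le ?_
    intro σ _
    refine (totalDegree_smul_le _ _).trans ?_
    refine (totalDegree_finsetProd _ _).trans ?_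
    calc ∑ i, (M (σ i) i).totalDegree ≤ ∑ i : Fin S.card, D := by
          apply Finset.sum_le_sum
          intro j _
          simp only [hM, Matrix.of_apply]
          refine (totalDegree_mul _ _).trans ?_
          rw [totalDegree_C, add_zero]
          refine (ztr_totalDegree _ _).trans (hD _ ?_)
          have := hmem j
          simp only [hS, Finset.mem_filter, Finset.mem_range] at this
          exact this.1
      _ = S.card * D := by simp
      _ ≤ L * D := Nat.mul_le_mul_right _ hcardL
  · intro p v hv hz
    rw [RingHom.map_det]
    have := lmn_vanish f S hf hfS hpos θ v hv (fun i l => eval (p + (i : ℝ) • e) (P l)) (by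
      intro i hi
      have := hz i (lt_of_lt_of_le hi hcardL)
      rw [← this, hS]
      apply Finset.sum_subset (Finset.filter_subset _ _)
      intro l hl hl2
      have : P l = 0 := by
        by_contra h
        exact hl2 (Finset.mem_filter.mpr ⟨hl, h⟩)
      rw [this, map_zero, zero_mul])
    rw [← this]
    congr 1
    ext i j
    simp [hM, ztr_eval]

theorem lmn_line (P : ℕ → MvPolynomial (Fin 2) ℝ) (L D : ℕ)
    (hD : ∀ l < L, (P l).totalDegree ≤ D) (θ : ℝ) (h0 : 0 < θ) (h1 : θ ≠ 1)
    (p e : Fin 2 → ℝ) (T : Finset ℝ) (hT : L * D < T.card)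
    (hz : ∀ τ ∈ T, ∃ v : ℝ, 0 < v ∧ ∀ i < L,
      ∑ l ∈ Finset.range L, eval (p + (τ + (i : ℝ)) • e) (P l) * (v * θ ^ i) ^ l = 0) :
    ∀ l < L, zln p e (P l) = 0 := by
  classical
  by_contra hcon
  push Not at hcon
  obtain ⟨l0, hl0, hl0'⟩ := hcon
  set S := (Finset.range L).filter (fun l => zln p e (P l) ≠ 0) with hS
  obtain ⟨f, hf, hfS⟩ := lmn_enum S
  have hmem : ∀ j, f j ∈ S := by
    intro j; rw [hfS]; exact Finset.mem_image_of_mem _ (Finset.mem_univ _)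
  have hcardL : S.card ≤ L := by
    calc S.card ≤ (Finset.range L).card := Finset.card_filter_le _ _
      _ = L := Finset.card_range L
  have hpos : 0 < S.card := Finset.card_pos.mpr ⟨l0, by simp [hS, hl0, hl0']⟩
  have hne := lmn_one S.card f hf θ h0 h1 (fun j => zln p e (P (f j))) (fun j => by
    have := hmem j
    simp only [hS, Finset.mem_filter] at this
    exact this.2)
  set M : Matrix (Fin S.card) (Fin S.card) (Polynomial ℝ) := Matrix.of (fun i j : Fin S.card => (zln p e (P (f j))).comp (Polynomial.X + Polynomial.C ((i : ℕ) : ℝ)) *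
      Polynomial.C (θ ^ ((i : ℕ) * f j))) with hM
  apply hne
  apply Polynomial.eq_zero_of_natDegree_lt_card_of_eval_eq_zero' _ T
  · intro τ hτ
    obtain ⟨v, hv, hz⟩ := hz τ hτ
    have h3 : (M.det).eval τ = (M.map (Polynomial.evalRingHom τ)).det := by
      have := RingHom.map_det (Polynomial.evalRingHom τ) M
      simpa using this
    rw [h3]
    have := lmn_vanish f S hf hfS hpos θ v hv (fun i l => eval (p + (τ + (i : ℝ)) • e) (P l)) (by
      intro i hi
      have := hz i (lt_of_lt_of_le hi hcardL)
      rw [← this, hS]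
      apply Finset.sum_subset (Finset.filter_subset _ _)
      intro l hl hl2
      have : zln p e (P l) = 0 := by
        by_contra h
        exact hl2 (Finset.mem_filter.mpr ⟨hl, h⟩)
      rw [← zln_eval, this, Polynomial.eval_zero, zero_mul])
    rw [← this]
    congr 1
    ext i j
    simp [hM, zln_eval]
  · refine lt_of_le_of_lt ?_ hT
    rw [Matrix.det_apply]
    refine Polynomial.natDegree_sum_le_of_forall_le _ _ ?_
    intro σ _
    refine (Polynomial.natDegree_smul_le _ _).trans ?_
    refine (Polynomial.natDegree_prod_le _ _).trans ?_
    calc ∑ i, (M (σ i) i).natDegree ≤ ∑ i : Fin S.card, D := by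
          apply Finset.sum_le_sum
          intro j _
          simp only [hM, Matrix.of_apply]
          refine (Polynomial.natDegree_mul_C_le _ _).trans ?_
          rw [Polynomial.natDegree_comp, Polynomial.natDegree_X_add_C, mul_one]
          refine (zln_natDegree _ _ _).trans (hD _ ?_)
          have := hmem j
          simp only [hS, Finset.mem_filter, Finset.mem_range] at this
          exact this.1
      _ = S.card * D := by simp
      _ ≤ L * D := Nat.mul_le_mul_right _ hcardL

end

section

open MvPolynomial

/-- the points -/
noncomputable def zpt (N d : ℕ) (x : ℕ × ℕ × ℕ) : Fin 2 → ℝ :=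
  ![(x.1 : ℝ) - N * x.2.2, (x.2.1 : ℝ) + d * x.2.2]

def zbox (R S T : ℕ) : Finset (ℕ × ℕ × ℕ) := Finset.range R ×ˢ (Finset.range S ×ˢ Finset.range T)

theorem zbox_card (R S T : ℕ) : (zbox R S T).card = R * S * T := by
  simp [zbox, mul_assoc]

theorem mem_zbox {R S T : ℕ} {x : ℕ × ℕ × ℕ} :
    x ∈ zbox R S T ↔ x.1 < R ∧ x.2.1 < S ∧ x.2.2 < T := by
  simp [zbox]

theorem zpt_inj {N d R S T : ℕ} (hN : R ≤ N) : Set.InjOn (zpt N d) (zbox R S T : Finset _) := by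
  rintro ⟨r, s, t⟩ hx ⟨r', s', t'⟩ hy h
  rw [Finset.mem_coe, mem_zbox] at hx hy
  simp only at hx hy
  have h0 := congrFun h 0
  have h1 := congrFun h 1
  simp only [zpt, Matrix.cons_val_zero, Matrix.cons_val_one] at h0 h1
  have h0' : (r : ℤ) - N * t = r' - N * t' := by exact_mod_cast h0
  have h1' : (s : ℤ) + d * t = s' + d * t' := by exact_mod_cast h1
  have ht : (t : ℤ) = t' := by
    by_contra hne
    rcases lt_or_gt_of_ne hne with hlt | hlt
    · have : (N : ℤ) * (t' - t) ≥ N * 1 := by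
        apply mul_le_mul_of_nonneg_left _ (by positivity)
        omega
      have e : (N : ℤ) * (t' - t) = r' - r := by linarith
      omega
    · have : (N : ℤ) * (t - t') ≥ N * 1 := by
        apply mul_le_mul_of_nonneg_left _ (by positivity)
        omega
      have e : (N : ℤ) * (t - t') = r - r' := by linarith
      omega
  rw [ht] at h0' h1'
  have : (r : ℤ) = r' := by linarith
  have : (s : ℤ) = s' := by linarith
  simp only [Prod.mk.injEq]
  omega

/-- t is unique if the step `C` is at least the range -/
theorem zt_unique {C a b : ℤ} {t t' W : ℤ} (hC : W ≤ |C|) (hab : |a - b| < W)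
    (h : a + C * t = b + C * t') : t = t' := by
  by_contra hne
  have h1 : C * (t' - t) = a - b := by linarith
  have h2 : |C| * |t' - t| < W := by rw [← abs_mul, h1]; exact hab
  have h3 : 1 ≤ |t' - t| := Int.one_le_abs (by omega)
  nlinarith [abs_nonneg C]

theorem zcount_r {R S T : ℕ} (X : Finset (ℕ × ℕ × ℕ)) (hX : X ⊆ zbox R S T)
    (h : ∀ x ∈ X, ∀ y ∈ X, x.1 = y.1 → x = y) : X.card ≤ R := by
  calc X.card ≤ (Finset.range R).card := by
        apply Finset.card_le_card_of_injOn (fun x => x.1)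
        · intro x hx
          simpa using (mem_zbox.mp (hX hx)).1
        · intro x hx y hy hxy
          exact h x hx y hy hxy
    _ = R := Finset.card_range R

theorem zcount_s {R S T : ℕ} (X : Finset (ℕ × ℕ × ℕ)) (hX : X ⊆ zbox R S T)
    (h : ∀ x ∈ X, ∀ y ∈ X, x.2.1 = y.2.1 → x = y) : X.card ≤ S := by
  calc X.card ≤ (Finset.range S).card := by
        apply Finset.card_le_card_of_injOn (fun x => x.2.1)
        · intro x hx
          simpa using (mem_zbox.mp (hX hx)).2.1
        · intro x hx y hy hxy
          exact h x hx y hy hxy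
    _ = S := Finset.card_range S

/-- two coprime: residue class count -/
theorem zcount_AB {R S T : ℕ} (X : Finset (ℕ × ℕ × ℕ)) (hX : X ⊆ zbox R S T) (A B : ℕ)
    (hA : 0 < A) (hcop : Nat.Coprime A B) (c C : ℤ)
    (h : ∀ x ∈ X, (A : ℤ) * x.1 + B * x.2.1 + C * x.2.2 = c) : X.card ≤ T * (S / A + 1) := by
  calc X.card ≤ (Finset.range T ×ˢ Finset.range (S / A + 1)).card := by
        apply Finset.card_le_card_of_injOn (fun x => (x.2.2, x.2.1 / A))
        · intro x hx
          have := mem_zbox.mp (hX hx)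
          simp only [Finset.coe_product, Set.mem_prod, Finset.mem_coe, Finset.mem_range]
          exact ⟨this.2.2, Nat.lt_succ_of_le (Nat.div_le_div_right this.2.1.le)⟩
        · rintro ⟨r, s, t⟩ hx ⟨r', s', t'⟩ hy hxy
          simp only [Prod.mk.injEq] at hxy
          obtain ⟨rfl, hs⟩ := hxy
          have h1 := h _ hx
          have h2 := h _ hy
          simp only at h1 h2
          have h3 : (A : ℤ) * (r - r') = B * (s' - s) := by linarith
          have h4 : (A : ℤ) ∣ (s' - s) := by
            have : IsCoprime (A : ℤ) B := Nat.isCoprime_iff_coprime.mpr hcop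
            exact this.dvd_of_dvd_mul_left ⟨_, h3.symm⟩
          have h5 : s = s' := by
            have e1 := Nat.div_add_mod s A
            have e2 := Nat.div_add_mod s' A
            have m1 := Nat.mod_lt s hA
            have m2 := Nat.mod_lt s' hA
            rw [hs] at e1
            obtain ⟨w, hw⟩ := h4
            have : |(s' : ℤ) - s| < A := by
              rw [abs_lt]; omega
            have := Int.eq_zero_of_abs_lt_dvd ⟨w, hw⟩ this
            omega
          subst h5
          have h6 : (A : ℤ) * r = A * r' := by linarith
          have h7 : (r : ℤ) = r' := mul_left_cancel₀ (by exact_mod_cast hA.ne') h6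
          simp only [Prod.mk.injEq, and_true]
          exact_mod_cast h7
    _ = _ := by simp

end

section

open MvPolynomial

theorem zline_stage (N d R S T L D R' S' r1 A B : ℕ) (α γ : ℝ) (hα : 0 < α) (hγ : 0 < γ)
    (P : ℕ → MvPolynomial (Fin 2) ℝ) (hD : ∀ l < L, (P l).totalDegree ≤ D)
    (hv : ∀ x ∈ zbox R S T, ∑ l ∈ Finset.range L,
      eval (zpt N d x) (P l) * (α ^ x.1 * 10 ^ x.2.1 * γ ^ x.2.2) ^ l = 0)
    (hA : 0 < A) (hB : 0 < B) (hcop : Nat.Coprime A B) (hAr : D < r1 * A)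
    (X : Finset (ℕ × ℕ × ℕ)) (hX : X ⊆ zbox R' S' T) (c : ℝ)
    (hc : ∀ x ∈ X, (A : ℝ) * zpt N d x 0 + B * zpt N d x 1 = c) (hcard : L * D < X.card)
    (hN : R' ≤ N) (hR : R' + r1 + L * B ≤ R) (hS : S' + A + L * A ≤ S)
    (hθ : α ^ B ≠ 10 ^ A) : ∀ l < L, P l = 0 := by
  classical
  have hBr : (0 : ℝ) < B := by exact_mod_cast hB
  have hArr : (0 : ℝ) < A := by exact_mod_cast hA
  have stepa : ∀ r' < r1, ∀ s' < A, ∀ q : Fin 2 → ℝ,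
      (A : ℝ) * q 0 + B * q 1 = c + A * r' + B * (s' + L * A) → ∀ l < L, eval q (P l) = 0 := by
    intro r' hr' s' hs' q hq l hl
    have hline := lmn_line P L D hD (α ^ B / 10 ^ A) (by positivity)
      (by rw [Ne, div_eq_one_iff_eq (by positivity)]; exact hθ) q ![(B : ℝ), -(A : ℝ)]
      (X.image (fun x => (zpt N d x 0 + r' - q 0) / B)) (by
        rw [Finset.card_image_of_injOn]
        · exact hcard
        · intro x hx y hy hxy
          have h0 : zpt N d x 0 = zpt N d y 0 := by
            have := (div_left_inj' hBr.ne').mp hxy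
            linarith
          have h1 : zpt N d x 1 = zpt N d y 1 := by
            have e1 := hc x hx
            have e2 := hc y hy
            rw [h0] at e1
            have : (B : ℝ) * zpt N d x 1 = B * zpt N d y 1 := by linarith
            exact mul_left_cancel₀ hBr.ne' this
          apply zpt_inj (S := S') (T := T) (d := d) hN (hX hx) (hX hy)
          ext i; fin_cases i
          · exact h0
          · exact h1) (by
        intro τ hτ
        rw [Finset.mem_image] at hτ
        obtain ⟨x, hx, rfl⟩ := hτ
        refine ⟨α ^ (x.1 + r') * 10 ^ (x.2.1 + s' + L * A) * γ ^ x.2.2, by positivity, ?_⟩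
        intro i hi
        have hb := mem_zbox.mp (hX hx)
        have hiB : i * B ≤ L * B := Nat.mul_le_mul_right _ hi.le
        have hiA : i * A ≤ L * A := Nat.mul_le_mul_right _ hi.le
        have := hv (x.1 + r' + i * B, x.2.1 + s' + (L - i) * A, x.2.2) (by
          rw [mem_zbox]
          have : (L - i) * A ≤ L * A := Nat.mul_le_mul_right _ (Nat.sub_le _ _)
          simp only
          omega)
        rw [← this]
        apply Finset.sum_congr rfl
        intro l _
        have hcast : (((L - i : ℕ)) : ℝ) = L - i := by
          push_cast [Nat.cast_sub hi.le]; ring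
        congr 1
        · congr 2
          have e1 := hc x hx
          ext j; fin_cases j
          · simp only [zpt, Fin.zero_eta, Matrix.cons_val_zero, Pi.add_apply, Pi.smul_apply, smul_eq_mul]
            push_cast
            field_simp
            ring
          · simp only [zpt, Fin.mk_one, Matrix.cons_val_one, Matrix.cons_val_zero, Pi.add_apply, Pi.smul_apply, smul_eq_mul] at e1 ⊢
            push_cast
            rw [hcast]
            field_simp
            linear_combination hq - e1
        · congr 1
          have e2 : (10 : ℝ) ^ (x.2.1 + s' + L * A) = 10 ^ (x.2.1 + s' + (L - i) * A) * (10 ^ A) ^ i := by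
            rw [← pow_mul, ← pow_add]
            congr 1
            have : (L - i) * A + A * i = L * A := by
              rw [mul_comm A i, ← Nat.add_mul, Nat.sub_add_cancel hi.le]
            omega
          rw [e2, div_pow, pow_add α (x.1 + r'), mul_comm i B, pow_mul α B i]
          field_simp) l hl
    have := zln_eval q ![(B : ℝ), -(A : ℝ)] 0 (P l)
    rw [hline, Polynomial.eval_zero, zero_smul, add_zero] at this
    exact this.symm
  intro l hl
  apply MvPolynomial.funext
  intro p
  rw [map_zero]
  have hz : zln p ![1, 0] (P l) = 0 := by
    apply Polynomial.eq_zero_of_natDegree_lt_card_of_eval_eq_zero' _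
      ((Finset.range r1 ×ˢ Finset.range A).image
        (fun y => (c + A * (y.1 : ℝ) + B * ((y.2 : ℝ) + L * A) - A * p 0 - B * p 1) / A))
    · intro τ hτ
      rw [Finset.mem_image] at hτ
      obtain ⟨⟨r', s'⟩, hy, rfl⟩ := hτ
      simp only [Finset.mem_product, Finset.mem_range] at hy
      rw [zln_eval]
      apply stepa r' hy.1 s' hy.2 _ _ l hl
      simp only [Pi.add_apply, Pi.smul_apply, smul_eq_mul, Matrix.cons_val_zero, Matrix.cons_val_one]
      field_simp
      ring
    · rw [Finset.card_image_of_injOn]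
      · rw [Finset.card_product, Finset.card_range, Finset.card_range]
        exact lt_of_le_of_lt ((zln_natDegree _ _ _).trans (hD l hl)) hAr
      · rintro ⟨r', s'⟩ hx ⟨r2, s2⟩ hy hxy
        simp only [Finset.coe_product, Set.mem_prod, Finset.mem_coe, Finset.mem_range] at hx hy
        have h1 := (div_left_inj' hArr.ne').mp hxy
        simp only at h1
        have h2 : (A : ℤ) * r' + B * s' = A * r2 + B * s2 := by
          have : (A : ℝ) * r' + B * s' = A * r2 + B * s2 := by linarith
          exact_mod_cast this
        have h3 : (A : ℤ) * (r' - r2) = B * (s2 - s') := by linarith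
        have h4 : (A : ℤ) ∣ (s2 - s') := by
          have : IsCoprime (A : ℤ) B := Nat.isCoprime_iff_coprime.mpr hcop
          exact this.dvd_of_dvd_mul_left ⟨_, h3.symm⟩
        have := Int.eq_zero_of_abs_lt_dvd h4 (by rw [abs_lt]; omega)
        have h5 : s' = s2 := by omega
        subst h5
        have h6 : (A : ℤ) * r' = A * r2 := by linarith
        have h7 : (r' : ℤ) = r2 := mul_left_cancel₀ (by exact_mod_cast hA.ne') h6
        simp only [Prod.mk.injEq, and_true]
        exact_mod_cast h7
  have := zln_eval p ![1, 0] 0 (P l)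
  rw [hz, Polynomial.eval_zero, zero_smul, add_zero] at this
  exact this.symm

end

section

open MvPolynomial

theorem zgen (Γ T A R' S' : ℕ) (hT0 : 0 < T) (hA : 0 < A) (hΓ : 2 * Γ ≤ R' * S') (hS0 : 0 < S')
    (h : R' * S' * T ≤ (T * (S' / A + 1)) * Γ) : A * R' ≤ 2 * Γ := by
  by_contra hlt
  push Not at hlt
  have h3 : R' * S' ≤ (S' / A + 1) * Γ := by
    have : T * (R' * S') ≤ T * ((S' / A + 1) * Γ) := by linarith
    exact Nat.le_of_mul_le_mul_left this hT0
  have h4 : A * (S' / A) ≤ S' := Nat.mul_div_le _ _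
  have h5 : 2 * A * (R' * S') ≤ 2 * (A * (S' / A)) * Γ + A * (2 * Γ) := by nlinarith
  have h6 : 2 * (A * (S' / A)) * Γ ≤ S' * (2 * Γ) := by nlinarith
  have h7 : A * (2 * Γ) ≤ A * (R' * S') := Nat.mul_le_mul_left _ hΓ
  have h8 : S' * (2 * Γ) < S' * (A * R') := Nat.mul_lt_mul_of_pos_left hlt hS0
  nlinarith

set_option maxHeartbeats 2000000 in
theorem zero_est (N d R S T L D R' S' ra sa r1 : ℕ) (α γ : ℝ) (hα : 0 < α) (hα1 : α ≠ 1) (hγ : 0 < γ)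
    (P : ℕ → MvPolynomial (Fin 2) ℝ) (hD : ∀ l < L, (P l).totalDegree ≤ D)
    (hv : ∀ x ∈ zbox R S T, ∑ l ∈ Finset.range L,
      eval (zpt N d x) (P l) * (α ^ x.1 * 10 ^ x.2.1 * γ ^ x.2.2) ^ l = 0)
    (hra : 0 < ra) (hsa : 0 < sa)
    (hN : R' ≤ N) (hd : S' ≤ d) (hRL : R' + L ≤ R) (hSS : S' ≤ S)
    (hRB : ∀ B, B * S' ≤ 2 * (L * D) → R' + r1 + L * B ≤ R)
    (hSA : ∀ A, A * R' ≤ 2 * (L * D) → S' + A + L * A ≤ S)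
    (hΓ1 : 2 * (L * D) ≤ R' * S') (hΓ2 : L * D < S' * T) (hΓ3 : L * D < R' * T)
    (hΓ4 : (L * D) ^ 2 < R' * S' * T)
    (h1 : 10 * (L * D) * ((R' + ra) * (S' + sa) * T) ≤ (ra * sa) * (R' * S' * T))
    (h2 : 10 * (L * D) ^ 2 * ((R' + ra) * (S' + sa) * T) < 9 * (R' * S' * T) ^ 2)
    (hθ : ∀ A B : ℕ, 0 < A → 0 < B → α ^ B ≠ 10 ^ A)
    (hnd : ∀ A B : ℕ, 0 < A → 0 < B → Nat.Coprime A B → r1 * A ≤ D →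
      ((A * R' + B * S' : ℕ) : ℤ) ≤ |(B : ℤ) * d - A * N|) : ∀ l < L, P l = 0 := by
  classical
  by_contra hcon
  push Not at hcon
  obtain ⟨G, hG0, hGdeg, hGz⟩ := lmn_two P L D hcon hD α hα hα1 ![1, 0]
  set I := zbox R' S' T with hI
  have hIcard : I.card = R' * S' * T := zbox_card _ _ _
  have hinj := zpt_inj (S := S') (T := T) (d := d) hN
  set AA := I.image (zpt N d) with hAA
  have hAAcard : AA.card = R' * S' * T := by rw [hAA, Finset.card_image_of_injOn hinj, hIcard]
  set A' := (zbox (R' + ra) (S' + sa) T).image (zpt N d) with hA'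
  have hA'card : A'.card ≤ (R' + ra) * (S' + sa) * T := by
    rw [← zbox_card]; exact Finset.card_image_le
  set Sh := (Finset.range ra ×ˢ Finset.range sa).image (fun y => ![(y.1 : ℝ), (y.2 : ℝ)]) with hSh
  have hShcard : Sh.card = ra * sa := by
    rw [hSh, Finset.card_image_of_injective, Finset.card_product, Finset.card_range, Finset.card_range]
    rintro ⟨a, b⟩ ⟨a', b'⟩ h
    have h0 := congrFun h 0
    have h1 := congrFun h 1
    simp at h0 h1
    simp [h0, h1]
  have hpos : 0 < R' * S' * T := by omega
  obtain ⟨g, hg, g', hg', hne, c, hc⟩ := zz_rich AA A' Sh G (L * D)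
    (by
      intro g hg p hp
      simp only [hSh, hAA, Finset.mem_image, Finset.mem_product, Finset.mem_range] at hg hp
      obtain ⟨⟨a, b⟩, hab, rfl⟩ := hg
      obtain ⟨x, hx, rfl⟩ := hp
      rw [hA', Finset.mem_image]
      refine ⟨(x.1 + a, x.2.1 + b, x.2.2), ?_, ?_⟩
      · rw [mem_zbox] at hx ⊢
        simp only at hab ⊢
        omega
      · ext j; fin_cases j
        · simp [zpt]; ring
        · simp [zpt]; ring)
    hG0 hGdeg
    (by
      intro p hp
      rw [hAA, Finset.mem_image] at hp
      obtain ⟨x, hx, rfl⟩ := hp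
      apply hGz _ (α ^ x.1 * 10 ^ x.2.1 * γ ^ x.2.2) (by positivity)
      intro i hi
      have hb := mem_zbox.mp hx
      have := hv (x.1 + i, x.2.1, x.2.2) (by rw [mem_zbox]; simp only; omega)
      refine Eq.trans ?_ this
      apply Finset.sum_congr rfl
      intro l _
      congr 1
      · congr 2
        ext j; fin_cases j
        · simp [zpt]; ring
        · simp [zpt]
      · congr 1
        simp only [pow_add]; ring)
    (by rw [← Finset.card_pos, hAAcard]; exact hpos)
    (by rw [hShcard]; positivity)
    (by rw [hShcard, hAAcard]; exact (Nat.mul_le_mul_left _ hA'card).trans h1)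
    (by rw [hAAcard]; exact lt_of_le_of_lt (Nat.mul_le_mul_left _ hA'card) h2)
  simp only [hSh, Finset.mem_image, Finset.mem_product, Finset.mem_range] at hg hg'
  obtain ⟨⟨a, b⟩, hab, rfl⟩ := hg
  obtain ⟨⟨a', b'⟩, hab', rfl⟩ := hg'
  set u0 : ℤ := (a : ℤ) - a' with hu0
  set u1 : ℤ := (b : ℤ) - b' with hu1
  have hune : ¬ (u0 = 0 ∧ u1 = 0) := by
    rintro ⟨h0, h1⟩
    apply hne
    have : a = a' := by omega
    have : b = b' := by omega
    simp [*]
  set X := I.filter (fun x => (u1 : ℝ) * zpt N d x 0 - u0 * zpt N d x 1 = c) with hX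
  have hXsub : X ⊆ zbox R' S' T := Finset.filter_subset _ _
  have hXcard : R' * S' * T ≤ X.card * (L * D) := by
    rw [hAAcard] at hc
    refine hc.trans (Nat.mul_le_mul_right _ ?_)
    have : (AA.filter (fun p => ((![(a : ℝ), (b : ℝ)] : Fin 2 → ℝ) - ![(a' : ℝ), (b' : ℝ)]) 1 * p 0 - ((![(a : ℝ), (b : ℝ)] : Fin 2 → ℝ) - ![(a' : ℝ), (b' : ℝ)]) 0 * p 1 = c)) ⊆ X.image (zpt N d) := by
      intro p hp
      rw [Finset.mem_filter, hAA, Finset.mem_image] at hp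
      obtain ⟨⟨x, hx, rfl⟩, h⟩ := hp
      rw [Finset.mem_image]
      refine ⟨x, ?_, rfl⟩
      rw [hX, Finset.mem_filter]
      refine ⟨hx, ?_⟩
      rw [← h]
      simp [hu0, hu1]
    exact (Finset.card_le_card this).trans Finset.card_image_le
  have hXeq : ∀ x ∈ X, ∀ y ∈ X, u1 * ((x.1 : ℤ) - N * x.2.2) - u0 * ((x.2.1 : ℤ) + d * x.2.2)
      = u1 * ((y.1 : ℤ) - N * y.2.2) - u0 * ((y.2.1 : ℤ) + d * y.2.2) := by
    intro x hx y hy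
    have e1 := (Finset.mem_filter.mp hx).2
    have e2 := (Finset.mem_filter.mp hy).2
    rw [← e2] at e1
    simp only [zpt, Matrix.cons_val_zero, Matrix.cons_val_one] at e1
    exact_mod_cast e1
  -- few points contradictions
  have fewR : ¬ X.card ≤ R' := by
    intro h
    have h3 : R' * S' * T ≤ R' * (L * D) := hXcard.trans (Nat.mul_le_mul_right _ h)
    have hR0 : 0 < R' := by
      rcases Nat.eq_zero_or_pos R' with h | h
      · rw [h] at hpos; simp at hpos
      · exact h
    have h4 : R' * (S' * T) ≤ R' * (L * D) := by rw [← mul_assoc]; exact h3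
    have := Nat.le_of_mul_le_mul_left h4 hR0
    omega
  have fewS : ¬ X.card ≤ S' := by
    intro h
    have h3 : R' * S' * T ≤ S' * (L * D) := hXcard.trans (Nat.mul_le_mul_right _ h)
    have hS0 : 0 < S' := by
      rcases Nat.eq_zero_or_pos S' with h | h
      · rw [h] at hpos; simp at hpos
      · exact h
    have h4 : S' * (R' * T) ≤ S' * (L * D) := by rw [← mul_assoc, mul_comm S' R']; exact h3
    have := Nat.le_of_mul_le_mul_left h4 hS0
    omega
  have tuniq : ∀ (A B C : ℤ), B ≠ 0 → |A| * R' + |B| * S' ≤ |C| →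
      (∀ x ∈ X, ∀ y ∈ X, A * x.1 + B * x.2.1 + C * x.2.2 = A * y.1 + B * y.2.1 + C * y.2.2) → False := by
    intro A B C hB hC h
    apply fewR
    apply zcount_r X hXsub
    rintro ⟨r, s, t⟩ hx ⟨r', s', t'⟩ hy hr
    have e := h _ hx _ hy
    have b1 := mem_zbox.mp (hXsub hx)
    have b2 := mem_zbox.mp (hXsub hy)
    simp only at hr e b1 b2
    subst hr
    have ht : (t : ℤ) = t' := by
      apply zt_unique hC _ e
      have : A * (r : ℤ) + B * s - (A * r + B * s') = B * (s - s') := by ring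
      rw [this, abs_mul]
      have hs : |(s : ℤ) - s'| < S' := by rw [abs_lt]; omega
      have hBp : 0 < |B| := abs_pos.mpr hB
      have h9 : 0 ≤ |A| * (R' : ℤ) := by positivity
      have h10 : |B| * |(s : ℤ) - s'| < |B| * S' := mul_lt_mul_of_pos_left hs hBp
      linarith only [h9, h10]
    rw [ht] at e
    have e2 : B * (s : ℤ) = B * s' := by linarith
    have := mul_left_cancel₀ hB e2
    simp only [Prod.mk.injEq, true_and]
    omega
  by_cases hz1 : u1 = 0
  · have hz0 : u0 ≠ 0 := fun h => hune ⟨h, hz1⟩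
    apply tuniq 0 u0 (u0 * d) hz0
    · rw [abs_zero, zero_mul, zero_add, abs_mul, Nat.abs_cast]
      apply mul_le_mul_of_nonneg_left _ (abs_nonneg _)
      exact_mod_cast hd
    · intro x hx y hy
      have := hXeq x hx y hy
      rw [hz1] at this
      linarith
  by_cases hz0 : u0 = 0
  · apply fewS
    apply zcount_s X hXsub
    rintro ⟨r, s, t⟩ hx ⟨r', s', t'⟩ hy hs
    have e := hXeq _ hx _ hy
    have b1 := mem_zbox.mp (hXsub hx)
    have b2 := mem_zbox.mp (hXsub hy)
    simp only at hs e b1 b2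
    subst hs
    rw [hz0, zero_mul, zero_mul, sub_zero, sub_zero] at e
    have e1 := mul_left_cancel₀ hz1 e
    have ht : (t : ℤ) = t' := by
      apply zt_unique (C := -(N : ℤ)) (a := r) (b := r') (W := R')
      · rw [abs_neg, Nat.abs_cast]; exact_mod_cast hN
      · rw [abs_lt]; omega
      · linarith
    rw [ht] at e1
    simp only [Prod.mk.injEq, true_and]
    omega
  rcases lt_or_ge 0 (u0 * u1) with hsign | hsign
  · apply tuniq u1 (-u0) (-(u1 * N + u0 * d)) (neg_ne_zero.mpr hz0)
    · rw [abs_neg, abs_neg]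
      have : |u1 * (N : ℤ) + u0 * d| = |u1| * N + |u0| * d := by
        rcases pos_and_pos_or_neg_and_neg_of_mul_pos hsign with ⟨p0, p1⟩ | ⟨p0, p1⟩
        · rw [abs_of_pos p0, abs_of_pos p1, abs_of_nonneg (by positivity)]
        · rw [abs_of_neg p0, abs_of_neg p1, abs_of_nonpos]
          · ring
          · have : 0 ≤ (-u1) * (N : ℤ) + (-u0) * d := by
              have : 0 ≤ -u1 := by omega
              have : 0 ≤ -u0 := by omega
              positivity
            linarith
      rw [this]
      have i1 : |u1| * (R' : ℤ) ≤ |u1| * N := mul_le_mul_of_nonneg_left (by exact_mod_cast hN) (abs_nonneg _)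
      have i2 : |u0| * (S' : ℤ) ≤ |u0| * d := mul_le_mul_of_nonneg_left (by exact_mod_cast hd) (abs_nonneg _)
      linarith
    · intro x hx y hy
      have := hXeq x hx y hy
      linarith
  -- opposite signs
  have hsign' : u0 * u1 < 0 := lt_of_le_of_ne hsign (mul_ne_zero hz0 hz1)
  obtain ⟨A, B, hA, hB, hcop, q, hq, hAq, hBq⟩ : ∃ A B : ℕ, 0 < A ∧ 0 < B ∧ Nat.Coprime A B ∧
      ∃ q : ℤ, q ≠ 0 ∧ u1 = q * A ∧ u0 = -(q * B) := by
    have hgpos : 0 < Nat.gcd u1.natAbs u0.natAbs := Nat.gcd_pos_of_pos_left _ (Int.natAbs_pos.mpr hz1)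
    obtain ⟨A, hA⟩ := Nat.gcd_dvd_left u1.natAbs u0.natAbs
    obtain ⟨B, hB⟩ := Nat.gcd_dvd_right u1.natAbs u0.natAbs
    have hcop := Nat.coprime_div_gcd_div_gcd hgpos
    have eA : u1.natAbs / Nat.gcd u1.natAbs u0.natAbs = A := by
      exact Nat.div_eq_of_eq_mul_right hgpos hA
    have eB : u0.natAbs / Nat.gcd u1.natAbs u0.natAbs = B := Nat.div_eq_of_eq_mul_right hgpos hB
    rw [eA, eB] at hcop
    set gg := Nat.gcd u1.natAbs u0.natAbs with hgg
    have hA0 : 0 < A := by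
      rcases Nat.eq_zero_or_pos A with h | h
      · rw [h, mul_zero] at hA; omega
      · exact h
    have hB0 : 0 < B := by
      rcases Nat.eq_zero_or_pos B with h | h
      · rw [h, mul_zero] at hB; omega
      · exact h
    have hA2 : (u1.natAbs : ℤ) = gg * A := by exact_mod_cast hA
    have hB2 : (u0.natAbs : ℤ) = gg * B := by exact_mod_cast hB
    rcases mul_neg_iff.mp hsign' with ⟨p0, p1⟩ | ⟨p0, p1⟩
    · refine ⟨A, B, hA0, hB0, hcop, -(gg : ℤ), by omega, ?_, ?_⟩
      · rw [neg_mul, ← hA2]; omega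
      · rw [neg_mul, neg_neg, ← hB2]; omega
    · refine ⟨A, B, hA0, hB0, hcop, (gg : ℤ), by omega, ?_, ?_⟩
      · rw [← hA2]; omega
      · rw [← hB2]; omega
  have hXeq2 : ∀ x ∈ X, ∀ y ∈ X, (A : ℤ) * x.1 + B * x.2.1 + (B * d - A * N) * x.2.2
      = A * y.1 + B * y.2.1 + (B * d - A * N) * y.2.2 := by
    intro x hx y hy
    have := hXeq x hx y hy
    rw [hAq, hBq] at this
    apply mul_left_cancel₀ hq
    linear_combination this
  have hXpos : 0 < X.card := by
    rcases Nat.eq_zero_or_pos X.card with h | h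
    · exact absurd (by rw [h]; exact Nat.zero_le _) fewR
    · exact h
  obtain ⟨x0, hx0⟩ := Finset.card_pos.mp hXpos
  have hcnt1 := zcount_AB X hXsub A B hA hcop _ _ (fun x hx => hXeq2 x hx x0 hx0)
  have hcnt2 : X.card ≤ T * (R' / B + 1) := by
    have := zcount_AB (R := S') (S := R') (T := T) (X.image (fun x => (x.2.1, x.1, x.2.2))) (by
      intro y hy
      rw [Finset.mem_image] at hy
      obtain ⟨x, hx, rfl⟩ := hy
      have := mem_zbox.mp (hXsub hx)
      rw [mem_zbox]; simp only; omega) B A hB hcop.symm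
      (A * x0.1 + B * x0.2.1 + (B * d - A * N) * x0.2.2) (B * d - A * N) (by
      intro y hy
      rw [Finset.mem_image] at hy
      obtain ⟨x, hx, rfl⟩ := hy
      have := hXeq2 x hx x0 hx0
      simp only
      linarith)
    rwa [Finset.card_image_of_injective] at this
    rintro ⟨r, s, t⟩ ⟨r', s', t'⟩ h
    simp only [Prod.mk.injEq] at h ⊢
    tauto
  have hT0 : 0 < T := by
    rcases Nat.eq_zero_or_pos T with h | h
    · rw [h] at hpos; simp at hpos
    · exact h
  have hR0 : 0 < R' := by
    rcases Nat.eq_zero_or_pos R' with h | h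
    · rw [h] at hpos; simp at hpos
    · exact h
  have hS0 : 0 < S' := by
    rcases Nat.eq_zero_or_pos S' with h | h
    · rw [h] at hpos; simp at hpos
    · exact h
  have hAb : A * R' ≤ 2 * (L * D) := zgen (L * D) T A R' S' hT0 hA hΓ1 hS0 (hXcard.trans (Nat.mul_le_mul_right _ hcnt1))
  have hBb : B * S' ≤ 2 * (L * D) := zgen (L * D) T B S' R' hT0 hB (by rw [mul_comm S']; exact hΓ1) hR0
    (by rw [mul_comm S']; exact hXcard.trans (Nat.mul_le_mul_right _ hcnt2))
  rcases le_or_gt (r1 * A) D with hsmall | hbig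
  · apply tuniq A B (B * d - A * N) (by exact_mod_cast hB.ne')
    · have := hnd A B hA hB hcop hsmall
      push_cast at this
      rwa [Nat.abs_cast, Nat.abs_cast]
    · exact hXeq2
  · obtain ⟨l, hl, hl0⟩ := hcon
    apply hl0
    refine zline_stage N d R S T L D R' S' r1 A B α γ hα hγ P hD hv hA hB hcop hbig X hXsub
      (A * zpt N d x0 0 + B * zpt N d x0 1) ?_ ?_ hN (hRB B hBb) (hSA A hAb) (hθ A B hA hB) l hl
    · intro x hx
      have := hXeq2 x hx x0 hx0
      have e : (A : ℝ) * x.1 + B * x.2.1 + (B * d - A * N) * x.2.2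
        = A * x0.1 + B * x0.2.1 + (B * d - A * N) * x0.2.2 := by exact_mod_cast this
      simp only [zpt, Matrix.cons_val_zero, Matrix.cons_val_one]
      linear_combination e
    · by_contra hle
      push Not at hle
      have : X.card * (L * D) ≤ (L * D) * (L * D) := Nat.mul_le_mul_right _ hle
      nlinarith

end

section

/-- span membership -/
theorem du_span {ι : Type*} [Fintype ι] (x w y : ι → ℝ) (u v z : ℝ) (hy : ∀ ξ, y ξ = u * w ξ + v + z * x ξ)
    (P Q : ℕ) : ∀ (j i m : ℕ), i + j < P → m + j < Q →
    (fun ξ => x ξ ^ i * y ξ ^ j * w ξ ^ m) ∈ Submodule.span ℝ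
      (((Finset.range P ×ˢ Finset.range Q).image (fun a : ℕ × ℕ => fun ξ => x ξ ^ a.1 * w ξ ^ a.2) : Finset (ι → ℝ)) : Set (ι → ℝ)) := by
  intro j
  induction j with
  | zero =>
    intro i m hi hm
    apply Submodule.subset_span
    rw [Finset.mem_coe, Finset.mem_image]
    refine ⟨(i, m), by simp; omega, ?_⟩
    ext ξ; simp
  | succ j ih =>
    intro i m hi hm
    have h1 := Submodule.smul_mem _ u (ih i (m + 1) (by omega) (by omega))
    have h2 := Submodule.smul_mem _ v (ih i m (by omega) (by omega))
    have h3 := Submodule.smul_mem _ z (ih (i + 1) m (by omega) (by omega))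
    have := Submodule.add_mem _ (Submodule.add_mem _ h1 h2) h3
    convert this using 1
    ext ξ
    simp only [Pi.add_apply, Pi.smul_apply, smul_eq_mul]
    rw [pow_succ (y ξ), hy ξ]
    ring

theorem du_vanish {ι : Type*} [Fintype ι] [DecidableEq ι] (x w y : ι → ℝ) (u v z : ℝ)
    (hy : ∀ ξ, y ξ = u * w ξ + v + z * x ξ) (K M0 : ℕ) (I J : ι → ℕ) (hIJ : ∀ c, I c + J c < K)
    (Ex : Finset ι) (p : ι → ι → ℝ) (hp : ∀ c, c ∉ Ex → ∀ ξ, p c ξ = x ξ ^ I c * y ξ ^ J c)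
    (m : ι → ℕ) (hm : ∑ c, m c + M0 * Ex.card <
      ∑ M ∈ Finset.range M0, (Fintype.card ι - K * (K + M + 1))) :
    (Matrix.of (fun c ξ => p c ξ * w ξ ^ m c)).det = 0 := by
  by_contra hdet
  have hli := Matrix.linearIndependent_rows_of_det_ne_zero hdet
  have hcount : ∀ M, Fintype.card ι - K * (K + M + 1) ≤ (Finset.univ.filter (fun c => M < m c)).card + Ex.card := by
    intro M
    set A := Finset.univ.filter (fun c => c ∉ Ex ∧ m c ≤ M) with hA
    have hAcard : A.card ≤ K * (K + M + 1) := by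
      have hsub : LinearIndependent ℝ (fun c : A => (Matrix.of (fun c ξ => p c ξ * w ξ ^ m c)).row (c : ι)) :=
        hli.comp _ Subtype.val_injective
      set B := ((Finset.range K ×ˢ Finset.range (K + M + 1)).image (fun a : ℕ × ℕ => fun ξ => x ξ ^ a.1 * w ξ ^ a.2) : Finset (ι → ℝ)) with hB
      have hle := linearIndependent_le_span_aux' (R := ℝ) _ hsub (B : Set (ι → ℝ)) (by
        rintro _ ⟨⟨c, hc⟩, rfl⟩
        simp only [hA, Finset.mem_filter, Finset.mem_univ, true_and] at hc
        have := du_span x w y u v z hy K (K + M + 1) (J c) (I c) (m c) (hIJ c) (by have := hIJ c; omega)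
        have e : (Matrix.of (fun c ξ => p c ξ * w ξ ^ m c)).row c = (fun ξ => x ξ ^ I c * y ξ ^ J c * w ξ ^ m c) := by
          ext ξ
          simp [Matrix.row, hp c hc.1 ξ]
        show (Matrix.of (fun c ξ => p c ξ * w ξ ^ m c)).row c ∈ Submodule.span ℝ (B : Set (ι → ℝ))
        rw [e]
        exact this)
      have h2 : A.card ≤ B.card := by simpa using hle
      refine h2.trans (Finset.card_image_le.trans ?_)
      simp
    have hcov : (Finset.univ : Finset ι) ⊆ A ∪ ((Finset.univ.filter (fun c => M < m c)) ∪ Ex) := by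
      intro c _
      simp only [hA, Finset.mem_union, Finset.mem_filter, Finset.mem_univ, true_and]
      by_cases h : c ∈ Ex
      · tauto
      · rcases le_or_gt (m c) M with h2 | h2 <;> tauto
    have h3 := Finset.card_le_card hcov
    have h4 := Finset.card_union_le A ((Finset.univ.filter (fun c => M < m c)) ∪ Ex)
    have h5 := Finset.card_union_le (Finset.univ.filter (fun c => M < m c)) Ex
    rw [Finset.card_univ] at h3
    omega
  have hsum : ∑ M ∈ Finset.range M0, (Finset.univ.filter (fun c => M < m c)).card ≤ ∑ c, m c := by
    simp_rw [Finset.card_filter]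
    rw [Finset.sum_comm]
    apply Finset.sum_le_sum
    intro c _
    rw [← Finset.card_filter]
    calc ((Finset.range M0).filter (fun M => M < m c)).card ≤ (Finset.range (m c)).card := by
          apply Finset.card_le_card
          intro M hM
          simp only [Finset.mem_filter] at hM
          simpa using hM.2
      _ = m c := Finset.card_range _
  have h6 := Finset.sum_le_sum (s := Finset.range M0) (fun M _ => hcount M)
  rw [Finset.sum_add_distrib, Finset.sum_const, Finset.card_range, smul_eq_mul] at h6
  omega

theorem du_moment {ι : Type*} [Fintype ι] [DecidableEq ι] (w lam : ι → ℝ) (p : ι → ι → ℝ) (Θ : ℕ)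
    (h0 : ∀ m : ι → ℕ, ∑ c, m c < Θ → (Matrix.of (fun c ξ => p c ξ * w ξ ^ m c)).det = 0)
    (n : ℕ) (hn : n < Θ) :
    ∑ σ : Equiv.Perm ι, (Equiv.Perm.sign σ : ℝ) * (∏ c, p c (σ c)) * (∑ c, lam c * w (σ c)) ^ n = 0 := by
  simp_rw [Finset.sum_pow_eq_sum_piAntidiag, Finset.mul_sum]
  rw [Finset.sum_comm]
  apply Finset.sum_eq_zero
  intro m hm
  rw [Finset.mem_piAntidiag] at hm
  have h := h0 m (by rw [hm.1]; exact hn)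
  rw [← Matrix.det_transpose, Matrix.det_apply'] at h
  have e : ∀ σ : Equiv.Perm ι, (Equiv.Perm.sign σ : ℝ) * (∏ c, p c (σ c)) *
      ((Nat.multinomial Finset.univ m : ℝ) * ∏ c, (lam c * w (σ c)) ^ m c)
      = ((Nat.multinomial Finset.univ m : ℝ) * ∏ c, lam c ^ m c) * ((Equiv.Perm.sign σ : ℝ) * ∏ c, (p c (σ c) * w (σ c) ^ m c)) := by
    intro σ
    rw [Finset.prod_mul_distrib]
    simp_rw [mul_pow]
    rw [Finset.prod_mul_distrib]
    ring
  simp_rw [e]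
  rw [← Finset.mul_sum]
  simp only [Matrix.transpose_apply, Matrix.of_apply] at h
  rw [h, mul_zero]

theorem du_tail (c ρ : ℝ) (hρ : 1 ≤ ρ) (Θ : ℕ) :
    |Real.exp c - ∑ m ∈ Finset.range Θ, c ^ m / m.factorial| ≤ ρ⁻¹ ^ Θ * Real.exp (ρ * |c|) := by
  have h1 := NormedSpace.expSeries_div_hasSum_exp (𝔸 := ℝ) c
  rw [← Real.exp_eq_exp_ℝ] at h1
  have h2 := (hasSum_nat_add_iff' Θ).mpr h1
  have h3 := NormedSpace.expSeries_div_hasSum_exp (𝔸 := ℝ) (ρ * |c|)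
  rw [← Real.exp_eq_exp_ℝ] at h3
  have h4 := h3.mul_left (ρ⁻¹ ^ Θ)
  rw [← h2.tsum_eq, ← h4.tsum_eq]
  have hρ0 : 0 < ρ := by linarith
  have hb : ∀ m : ℕ, ‖c ^ (m + Θ) / ((m + Θ).factorial : ℝ)‖ ≤ ρ⁻¹ ^ Θ * ((ρ * |c|) ^ (m + Θ) / ((m + Θ).factorial : ℝ)) := by
    intro m
    rw [norm_div, norm_pow, Real.norm_eq_abs, Real.norm_eq_abs, Nat.abs_cast, mul_pow, ← mul_div_assoc]
    gcongr
    rw [← mul_assoc, pow_add ρ, ← mul_assoc, mul_comm (ρ⁻¹ ^ Θ), mul_assoc (ρ ^ m), ← mul_pow, inv_mul_cancel₀ hρ0.ne', one_pow, mul_one]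
    have : 1 ≤ ρ ^ m := one_le_pow₀ hρ
    nlinarith [pow_nonneg (abs_nonneg c) (m + Θ)]
  have hs := h4.summable
  have hs2 : Summable (fun m : ℕ => ρ⁻¹ ^ Θ * ((ρ * |c|) ^ (m + Θ) / ((m + Θ).factorial : ℝ))) :=
    (summable_nat_add_iff (f := fun m : ℕ => ρ⁻¹ ^ Θ * ((ρ * |c|) ^ m / (m.factorial : ℝ))) Θ).mpr hs
  have h5 := tsum_of_norm_bounded hs2.hasSum hb
  rw [Real.norm_eq_abs] at h5
  refine h5.trans ?_
  have h6 := hs.sum_add_tsum_nat_add Θ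
  have h7 : 0 ≤ ∑ m ∈ Finset.range Θ, ρ⁻¹ ^ Θ * ((ρ * |c|) ^ m / (m.factorial : ℝ)) :=
    Finset.sum_nonneg fun m _ => by positivity
  linarith

end

section

theorem du_bound1 {ι : Type*} [Fintype ι] [DecidableEq ι] (w lam : ι → ℝ) (p : ι → ι → ℝ) (Θ : ℕ)
    (h0 : ∀ m : ι → ℕ, ∑ c, m c < Θ → (Matrix.of (fun c ξ => p c ξ * w ξ ^ m c)).det = 0)
    (B : ι → ℝ) (hB : ∀ c ξ, |p c ξ| ≤ B c) (W : ℝ) (hW : ∀ ξ, |w ξ| ≤ W) (ρ : ℝ) (hρ : 1 ≤ ρ) :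
    |(Matrix.of (fun c ξ => p c ξ * Real.exp (lam c * w ξ))).det| ≤
      (Fintype.card ι).factorial * ((∏ c, B c) * (ρ⁻¹ ^ Θ * Real.exp (ρ * ((∑ c, |lam c|) * W)))) := by
  have hρ0 : 0 < ρ := by linarith
  have e1 : (Matrix.of (fun c ξ => p c ξ * Real.exp (lam c * w ξ))).det
      = ∑ σ : Equiv.Perm ι, (Equiv.Perm.sign σ : ℝ) * (∏ c, p c (σ c)) * Real.exp (∑ c, lam c * w (σ c)) := by
    rw [← Matrix.det_transpose, Matrix.det_apply']
    apply Finset.sum_congr rfl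
    intro σ _
    simp only [Matrix.transpose_apply, Matrix.of_apply]
    rw [Finset.prod_mul_distrib, Real.exp_sum, mul_assoc]
  have e2 : ∑ σ : Equiv.Perm ι, (Equiv.Perm.sign σ : ℝ) * (∏ c, p c (σ c)) *
      ∑ m ∈ Finset.range Θ, (∑ c, lam c * w (σ c)) ^ m / m.factorial = 0 := by
    simp_rw [Finset.mul_sum]
    rw [Finset.sum_comm]
    apply Finset.sum_eq_zero
    intro m hm
    have := du_moment w lam p Θ h0 m (Finset.mem_range.mp hm)
    simp_rw [← mul_div_assoc]
    rw [← Finset.sum_div, this, zero_div]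
  have e3 : (Matrix.of (fun c ξ => p c ξ * Real.exp (lam c * w ξ))).det
      = ∑ σ : Equiv.Perm ι, (Equiv.Perm.sign σ : ℝ) * (∏ c, p c (σ c)) *
        (Real.exp (∑ c, lam c * w (σ c)) - ∑ m ∈ Finset.range Θ, (∑ c, lam c * w (σ c)) ^ m / m.factorial) := by
    simp_rw [mul_sub]
    rw [Finset.sum_sub_distrib, e2, sub_zero, e1]
  rw [e3]
  refine (Finset.abs_sum_le_sum_abs _ _).trans ?_
  have hterm : ∀ σ : Equiv.Perm ι, |(Equiv.Perm.sign σ : ℝ) * (∏ c, p c (σ c)) *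
        (Real.exp (∑ c, lam c * w (σ c)) - ∑ m ∈ Finset.range Θ, (∑ c, lam c * w (σ c)) ^ m / m.factorial)|
        ≤ (∏ c, B c) * (ρ⁻¹ ^ Θ * Real.exp (ρ * ((∑ c, |lam c|) * W))) := by
    intro σ
    rw [abs_mul, abs_mul]
    have hs : |((Equiv.Perm.sign σ : ℤ) : ℝ)| = 1 := by
      rcases Int.units_eq_one_or (Equiv.Perm.sign σ) with h | h <;> simp [h]
    rw [hs, one_mul, Finset.abs_prod]
    have hprod : ∏ c, |p c (σ c)| ≤ ∏ c, B c :=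
      Finset.prod_le_prod (fun c _ => abs_nonneg _) (fun c _ => hB c _)
    have hB0 : 0 ≤ ∏ c, B c := Finset.prod_nonneg fun c _ => (abs_nonneg _).trans (hB c c)
    refine mul_le_mul hprod ?_ (abs_nonneg _) hB0
    refine (du_tail _ ρ hρ Θ).trans ?_
    gcongr
    refine (Finset.abs_sum_le_sum_abs _ _).trans ?_
    rw [Finset.sum_mul]
    apply Finset.sum_le_sum
    intro c _
    rw [abs_mul]
    exact mul_le_mul_of_nonneg_left (hW _) (abs_nonneg _)
  refine (Finset.sum_le_sum fun σ _ => hterm σ).trans ?_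
  rw [Finset.sum_const, Finset.card_univ, Fintype.card_perm, nsmul_eq_mul]

theorem du_main {ι : Type*} [Fintype ι] [DecidableEq ι] (x w y ys lam : ι → ℝ) (u v z : ℝ)
    (hy : ∀ ξ, ys ξ = u * w ξ + v + z * x ξ) (K M0 : ℕ) (I J : ι → ℕ) (hIJ : ∀ c, I c + J c < K)
    (X W ρ ε : ℝ) (hX : 1 ≤ X) (hx : ∀ ξ, |x ξ| ≤ X) (hy1 : ∀ ξ, |y ξ| ≤ X) (hy2 : ∀ ξ, |ys ξ| ≤ X)
    (hε : ∀ ξ, |y ξ - ys ξ| ≤ ε) (hW : ∀ ξ, |w ξ| ≤ W) (hρ : 1 ≤ ρ) (hε2 : ε * K * ρ ^ M0 ≤ 1) :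
    |(Matrix.of (fun c ξ => x ξ ^ I c * y ξ ^ J c * Real.exp (lam c * w ξ))).det| ≤
      2 ^ (Fintype.card ι) * ((Fintype.card ι).factorial * (X ^ (∑ c, (I c + J c)) *
      (ρ⁻¹ ^ (∑ M ∈ Finset.range M0, (Fintype.card ι - K * (K + M + 1))) *
        Real.exp (ρ * ((∑ c, |lam c|) * W))))) := by
  classical
  have hρ0 : 0 < ρ := by linarith
  set Θ := ∑ M ∈ Finset.range M0, (Fintype.card ι - K * (K + M + 1)) with hΘ
  set r1 : ι → ι → ℝ := fun c ξ => x ξ ^ I c * (y ξ ^ J c - ys ξ ^ J c) * Real.exp (lam c * w ξ) with hr1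
  set r2 : ι → ι → ℝ := fun c ξ => x ξ ^ I c * ys ξ ^ J c * Real.exp (lam c * w ξ) with hr2
  have e1 : (Matrix.of (fun c ξ => x ξ ^ I c * y ξ ^ J c * Real.exp (lam c * w ξ))).det
      = ∑ s : Finset ι, (Matrix.of (s.piecewise r1 r2)).det := by
    have := (Matrix.detRowAlternating (n := ι) (R := ℝ)).toMultilinearMap.map_add_univ r1 r2
    have e2 : r1 + r2 = (fun c ξ => x ξ ^ I c * y ξ ^ J c * Real.exp (lam c * w ξ)) := by
      ext c ξ
      simp only [hr1, hr2, Pi.add_apply]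
      ring
    rw [e2] at this
    exact this
  rw [e1]
  refine (Finset.abs_sum_le_sum_abs _ _).trans ?_
  have hterm : ∀ s : Finset ι, |(Matrix.of (s.piecewise r1 r2)).det| ≤
      ((Fintype.card ι).factorial * (X ^ (∑ c, (I c + J c)) *
      (ρ⁻¹ ^ Θ * Real.exp (ρ * ((∑ c, |lam c|) * W))))) := by
    intro s
    set p : ι → ι → ℝ := fun c ξ => if c ∈ s then x ξ ^ I c * (y ξ ^ J c - ys ξ ^ J c) else x ξ ^ I c * ys ξ ^ J c with hp
    set B : ι → ℝ := fun c => if c ∈ s then X ^ (I c + J c) * (ε * K) else X ^ (I c + J c) with hB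
    have hpB : ∀ c ξ, |p c ξ| ≤ B c := by
      intro c ξ
      have hxi : |x ξ| ^ I c ≤ X ^ I c := pow_le_pow_left₀ (abs_nonneg _) (hx ξ) _
      by_cases hc : c ∈ s
      · simp only [hp, hB, if_pos hc]
        rw [abs_mul, abs_pow, pow_add, mul_assoc]
        have h1 := abs_pow_sub_pow_le (y ξ) (ys ξ) (J c)
        have hmax : max |y ξ| |ys ξ| ≤ X := max_le (hy1 ξ) (hy2 ξ)
        have h2 : max |y ξ| |ys ξ| ^ (J c - 1) ≤ X ^ (J c) :=
          (pow_le_pow_left₀ (le_max_of_le_left (abs_nonneg _)) hmax _).trans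
            (pow_le_pow_right₀ hX (Nat.sub_le _ _))
        have hJ : (J c : ℝ) ≤ K := by
          have := hIJ c
          exact_mod_cast (by omega : J c ≤ K)
        have h3 : |y ξ ^ J c - ys ξ ^ J c| ≤ X ^ J c * (ε * K) := by
          refine h1.trans ?_
          have hε0 : 0 ≤ ε := (abs_nonneg _).trans (hε ξ)
          calc |y ξ - ys ξ| * (J c : ℝ) * max |y ξ| |ys ξ| ^ (J c - 1)
              ≤ ε * K * X ^ J c := by
                apply mul_le_mul _ h2 (by positivity) (by positivity)
                exact mul_le_mul (hε ξ) hJ (by positivity) hε0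
            _ = _ := by ring
        exact mul_le_mul hxi h3 (abs_nonneg _) (by positivity)
      · simp only [hp, hB, if_neg hc]
        rw [abs_mul, abs_pow, abs_pow, pow_add]
        exact mul_le_mul hxi (pow_le_pow_left₀ (abs_nonneg _) (hy2 ξ) _) (by positivity) (by positivity)
    have hmat : Matrix.of (s.piecewise r1 r2) = Matrix.of (fun c ξ => p c ξ * Real.exp (lam c * w ξ)) := by
      ext c ξ
      by_cases hc : c ∈ s <;> simp [hp, hr1, hr2, hc]
    rw [hmat]
    refine (du_bound1 w lam p (Θ - M0 * s.card) ?_ B hpB W hW ρ hρ).trans ?_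
    · intro m hm
      apply du_vanish x w ys u v z hy K M0 I J hIJ s p _ m (by omega)
      intro c hc ξ
      simp only [hp, if_neg hc]
    · gcongr ?_ * ?_
      have hBp : ∏ c, B c = X ^ (∑ c, (I c + J c)) * (ε * K) ^ s.card := by
        have : ∀ c, B c = X ^ (I c + J c) * (if c ∈ s then ε * K else 1) := by
          intro c; by_cases hc : c ∈ s <;> simp [hB, hc]
        simp_rw [this]
        rw [Finset.prod_mul_distrib, Finset.prod_pow_eq_pow_sum, Finset.prod_ite_mem, Finset.univ_inter, Finset.prod_const]
      rw [hBp, mul_assoc]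
      gcongr ?_ * ?_
      rw [← mul_assoc]
      gcongr ?_ * ?_
      rcases s.eq_empty_or_nonempty with hs | hs
      · simp [hs]
      · obtain ⟨c0, _⟩ := hs
        have hε0 : 0 ≤ ε * K := mul_nonneg ((abs_nonneg _).trans (hε c0)) (by positivity)
        have h5 : (ε * K) ^ s.card ≤ (ρ⁻¹ ^ M0) ^ s.card := by
          apply pow_le_pow_left₀ hε0
          rw [inv_pow, ← one_div, le_div_iff₀ (by positivity)]
          exact hε2
        calc (ε * K) ^ s.card * ρ⁻¹ ^ (Θ - M0 * s.card)
            ≤ (ρ⁻¹ ^ M0) ^ s.card * ρ⁻¹ ^ (Θ - M0 * s.card) := by gcongr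
          _ = ρ⁻¹ ^ (M0 * s.card + (Θ - M0 * s.card)) := by rw [pow_add, pow_mul]
          _ ≤ ρ⁻¹ ^ Θ := by
              apply pow_le_pow_of_le_one (by positivity) (inv_le_one_of_one_le₀ hρ)
              omega
  refine (Finset.sum_le_sum fun s _ => hterm s).trans ?_
  rw [Finset.sum_const, Finset.card_univ, Fintype.card_finset, nsmul_eq_mul]
  push_cast
  rfl

end

section

open Polynomial IntermediateField in
theorem liou (k : ℕ) (α : ℝ) (f : Polynomial ℤ) (hf : f.Monic) (hfk : f.natDegree ≤ k) (hfα : aeval α f = 0)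
    (hconj : ∀ β : ℂ, aeval β f = 0 → β ≠ (α : ℂ) → ‖β‖ ≤ 1) (Q : Polynomial ℤ) (hQ : aeval α Q ≠ 0)
    (U : ℝ) (hU : 1 ≤ U) (hQU : ∀ β : ℂ, ‖β‖ ≤ 1 → ‖aeval β Q‖ ≤ U) :
    1 ≤ |aeval α Q| * U ^ (k - 1) := by
  classical
  have hcα : aeval (α : ℂ) f = 0 := by
    have := congrArg (algebraMap ℝ ℂ) hfα
    rw [← aeval_algebraMap_apply, map_zero] at this
    exact this
  have h_integral : IsIntegral ℤ (α : ℂ) := ⟨f, hf, by rw [← aeval_def]; exact hcα⟩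
  have h_integralQ : IsIntegral ℚ (α : ℂ) := h_integral.tower_top
  set F := ℚ⟮(α : ℂ)⟯ with hF
  haveI : FiniteDimensional ℚ F := adjoin.finiteDimensional h_integralQ
  set g : F := AdjoinSimple.gen ℚ (α : ℂ) with hg
  have hgint : IsIntegral ℤ g := by
    have : IsIntegral ℤ ((algebraMap F ℂ) g) := by
      rw [hg, AdjoinSimple.algebraMap_gen]; exact h_integral
    exact (isIntegral_algebraMap_iff (algebraMap F ℂ).injective).mp this
  set xx : F := aeval g Q with hxx
  have hxint : IsIntegral ℤ xx := by
    rw [hxx]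
    have h8 := adjoin_le_integralClosure hgint (Polynomial.aeval_mem_adjoin_singleton ℤ g (p := Q))
    exact h8
  have hσ : ∀ σ : F →ₐ[ℚ] ℂ, σ xx = aeval (σ g) Q := by
    intro σ
    rw [hxx]
    exact (aeval_algHom_apply (σ.restrictScalars ℤ) g Q).symm
  set σ0 : F →ₐ[ℚ] ℂ := F.val with hσ0
  have hσ0g : σ0 g = α := by
    rw [hσ0, hg]; exact AdjoinSimple.coe_gen ℚ (α : ℂ)
  have hroot : ∀ σ : F →ₐ[ℚ] ℂ, aeval (σ g) f = 0 := by
    intro σ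
    have h1 : aeval g f = 0 := by
      apply (algebraMap F ℂ).injective
      rw [← aeval_algebraMap_apply, map_zero, hg, AdjoinSimple.algebraMap_gen]
      exact hcα
    have h2 := (aeval_algHom_apply (σ.restrictScalars ℤ) g f)
    rw [h1, map_zero] at h2
    exact h2
  have hne : ∀ σ : F →ₐ[ℚ] ℂ, σ ≠ σ0 → σ g ≠ α := by
    intro σ h h2
    apply h
    apply IntermediateField.adjoin_algHom_ext ℚ
    intro z hz
    have hzz : z = (α : ℂ) := hz
    subst hzz
    exact h2.trans hσ0g.symm
  have hnorm := Algebra.norm_eq_prod_embeddings ℚ ℂ xx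
  have hx0 : aeval (α : ℂ) Q ≠ 0 := by
    intro h
    apply hQ
    apply (algebraMap ℝ ℂ).injective
    rw [← aeval_algebraMap_apply, map_zero]
    exact h
  have hxx0 : xx ≠ 0 := by
    intro h
    have := hσ σ0
    rw [h, map_zero, hσ0g] at this
    exact hx0 this.symm
  have hN0 : Algebra.norm ℚ xx ≠ 0 := Algebra.norm_ne_zero_iff.mpr hxx0
  have hNint : IsIntegral ℤ (Algebra.norm ℚ xx) := Algebra.isIntegral_norm ℚ hxint
  obtain ⟨z, hz⟩ := IsIntegrallyClosed.isIntegral_iff.mp hNint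
  have hz0 : z ≠ 0 := by
    rintro rfl
    rw [map_zero] at hz
    exact hN0 hz.symm
  have h1 : (1 : ℝ) ≤ ‖(algebraMap ℚ ℂ) (Algebra.norm ℚ xx)‖ := by
    rw [← hz]
    simp only [algebraMap_int_eq, eq_intCast, map_intCast, Complex.norm_intCast]
    exact_mod_cast Int.one_le_abs hz0
  rw [hnorm, norm_prod, ← Finset.mul_prod_erase _ _ (Finset.mem_univ σ0), hσ, hσ0g] at h1
  have h2 : ‖aeval (α : ℂ) Q‖ = |aeval α Q| := by
    have : aeval (α : ℂ) Q = ((aeval α Q : ℝ) : ℂ) := aeval_algebraMap_apply ℂ α Q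
    rw [this, Complex.norm_real, Real.norm_eq_abs]
  rw [h2] at h1
  refine h1.trans (mul_le_mul_of_nonneg_left ?_ (abs_nonneg _))
  have h3 : ∏ σ ∈ Finset.univ.erase σ0, ‖σ xx‖ ≤ ∏ σ ∈ (Finset.univ.erase σ0 : Finset (F →ₐ[ℚ] ℂ)), U := by
    apply Finset.prod_le_prod (fun _ _ => norm_nonneg _)
    intro σ hs
    rw [hσ]
    exact hQU _ (hconj _ (hroot σ) (hne σ (Finset.ne_of_mem_erase hs)))
  refine h3.trans ?_
  rw [Finset.prod_const, Finset.card_erase_of_mem (Finset.mem_univ _), Finset.card_univ]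
  apply pow_le_pow_right₀ hU
  have h4 : Fintype.card (F →ₐ[ℚ] ℂ) = Module.finrank ℚ F := AlgHom.card ℚ F ℂ
  have h5 : Module.finrank ℚ F ≤ k := by
    rw [hF, adjoin.finrank h_integralQ]
    refine le_trans ?_ hfk
    have h6 : minpoly ℚ (α : ℂ) ∣ f.map (algebraMap ℤ ℚ) := by
      apply minpoly.dvd
      rw [aeval_map_algebraMap]; exact hcα
    rw [← hf.natDegree_map (algebraMap ℤ ℚ)]
    exact natDegree_le_of_dvd h6 (hf.map _).ne_zero
  omega

end

section

theorem exists_det_ne {ι X : Type*} [Fintype ι] [DecidableEq ι] (f : ι → X → ℝ) (B : Set X)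
    (h : ∀ a : ι → ℝ, (∀ x ∈ B, ∑ c, a c * f c x = 0) → a = 0) :
    ∃ ξ : ι → X, (∀ c, ξ c ∈ B) ∧ (Matrix.of (fun c c' => f c (ξ c'))).det ≠ 0 := by
  set s : Set (ι → ℝ) := (fun x c => f c x) '' B with hs
  have hspan : Submodule.span ℝ s = ⊤ := by
    by_contra hne
    obtain ⟨φ, hφ, hφ2⟩ := Submodule.exists_le_ker_of_lt_top _ (lt_top_iff_ne_top.mpr hne)
    apply hφ
    have hz := h (fun c => φ (Pi.single c 1)) (by
      intro x hx
      have : (fun c => f c x) ∈ LinearMap.ker φ := hφ2 (Submodule.subset_span ⟨x, hx, rfl⟩)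
      rw [LinearMap.mem_ker, LinearMap.pi_apply_eq_sum_univ φ] at this
      rw [← this]
      apply Finset.sum_congr rfl
      intro c _
      rw [smul_eq_mul, mul_comm]
      congr 2
      ext j
      simp [Pi.single_apply, eq_comm])
    apply LinearMap.pi_ext'
    intro c
    ext
    simpa using congrFun hz c
  obtain ⟨b, hbs, hbspan, hbli⟩ := exists_linearIndependent ℝ s
  rw [hspan] at hbspan
  let bas := Module.Basis.mk hbli (by rw [Subtype.range_coe, hbspan])
  haveI : Fintype b := FiniteDimensional.fintypeBasisIndex bas
  have hcard : Fintype.card ι = Fintype.card b := by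
    rw [← Module.finrank_eq_card_basis bas, Module.finrank_fintype_fun_eq_card]
  let e := Fintype.equivOfCardEq hcard
  have hch : ∀ c, ∃ x ∈ B, (fun c' => f c' x) = (e c : ι → ℝ) := fun c => hbs (e c).2
  choose ξ hξB hξ using hch
  refine ⟨ξ, hξB, ?_⟩
  have hli : LinearIndependent ℝ (fun c => ((e c : b) : ι → ℝ)) := hbli.comp _ e.injective
  have : (Matrix.of (fun c c' => f c (ξ c'))).transpose = Matrix.of (fun c => ((e c : b) : ι → ℝ)) := by
    ext c c'
    have := congrFun (hξ c) c'
    simpa using this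
  rw [← Matrix.det_transpose, this]
  have h3 := Matrix.linearIndependent_rows_iff_isUnit (A := Matrix.of (fun c => ((e c : b) : ι → ℝ)))
  have h4 := h3.mp hli
  rw [Matrix.isUnit_iff_isUnit_det] at h4
  exact h4.ne_zero

def tri (K : ℕ) : Finset (Σ _ : ℕ, ℕ × ℕ) := (Finset.range K).sigma (fun m => Finset.HasAntidiagonal.antidiagonal m)

theorem mem_tri {K : ℕ} {q : Σ _ : ℕ, ℕ × ℕ} : q ∈ tri K ↔ q.1 < K ∧ q.2.1 + q.2.2 = q.1 := by
  simp [tri]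

theorem tri_card (K : ℕ) : 2 * (tri K).card = K * (K + 1) := by
  unfold tri
  rw [Finset.card_sigma]
  simp only [Finset.Nat.card_antidiagonal]
  induction K with
  | zero => simp
  | succ n ih => rw [Finset.sum_range_succ, mul_add, ih]; ring

theorem tri_deg (K : ℕ) : 3 * ∑ q ∈ tri K, (q.2.1 + q.2.2) + K * (K + 1) = K * K * (K + 1) := by
  have e : ∑ q ∈ tri K, (q.2.1 + q.2.2) = ∑ m ∈ Finset.range K, (m + 1) * m := by
    unfold tri
    rw [Finset.sum_sigma]
    apply Finset.sum_congr rfl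
    intro m _
    rw [Finset.sum_congr rfl (g := fun _ => m)]
    · simp
    · intro q hq; simpa using hq
  rw [e]
  induction K with
  | zero => simp
  | succ n ih => 
    rw [Finset.sum_range_succ, mul_add]
    have : (∑ q ∈ tri n, (q.2.1 + q.2.2) = ∑ m ∈ Finset.range n, (m + 1) * m) := by
      unfold tri
      rw [Finset.sum_sigma]
      apply Finset.sum_congr rfl
      intro m _
      rw [Finset.sum_congr rfl (g := fun _ => m)]
      · simp
      · intro q hq; simpa using hq
    have := ih this
    nlinarith

open MvPolynomial in
theorem exists_points (N d R S T L K : ℕ) (hK : 0 < K) (α γ : ℝ)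
    (hZ : ∀ P : ℕ → MvPolynomial (Fin 2) ℝ, (∀ l < L, (P l).totalDegree ≤ K - 1) →
      (∀ x ∈ zbox R S T, ∑ l ∈ Finset.range L,
        eval (zpt N d x) (P l) * (α ^ x.1 * 10 ^ x.2.1 * γ ^ x.2.2) ^ l = 0) → ∀ l < L, P l = 0) :
    ∃ ξ : ↥(tri K ×ˢ Finset.range L) → ℕ × ℕ × ℕ, (∀ c, ξ c ∈ zbox R S T) ∧
      (Matrix.of (fun c c' : ↥(tri K ×ˢ Finset.range L) => zpt N d (ξ c') 0 ^ c.1.1.2.1 * zpt N d (ξ c') 1 ^ c.1.1.2.2 *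
        (α ^ (ξ c').1 * 10 ^ (ξ c').2.1 * γ ^ (ξ c').2.2) ^ c.1.2)).det ≠ 0 := by
  classical
  apply exists_det_ne (fun (c : ↥(tri K ×ˢ Finset.range L)) (x : ℕ × ℕ × ℕ) => zpt N d x 0 ^ c.1.1.2.1 * zpt N d x 1 ^ c.1.1.2.2 *
        (α ^ x.1 * 10 ^ x.2.1 * γ ^ x.2.2) ^ c.1.2) (zbox R S T : Set _)
  intro a ha
  set A : (Σ _ : ℕ, ℕ × ℕ) → ℕ → ℝ := fun q l => if h : (q, l) ∈ tri K ×ˢ Finset.range L then a ⟨(q, l), h⟩ else 0 with hA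
  set mon : (Σ _ : ℕ, ℕ × ℕ) → (Fin 2 →₀ ℕ) := fun q => Finsupp.single 0 q.2.1 + Finsupp.single 1 q.2.2 with hmon
  have hmon0 : ∀ q, mon q 0 = q.2.1 := by intro q; simp [hmon]
  have hmon1 : ∀ q, mon q 1 = q.2.2 := by intro q; simp [hmon]
  set P : ℕ → MvPolynomial (Fin 2) ℝ := fun l => ∑ q ∈ tri K, monomial (mon q) (A q l) with hP
  have hz := hZ P (by
    intro l _
    simp only [hP]
    refine totalDegree_finsetSum_le ?_
    intro q hq
    rw [mem_tri] at hq
    refine (totalDegree_monomial_le _ _).trans ?_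
    rw [Finsupp.sum_fintype _ _ (fun _ => rfl), Fin.sum_univ_two, hmon0, hmon1]
    simp only [id]
    omega) (by
    intro x hx
    have := ha x hx
    rw [Finset.sum_coe_sort_eq_attach] at this
    have e1 : ∑ c ∈ (tri K ×ˢ Finset.range L).attach, a c * (zpt N d x 0 ^ c.1.1.2.1 * zpt N d x 1 ^ c.1.1.2.2 *
        (α ^ x.1 * 10 ^ x.2.1 * γ ^ x.2.2) ^ c.1.2) = ∑ c ∈ (tri K ×ˢ Finset.range L), A c.1 c.2 * (zpt N d x 0 ^ c.1.2.1 * zpt N d x 1 ^ c.1.2.2 *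
        (α ^ x.1 * 10 ^ x.2.1 * γ ^ x.2.2) ^ c.2) := by
      rw [← Finset.sum_attach (tri K ×ˢ Finset.range L)]
      apply Finset.sum_congr rfl
      intro c _
      congr 1
      simp only [hA]
      rw [dif_pos c.2]
    rw [e1, Finset.sum_product_right] at this
    rw [← this]
    apply Finset.sum_congr rfl
    intro l _
    simp only [hP]
    rw [map_sum, Finset.sum_mul]
    apply Finset.sum_congr rfl
    intro q _
    rw [eval_monomial, Finsupp.prod_fintype _ _ (fun _ => pow_zero _), Fin.prod_univ_two, hmon0, hmon1]
    ring)
  ext ⟨⟨q, l⟩, hc⟩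
  have hc' := Finset.mem_product.mp hc
  simp only [Finset.mem_range] at hc'
  have h1 := hz l hc'.2
  have h2 := congrArg (coeff (mon q)) h1
  simp only [hP] at h2
  rw [coeff_sum, coeff_zero, Finset.sum_eq_single q] at h2
  · rw [coeff_monomial, if_pos rfl] at h2
    simp only [hA] at h2
    rw [dif_pos hc] at h2
    simpa using h2
  · intro q' hq' hne
    rw [coeff_monomial, if_neg]
    intro h
    apply hne
    have i0 := hmon0 q; have i1 := hmon1 q; have j0 := hmon0 q'; have j1 := hmon1 q'
    rw [h] at j0 j1
    have m1 := (mem_tri.mp hc'.1).2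
    have m2 := (mem_tri.mp hq').2
    obtain ⟨m, i, j⟩ := q
    obtain ⟨m', i', j'⟩ := q'
    simp only at i0 i1 j0 j1 m1 m2
    have : i = i' := by omega
    have : j = j' := by omega
    have : m = m' := by omega
    subst_vars
    rfl
  · intro h; exact absurd hc'.1 h

end

section

open Polynomial

theorem det_norm_le {ι : Type*} [Fintype ι] [DecidableEq ι] (A : Matrix ι ι ℂ) (B : ι → ℝ)
    (hA : ∀ c ξ, ‖A c ξ‖ ≤ B c) : ‖A.det‖ ≤ (Fintype.card ι).factorial * ∏ c, B c := by
  rw [← Matrix.det_transpose, Matrix.det_apply']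
  refine (norm_sum_le _ _).trans ?_
  have : ∀ σ ∈ (Finset.univ : Finset (Equiv.Perm ι)), ‖((Equiv.Perm.sign σ : ℤ) : ℂ) * ∏ c, A.transpose (σ c) c‖ ≤ ∏ c, B c := by
    intro σ _
    rw [norm_mul, norm_prod]
    have : ‖((Equiv.Perm.sign σ : ℤ) : ℂ)‖ = 1 := by
      rcases Int.units_eq_one_or (Equiv.Perm.sign σ) with h | h <;> simp [h]
    rw [this, one_mul]
    exact Finset.prod_le_prod (fun _ _ => norm_nonneg _) (fun c _ => hA _ _)
  refine (Finset.sum_le_sum this).trans ?_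
  simp [Fintype.card_perm]

/-- the upper bound for the analytic determinant -/
theorem core_up {ι : Type*} [Fintype ι] [DecidableEq ι] (I J l r s t : ι → ℕ) (N d R S T L1 K M0 : ℕ)
    (hIJ : ∀ c, I c + J c < K) (hsum : 2 * ∑ c, l c = Fintype.card ι * L1)
    (hr : ∀ c, r c < R) (hs : ∀ c, s c < S) (ht : ∀ c, t c < T)
    (a0 b g h X ρ : ℝ) (ha0 : 0 < a0) (hb : 1 ≤ b) (hgh : |g| ≤ h) (hX1 : (R : ℝ) + N * T ≤ X) (hX2 : (S : ℝ) + d * T + 1 ≤ X)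
    (hρ : 1 ≤ ρ) (hT : 1 ≤ T) (hK : 1 ≤ K) (hΛ : K * T * |N * a0 - d * b + g| * ρ ^ M0 ≤ 1) :
    |(Matrix.of (fun c ξ => ((r ξ : ℝ) - N * t ξ) ^ I c * ((s ξ : ℝ) + d * t ξ) ^ J c *
        Real.exp (l c * (r ξ * a0 + s ξ * b + t ξ * g)))).det| ≤
      2 ^ (Fintype.card ι) * ((Fintype.card ι).factorial * (X ^ (∑ c, (I c + J c)) *
      (ρ⁻¹ ^ (∑ M ∈ Finset.range M0, (Fintype.card ι - K * (K + M + 1))) *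
        Real.exp (ρ * ((∑ c, |(l c : ℝ) - L1 / 2|) * (1 / 2 * (R * a0 + S * b + T * h))))))) *
      ∏ ξ, Real.exp ((L1 : ℝ) / 2 * (r ξ * a0 + s ξ * b + t ξ * g)) := by
  set w0 : ℝ := 1 / 2 * (R * a0 + S * b + T * g) with hw0
  set Λ : ℝ := N * a0 - d * b + g with hΛd
  have hb0 : 0 < b := by linarith
  have hfac : (Matrix.of (fun c ξ => ((r ξ : ℝ) - N * t ξ) ^ I c * ((s ξ : ℝ) + d * t ξ) ^ J c *
        Real.exp (l c * (r ξ * a0 + s ξ * b + t ξ * g)))) =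
      Matrix.of (fun c ξ => Real.exp ((L1 : ℝ) / 2 * (r ξ * a0 + s ξ * b + t ξ * g)) *
        (Matrix.of (fun c ξ => Real.exp (((l c : ℝ) - L1 / 2) * w0) *
          (Matrix.of (fun c ξ => ((r ξ : ℝ) - N * t ξ) ^ I c * ((s ξ : ℝ) + d * t ξ) ^ J c *
        Real.exp (((l c : ℝ) - L1 / 2) * (r ξ * a0 + s ξ * b + t ξ * g - w0)))) c ξ)) c ξ) := by
    ext c ξ
    simp only [Matrix.of_apply]
    have : Real.exp (l c * (r ξ * a0 + s ξ * b + t ξ * g)) = Real.exp ((L1 : ℝ) / 2 * (r ξ * a0 + s ξ * b + t ξ * g)) *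
      (Real.exp (((l c : ℝ) - L1 / 2) * w0) * Real.exp (((l c : ℝ) - L1 / 2) * (r ξ * a0 + s ξ * b + t ξ * g - w0))) := by
      rw [← Real.exp_add, ← Real.exp_add]; congr 1; ring
    rw [this]; ring
  rw [hfac, Matrix.det_mul_row, Matrix.det_mul_column]
  have hone : ∏ c, Real.exp (((l c : ℝ) - L1 / 2) * w0) = 1 := by
    rw [← Real.exp_sum, ← Finset.sum_mul, Finset.sum_sub_distrib]
    have : (2 : ℝ) * ∑ c, (l c : ℝ) = Fintype.card ι * L1 := by exact_mod_cast hsum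
    simp only [Finset.sum_const, Finset.card_univ, nsmul_eq_mul]
    have e : ∑ c, (l c : ℝ) - Fintype.card ι * (L1 / 2 : ℝ) = 0 := by linarith
    rw [e]; simp
  rw [hone, one_mul, abs_mul, Finset.abs_prod, mul_comm]
  simp only [Real.abs_exp]
  refine mul_le_mul_of_nonneg_right ?_ (Finset.prod_nonneg (fun _ _ => (Real.exp_pos _).le))
  have hTR : (1 : ℝ) ≤ T := by exact_mod_cast hT
  have hKR : (1 : ℝ) ≤ K := by exact_mod_cast hK
  have hX : 1 ≤ X := by
    have : (0 : ℝ) ≤ S + d * T := by positivity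
    linarith
  have hρM : 1 ≤ ρ ^ M0 := one_le_pow₀ hρ
  have hTΛ : T * |Λ| ≤ 1 := by
    have h0 : 0 ≤ T * |Λ| := by positivity
    calc T * |Λ| = 1 * (T * |Λ|) * 1 := by ring
      _ ≤ K * (T * |Λ|) * ρ ^ M0 := by gcongr
      _ = K * T * |Λ| * ρ ^ M0 := by ring
      _ ≤ 1 := hΛ
  have htT : ∀ ξ, (t ξ : ℝ) ≤ T := fun ξ => by exact_mod_cast (ht ξ).le
  have hrR : ∀ ξ, (r ξ : ℝ) ≤ R := fun ξ => by exact_mod_cast (hr ξ).le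
  have hsS : ∀ ξ, (s ξ : ℝ) ≤ S := fun ξ => by exact_mod_cast (hs ξ).le
  have heps : ∀ ξ, |(t ξ : ℝ) * Λ / b| ≤ T * |Λ| := by
    intro ξ
    rw [abs_div, abs_mul, abs_of_pos hb0, Nat.abs_cast]
    refine (div_le_self (by positivity) hb).trans ?_
    gcongr
    exact (ht ξ).le
  have hyabs : ∀ ξ, |(s ξ : ℝ) + d * t ξ| ≤ S + d * T := by
    intro ξ
    rw [abs_of_nonneg (by positivity)]
    have := hsS ξ; have := htT ξ
    gcongr
  apply du_main (fun ξ => (r ξ : ℝ) - N * t ξ) (fun ξ => r ξ * a0 + s ξ * b + t ξ * g - w0)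
    (fun ξ => (s ξ : ℝ) + d * t ξ) (fun ξ => (s ξ : ℝ) + d * t ξ + t ξ * Λ / b) (fun c => (l c : ℝ) - L1 / 2)
    (1 / b) (w0 / b) (- a0 / b) ?_ K M0 I J hIJ X (1 / 2 * (R * a0 + S * b + T * h)) ρ (T * |Λ|) hX ?_ ?_ ?_ ?_ ?_ hρ ?_
  · intro ξ; simp only [hΛd]; field_simp; ring
  · intro ξ
    refine (abs_sub _ _).trans ?_
    rw [Nat.abs_cast, abs_mul, Nat.abs_cast, Nat.abs_cast]
    have := hrR ξ; have := htT ξ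
    refine le_trans ?_ hX1
    gcongr
  · intro ξ; have := hyabs ξ; linarith
  · intro ξ
    refine (abs_add_le _ _).trans ?_
    have := hyabs ξ; have := heps ξ; linarith
  · intro ξ
    have : (s ξ : ℝ) + d * t ξ - ((s ξ : ℝ) + d * t ξ + t ξ * Λ / b) = - (t ξ * Λ / b) := by ring
    rw [this, abs_neg]; exact heps ξ
  · intro ξ
    have e : r ξ * a0 + s ξ * b + t ξ * g - w0 = ((r ξ : ℝ) - R / 2) * a0 + ((s ξ : ℝ) - S / 2) * b + ((t ξ : ℝ) - T / 2) * g := by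
      rw [hw0]; ring
    rw [e]
    have aux : ∀ (p q : ℝ), 0 ≤ p → p ≤ q → |p - q / 2| ≤ q / 2 := by
      intro p q h1 h2; rw [abs_le]; constructor <;> linarith
    have h1 := aux _ _ (Nat.cast_nonneg _) (hrR ξ)
    have h2 := aux _ _ (Nat.cast_nonneg _) (hsS ξ)
    have h3 := aux _ _ (Nat.cast_nonneg _) (htT ξ)
    refine (abs_add_le _ _).trans ?_
    refine (add_le_add (abs_add_le _ _) le_rfl).trans ?_
    rw [abs_mul, abs_mul, abs_mul, abs_of_pos ha0, abs_of_pos hb0]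
    calc _ ≤ (R : ℝ) / 2 * a0 + S / 2 * b + T / 2 * h := by gcongr
      _ = _ := by ring
  · calc T * |Λ| * K * ρ ^ M0 = K * T * |Λ| * ρ ^ M0 := by ring
      _ ≤ 1 := hΛ

theorem core_alg {ι : Type*} [Fintype ι] [DecidableEq ι] (I J l r s t : ι → ℕ) (k N d R S T L1 K M0 : ℕ)
    (hk : 1 ≤ k) (hIJ : ∀ c, I c + J c < K) (hsum : 2 * ∑ c, l c = Fintype.card ι * L1) (hl : ∀ c, l c ≤ L1)
    (hr : ∀ c, r c < R) (hs : ∀ c, s c < S) (ht : ∀ c, t c < T)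
    (α : ℝ) (hα : 1 < α) (f ν τ : ℤ[X]) (hf : f.Monic) (hfk : f.natDegree ≤ k) (hfα : aeval α f = 0)
    (hconj : ∀ β : ℂ, aeval β f = 0 → β ≠ (α : ℂ) → ‖β‖ ≤ 1)
    (hν : 0 < aeval α ν) (hτ : 0 < aeval α τ) (Hν Hτ : ℝ) (hHν : 1 ≤ Hν) (hHτ : 1 ≤ Hτ)
    (hν1 : aeval α ν ≤ Hν) (hτ1 : aeval α τ ≤ Hτ)
    (hν2 : ∀ β : ℂ, ‖β‖ ≤ 1 → ‖aeval β ν‖ ≤ Hν) (hτ2 : ∀ β : ℂ, ‖β‖ ≤ 1 → ‖aeval β τ‖ ≤ Hτ)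
    (X ρ : ℝ) (hgh : |Real.log (aeval α ν / aeval α τ)| ≤ Real.log Hν + Real.log Hτ)
    (hX1 : (R : ℝ) + N * T ≤ X) (hX2 : (S : ℝ) + d * T + 1 ≤ X)
    (hρ : 1 ≤ ρ) (hT : 1 ≤ T) (hK : 1 ≤ K)
    (hΛ : K * T * |N * Real.log α - d * Real.log 10 + Real.log (aeval α ν / aeval α τ)| * ρ ^ M0 ≤ 1)
    (hdet : (Matrix.of (fun c ξ => ((r ξ : ℝ) - N * t ξ) ^ I c * ((s ξ : ℝ) + d * t ξ) ^ J c *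
        (α ^ r ξ * 10 ^ s ξ * (aeval α ν / aeval α τ) ^ t ξ) ^ l c)).det ≠ 0) :
    0 ≤ k * (Real.log (Fintype.card ι).factorial + (∑ c, (I c + J c) : ℕ) * Real.log X) +
      (∑ c, l c : ℕ) * (R * Real.log α + k * (S * Real.log 10 + T * (Real.log Hν + Real.log Hτ))) +
      Fintype.card ι * Real.log 2 - (∑ M ∈ Finset.range M0, (Fintype.card ι - K * (K + M + 1)) : ℕ) * Real.log ρ +
      ρ * ((∑ c, |(l c : ℝ) - L1 / 2|) * (1 / 2 * (R * Real.log α + S * Real.log 10 + T * (Real.log Hν + Real.log Hτ)))) := by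
  set a0 := Real.log α with ha0
  set b := Real.log 10 with hb
  set n0 := Fintype.card ι with hn0
  set dg := ∑ c, (I c + J c) with hdg
  set s1 := ∑ c, l c with hs1
  set Θ := ∑ M ∈ Finset.range M0, (n0 - K * (K + M + 1)) with hΘ
  set h := Real.log Hν + Real.log Hτ with hh
  set γ := aeval α ν / aeval α τ with hγ
  have hγ0 : 0 < γ := div_pos hν hτ
  have hα0 : 0 < α := by linarith
  have ha0p : 0 < a0 := Real.log_pos hα
  have hb1 : 1 ≤ b := by
    rw [hb, Real.le_log_iff_exp_le (by norm_num)]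
    have := Real.exp_one_lt_d9; linarith
  have hX : 1 ≤ X := by
    have : (0 : ℝ) ≤ S + d * T := by positivity
    linarith
  have hrR : ∀ ξ, (r ξ : ℝ) ≤ R := fun ξ => by exact_mod_cast (hr ξ).le
  have htT : ∀ ξ, (t ξ : ℝ) ≤ T := fun ξ => by exact_mod_cast (ht ξ).le
  have hsS : ∀ ξ, (s ξ : ℝ) ≤ S := fun ξ => by exact_mod_cast (hs ξ).le
  have hXx : ∀ ξ, |(r ξ : ℝ) - N * t ξ| ≤ X := by
    intro ξ
    refine (abs_sub _ _).trans ?_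
    rw [Nat.abs_cast, abs_mul, Nat.abs_cast, Nat.abs_cast]
    have := hrR ξ; have := htT ξ
    refine le_trans ?_ hX1
    gcongr
  have hXy : ∀ ξ, |(s ξ : ℝ) + d * t ξ| ≤ X := by
    intro ξ
    rw [abs_of_nonneg (by positivity)]
    have := hsS ξ; have := htT ξ
    refine le_trans ?_ hX2
    have : (s ξ : ℝ) + d * t ξ ≤ S + d * T := by gcongr
    linarith
  set Mx : Matrix ι ι ℤ[X] := Matrix.of (fun c ξ => C (((r ξ : ℤ) - N * t ξ) ^ I c * ((s ξ : ℤ) + d * t ξ) ^ J c * 10 ^ (s ξ * l c)) *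
    Polynomial.X ^ (r ξ * l c) * ν ^ (t ξ * l c) * τ ^ (t ξ * (L1 - l c))) with hMx
  set Q := Mx.det with hQ
  -- real evaluation
  have hentry : (aeval α : ℤ[X] →ₐ[ℤ] ℝ).mapMatrix Mx = Matrix.of (fun c ξ => (aeval α τ) ^ (t ξ * L1) *
      (Matrix.of (fun c ξ => ((r ξ : ℝ) - N * t ξ) ^ I c * ((s ξ : ℝ) + d * t ξ) ^ J c *
        (α ^ r ξ * 10 ^ s ξ * γ ^ t ξ) ^ l c)) c ξ) := by
    ext c ξ
    simp only [AlgHom.mapMatrix_apply, Matrix.map_apply, hMx, Matrix.of_apply, map_mul, map_pow, aeval_X, aeval_C]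
    have e1 : t ξ * L1 = t ξ * (L1 - l c) + t ξ * l c := by
      rw [← mul_add, Nat.sub_add_cancel (hl c)]
    rw [e1, pow_add, hγ]
    simp only [mul_pow, div_pow, ← pow_mul]
    have : (aeval α τ) ^ (t ξ * l c) ≠ 0 := (pow_pos hτ _).ne'
    field_simp
    simp [algebraMap_int_eq, mul_comm]
  have hQα : aeval α Q = (∏ ξ, (aeval α τ) ^ (t ξ * L1)) * (Matrix.of (fun c ξ => ((r ξ : ℝ) - N * t ξ) ^ I c * ((s ξ : ℝ) + d * t ξ) ^ J c *
        (α ^ r ξ * 10 ^ s ξ * γ ^ t ξ) ^ l c)).det := by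
    rw [hQ, AlgHom.map_det, hentry, Matrix.det_mul_row]
  have hτp : 0 < ∏ ξ, (aeval α τ) ^ (t ξ * L1) := Finset.prod_pos (fun _ _ => pow_pos hτ _)
  have hQne : aeval α Q ≠ 0 := by
    rw [hQα]; exact mul_ne_zero hτp.ne' hdet
  set U : ℝ := n0.factorial * (X ^ dg * (10 ^ S * Hν ^ T * Hτ ^ T) ^ s1) with hU
  have hHν0 : 0 < Hν := by linarith
  have hHτ0 : 0 < Hτ := by linarith
  have hY1 : (1 : ℝ) ≤ 10 ^ S * Hν ^ T * Hτ ^ T := by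
    have h1 : (1 : ℝ) ≤ 10 ^ S := one_le_pow₀ (by norm_num)
    have h2 : (1 : ℝ) ≤ Hν ^ T := one_le_pow₀ hHν
    have h3 : (1 : ℝ) ≤ Hτ ^ T := one_le_pow₀ hHτ
    exact one_le_mul_of_one_le_of_one_le (one_le_mul_of_one_le_of_one_le h1 h2) h3
  have hfac1 : (1 : ℝ) ≤ n0.factorial := by exact_mod_cast Nat.factorial_pos n0
  have hU1 : 1 ≤ U :=
    one_le_mul_of_one_le_of_one_le hfac1 (one_le_mul_of_one_le_of_one_le (one_le_pow₀ hX) (one_le_pow₀ hY1))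
  have hL := liou k α f hf hfk hfα hconj Q hQne U hU1 (by
    intro β hβ
    rw [hQ, AlgHom.map_det]
    refine (det_norm_le _ (fun c => X ^ (I c + J c) * (10 ^ S * Hν ^ T) ^ l c * (Hτ ^ T) ^ (L1 - l c)) ?_).trans ?_
    · intro c ξ
      simp only [AlgHom.mapMatrix_apply, Matrix.map_apply, hMx, Matrix.of_apply, map_mul, map_pow, aeval_X, aeval_C, norm_mul, norm_pow]
      have x1 : ‖(algebraMap ℤ ℂ) ((r ξ : ℤ) - N * t ξ)‖ ≤ X := by
        have := hXx ξ
        rw [algebraMap_int_eq, eq_intCast, Complex.norm_intCast]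
        push_cast; exact this
      have x2 : ‖(algebraMap ℤ ℂ) ((s ξ : ℤ) + d * t ξ)‖ ≤ X := by
        have := hXy ξ
        rw [algebraMap_int_eq, eq_intCast, Complex.norm_intCast]
        push_cast; exact this
      have x3 : ‖(algebraMap ℤ ℂ) 10‖ = 10 := by simp
      rw [x3]
      have y1 := hν2 β hβ
      have y2 := hτ2 β hβ
      have z1 : ‖β‖ ^ (r ξ * l c) ≤ 1 := pow_le_one₀ (norm_nonneg _) hβ
      have z2 : ‖aeval β ν‖ ^ (t ξ * l c) ≤ Hν ^ (T * l c) :=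
        (pow_le_pow_left₀ (norm_nonneg _) y1 _).trans (pow_le_pow_right₀ hHν (Nat.mul_le_mul_right _ (ht ξ).le))
      have z3 : ‖aeval β τ‖ ^ (t ξ * (L1 - l c)) ≤ Hτ ^ (T * (L1 - l c)) :=
        (pow_le_pow_left₀ (norm_nonneg _) y2 _).trans (pow_le_pow_right₀ hHτ (Nat.mul_le_mul_right _ (ht ξ).le))
      have z4 : (10 : ℝ) ^ (s ξ * l c) ≤ 10 ^ (S * l c) := pow_le_pow_right₀ (by norm_num) (Nat.mul_le_mul_right _ (hs ξ).le)
      calc _ ≤ X ^ I c * X ^ J c * 10 ^ (S * l c) * 1 * Hν ^ (T * l c) * Hτ ^ (T * (L1 - l c)) := by gcongr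
        _ = _ := by simp only [mul_pow, ← pow_mul, pow_add]; ring
    · rw [Finset.prod_mul_distrib, Finset.prod_mul_distrib, Finset.prod_pow_eq_pow_sum, Finset.prod_pow_eq_pow_sum, Finset.prod_pow_eq_pow_sum]
      have e2 : ∑ c, (L1 - l c) = s1 := by
        have e3 : ∑ c, (L1 - l c) + ∑ c, l c = n0 * L1 := by
          rw [← Finset.sum_add_distrib, Finset.sum_congr rfl (fun c _ => Nat.sub_add_cancel (hl c))]
          simp [hn0]
        omega
      rw [e2, hU]
      apply le_of_eq
      simp only [mul_pow]; ring)
  -- analytic bound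
  have hup := core_up I J l r s t N d R S T L1 K M0 hIJ hsum hr hs ht a0 b (Real.log γ) h X ρ ha0p hb1 hgh hX1 hX2 hρ hT hK hΛ
  have hmat : (Matrix.of (fun c ξ => ((r ξ : ℝ) - N * t ξ) ^ I c * ((s ξ : ℝ) + d * t ξ) ^ J c *
        (α ^ r ξ * 10 ^ s ξ * γ ^ t ξ) ^ l c)) = (Matrix.of (fun c ξ => ((r ξ : ℝ) - N * t ξ) ^ I c * ((s ξ : ℝ) + d * t ξ) ^ J c *
        Real.exp (l c * (r ξ * a0 + s ξ * b + t ξ * Real.log γ)))) := by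
    ext c ξ
    simp only [Matrix.of_apply]
    congr 1
    rw [Real.exp_nat_mul, Real.exp_add, Real.exp_add, Real.exp_nat_mul, Real.exp_nat_mul, Real.exp_nat_mul,
      ha0, hb, Real.exp_log hα0, Real.exp_log (by norm_num), Real.exp_log hγ0]
  rw [← hmat] at hup
  set D := (Matrix.of (fun c ξ => ((r ξ : ℝ) - N * t ξ) ^ I c * ((s ξ : ℝ) + d * t ξ) ^ J c *
        (α ^ r ξ * 10 ^ s ξ * γ ^ t ξ) ^ l c)).det with hD
  set Sg := ρ * ((∑ c, |(l c : ℝ) - L1 / 2|) * (1 / 2 * (R * a0 + S * b + T * h))) with hSg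
  set G := 2 ^ n0 * (n0.factorial * (X ^ dg * (ρ⁻¹ ^ Θ * Real.exp Sg))) with hG
  have hX0 : 0 < X := by linarith
  have hρ0 : 0 < ρ := by linarith
  have hGp : 0 < G := by positivity
  have hQb : |aeval α Q| ≤ G * Real.exp (s1 * (R * a0 + S * b + T * h)) := by
    rw [hQα, abs_mul, abs_of_pos hτp]
    calc _ ≤ (∏ ξ, (aeval α τ) ^ (t ξ * L1)) * (G * ∏ ξ, Real.exp ((L1 : ℝ) / 2 * (r ξ * a0 + s ξ * b + t ξ * Real.log γ))) := by
          gcongr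
      _ = G * ∏ ξ, ((aeval α τ) ^ (t ξ * L1) * Real.exp ((L1 : ℝ) / 2 * (r ξ * a0 + s ξ * b + t ξ * Real.log γ))) := by
          rw [Finset.prod_mul_distrib]; ring
      _ ≤ G * ∏ ξ : ι, Real.exp ((L1 : ℝ) / 2 * (R * a0 + S * b + T * h)) := by
          gcongr with ξ
          rw [← Real.exp_log (pow_pos hτ (t ξ * L1)), ← Real.exp_add, Real.exp_le_exp, Real.log_pow, hγ, Real.log_div hν.ne' hτ.ne']
          have g1 := Real.log_le_log hν hν1
          have g2 := Real.log_le_log hτ hτ1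
          have q1 := hrR ξ; have q2 := hsS ξ; have q3 := htT ξ
          have hh0 : 0 ≤ h := by rw [hh]; have := Real.log_nonneg hHν; have := Real.log_nonneg hHτ; linarith
          push_cast
          calc _ = (L1 : ℝ) / 2 * (r ξ * a0 + s ξ * b + t ξ * (Real.log (aeval α ν) + Real.log (aeval α τ))) := by ring
            _ ≤ (L1 : ℝ) / 2 * (r ξ * a0 + s ξ * b + t ξ * h) := by gcongr; linarith
            _ ≤ _ := by gcongr
      _ = _ := by
          rw [Finset.prod_const, ← Real.exp_nat_mul, Finset.card_univ]
          congr 2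
          have : (2 : ℝ) * s1 = n0 * L1 := by exact_mod_cast hsum
          rw [← mul_assoc]
          congr 1
          rw [← hn0]; linarith
  have hfin : 1 ≤ G * Real.exp (s1 * (R * a0 + S * b + T * h)) * U ^ (k - 1) :=
    hL.trans (by gcongr)
  have hlog := Real.log_nonneg hfin
  have hfp : (0 : ℝ) < n0.factorial := by linarith
  have hY0 : (0 : ℝ) < 10 ^ S * Hν ^ T * Hτ ^ T := by positivity
  have hlU : Real.log U = Real.log n0.factorial + dg * Real.log X + s1 * (S * b + T * h) := by
    rw [hU, Real.log_mul hfp.ne' (by positivity), Real.log_mul (by positivity) (by positivity), Real.log_pow, Real.log_pow,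
      Real.log_mul (by positivity) (by positivity), Real.log_mul (by positivity) (by positivity), Real.log_pow, Real.log_pow, Real.log_pow, hh, hb]
    ring
  have hlG : Real.log G = n0 * Real.log 2 + Real.log n0.factorial + dg * Real.log X - Θ * Real.log ρ + Sg := by
    rw [hG, Real.log_mul (by positivity) (by positivity), Real.log_mul hfp.ne' (by positivity), Real.log_mul (by positivity) (by positivity), Real.log_mul (by positivity) (by positivity),
      Real.log_pow, Real.log_pow, Real.log_pow, Real.log_inv, Real.log_exp]
    ring
  rw [Real.log_mul (by positivity) (by positivity), Real.log_mul hGp.ne' (Real.exp_pos _).ne', Real.log_exp, Real.log_pow, hlU, hlG,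
    Nat.cast_sub hk] at hlog
  refine hlog.trans (le_of_eq ?_)
  push_cast
  ring

end

section

open Polynomial

theorem sum_lam (L : ℕ) : ∑ l ∈ Finset.range L, |(l : ℝ) - ((L : ℝ) - 1) / 2| ≤ (L : ℝ) ^ 2 / 4 := by
  induction L using Nat.twoStepInduction with
  | zero => simp
  | one => simp
  | more n ih _ =>
    rw [Finset.sum_range_succ, Finset.sum_range_succ']
    have e : ∑ i ∈ Finset.range n, |((i + 1 : ℕ) : ℝ) - (((n + 2 : ℕ) : ℝ) - 1) / 2| = ∑ l ∈ Finset.range n, |(l : ℝ) - ((n : ℝ) - 1) / 2| := by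
      apply Finset.sum_congr rfl
      intro i _
      congr 1; push_cast; ring
    rw [e]
    have hn : (0 : ℝ) ≤ n := Nat.cast_nonneg _
    have e1 : |((0 : ℕ) : ℝ) - (((n + 2 : ℕ) : ℝ) - 1) / 2| = (n + 1) / 2 := by
      rw [abs_of_nonpos] <;> push_cast <;> linarith
    have e2 : |((n + 1 : ℕ) : ℝ) - (((n + 2 : ℕ) : ℝ) - 1) / 2| = (n + 1) / 2 := by
      rw [abs_of_nonneg] <;> push_cast <;> linarith
    rw [e1, e2]
    push_cast
    nlinarith

theorem sum_id_le (M0 : ℕ) : ∑ M ∈ Finset.range M0, (M : ℝ) ≤ (M0 : ℝ) ^ 2 / 2 := by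
  induction M0 with
  | zero => simp
  | succ n ih => rw [Finset.sum_range_succ]; push_cast; nlinarith

set_option maxHeartbeats 800000 in
theorem core (k N d R S T L K M0 : ℕ)
    (hk : 1 ≤ k) (hL : 1 ≤ L) (hK : 1 ≤ K) (hT : 1 ≤ T)
    (α : ℝ) (hα : 1 < α) (f ν τ : ℤ[X]) (hf : f.Monic) (hfk : f.natDegree ≤ k) (hfα : aeval α f = 0)
    (hconj : ∀ β : ℂ, aeval β f = 0 → β ≠ (α : ℂ) → ‖β‖ ≤ 1)
    (hν : 0 < aeval α ν) (hτ : 0 < aeval α τ) (Hν Hτ : ℝ) (hHν : 1 ≤ Hν) (hHτ : 1 ≤ Hτ)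
    (hν1 : aeval α ν ≤ Hν) (hτ1 : aeval α τ ≤ Hτ)
    (hν2 : ∀ β : ℂ, ‖β‖ ≤ 1 → ‖aeval β ν‖ ≤ Hν) (hτ2 : ∀ β : ℂ, ‖β‖ ≤ 1 → ‖aeval β τ‖ ≤ Hτ)
    (X ρ : ℝ) (hgh : |Real.log (aeval α ν / aeval α τ)| ≤ Real.log Hν + Real.log Hτ)
    (hX1 : (R : ℝ) + N * T ≤ X) (hX2 : (S : ℝ) + d * T + 1 ≤ X)
    (hρ : 1 ≤ ρ)
    (hΛ : K * T * |N * Real.log α - d * Real.log 10 + Real.log (aeval α ν / aeval α τ)| * ρ ^ M0 ≤ 1)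
    (hZ : ∀ P : ℕ → MvPolynomial (Fin 2) ℝ, (∀ l < L, (P l).totalDegree ≤ K - 1) →
      (∀ x ∈ zbox R S T, ∑ l ∈ Finset.range L,
        MvPolynomial.eval (zpt N d x) (P l) * (α ^ x.1 * 10 ^ x.2.1 * (aeval α ν / aeval α τ) ^ x.2.2) ^ l = 0) → ∀ l < L, P l = 0) :
    0 ≤ k * (Real.log (K * (K + 1) / 2 * L) + 2 / 3 * (K - 1) * Real.log X) +
      ((L : ℝ) - 1) / 2 * (R * Real.log α + k * (S * Real.log 10 + T * (Real.log Hν + Real.log Hτ))) +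
      Real.log 2 - (M0 * (1 - 2 / L) - M0 ^ 2 / ((K + 1) * L)) * Real.log ρ +
      ρ * (L / 8 * (R * Real.log α + S * Real.log 10 + T * (Real.log Hν + Real.log Hτ))) := by
  classical
  obtain ⟨ξ, hξ, hdet⟩ := exists_points N d R S T L K hK α (aeval α ν / aeval α τ) hZ
  have hξ' := fun c => mem_zbox.mp (hξ c)
  have hcard : Fintype.card ↥(tri K ×ˢ Finset.range L) = (tri K).card * L := by
    rw [Fintype.card_coe, Finset.card_product, Finset.card_range]
  have hsl : ∑ c : ↥(tri K ×ˢ Finset.range L), c.1.2 = (tri K).card * ∑ l ∈ Finset.range L, l := by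
    rw [Finset.sum_coe_sort (tri K ×ˢ Finset.range L) (fun c => c.2), Finset.sum_product]
    simp
  have hsd : ∑ c : ↥(tri K ×ˢ Finset.range L), (c.1.1.2.1 + c.1.1.2.2) = L * ∑ q ∈ tri K, (q.2.1 + q.2.2) := by
    rw [Finset.sum_coe_sort (tri K ×ˢ Finset.range L) (fun c => c.1.2.1 + c.1.2.2), Finset.sum_product_right]
    simp
  have h2s : 2 * ∑ c : ↥(tri K ×ˢ Finset.range L), c.1.2 = Fintype.card ↥(tri K ×ˢ Finset.range L) * (L - 1) := by
    rw [hsl, hcard]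
    have := Finset.sum_range_id_mul_two L
    calc _ = (tri K).card * ((∑ i ∈ Finset.range L, i) * 2) := by ring
      _ = _ := by rw [this]; ring
  have key := core_alg (ι := ↥(tri K ×ˢ Finset.range L)) (fun c => c.1.1.2.1) (fun c => c.1.1.2.2) (fun c => c.1.2)
    (fun c => (ξ c).1) (fun c => (ξ c).2.1) (fun c => (ξ c).2.2) k N d R S T (L - 1) K M0 hk
    (by
      intro c
      have := mem_tri.mp (Finset.mem_product.mp c.2).1
      omega) h2s
    (by
      intro c
      have := Finset.mem_range.mp (Finset.mem_product.mp c.2).2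
      omega) (fun c => (hξ' c).1) (fun c => (hξ' c).2.1) (fun c => (hξ' c).2.2) α hα f ν τ hf hfk hfα hconj hν hτ Hν Hτ hHν hHτ
    hν1 hτ1 hν2 hτ2 X ρ hgh hX1 hX2 hρ hT hK hΛ (by
      simpa [zpt] using hdet)
  set A := R * Real.log α + k * (S * Real.log 10 + T * (Real.log Hν + Real.log Hτ)) with hA
  set W := R * Real.log α + S * Real.log 10 + T * (Real.log Hν + Real.log Hτ) with hW
  set n0 := Fintype.card ↥(tri K ×ˢ Finset.range L) with hn0
  have hLR : (1 : ℝ) ≤ L := by exact_mod_cast hL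
  have hKR : (1 : ℝ) ≤ K := by exact_mod_cast hK
  have htc : (2 : ℝ) * (tri K).card = K * (K + 1) := by exact_mod_cast tri_card K
  have hn0R : (n0 : ℝ) = K * (K + 1) / 2 * L := by
    rw [hcard]; push_cast; rw [← htc]; ring
  have hn0p : (0 : ℝ) < n0 := by rw [hn0R]; positivity
  have hlam : ∑ c : ↥(tri K ×ˢ Finset.range L), |((c.1.2 : ℕ) : ℝ) - ((L - 1 : ℕ) : ℝ) / 2| ≤ n0 * (L / 4) := by
    rw [Finset.sum_coe_sort (tri K ×ˢ Finset.range L) (fun c => |((c.2 : ℕ) : ℝ) - ((L - 1 : ℕ) : ℝ) / 2|), Finset.sum_product]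
    rw [Nat.cast_sub hL]
    simp only [Finset.sum_const, nsmul_eq_mul, Nat.cast_one]
    rw [hcard]
    push_cast
    have := sum_lam L
    calc _ ≤ ((tri K).card : ℝ) * ((L : ℝ) ^ 2 / 4) := by gcongr
      _ = _ := by ring
  have hW0 : 0 ≤ W := by
    have := Real.log_nonneg hHν; have := Real.log_nonneg hHτ; have := Real.log_pos hα
    have : 0 ≤ Real.log 10 := Real.log_nonneg (by norm_num)
    positivity
  have hρ0 : 0 < ρ := by linarith
  have hlogρ : 0 ≤ Real.log ρ := Real.log_nonneg hρ
  have hTh : (n0 : ℝ) * (M0 * (1 - 2 / L) - M0 ^ 2 / ((K + 1) * L)) ≤ (∑ M ∈ Finset.range M0, (n0 - K * (K + M + 1)) : ℕ) := by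
    push_cast
    have h1 : ∑ M ∈ Finset.range M0, ((n0 : ℝ) - K * (K + M + 1)) ≤ ∑ M ∈ Finset.range M0, ((n0 - K * (K + M + 1) : ℕ) : ℝ) := by
      apply Finset.sum_le_sum
      intro M _
      have : n0 ≤ (n0 - K * (K + M + 1)) + K * (K + M + 1) := by omega
      have : (n0 : ℝ) ≤ ((n0 - K * (K + M + 1) : ℕ) : ℝ) + K * (K + M + 1) := by exact_mod_cast this
      linarith
    refine le_trans ?_ h1
    have h2 : ∑ M ∈ Finset.range M0, ((n0 : ℝ) - K * (K + M + 1)) = M0 * n0 - M0 * (K * (K + 1)) - K * ∑ M ∈ Finset.range M0, (M : ℝ) := by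
      rw [Finset.mul_sum, ← sub_eq_zero]
      simp only [Finset.sum_sub_distrib, Finset.sum_const, Finset.card_range, nsmul_eq_mul, mul_add, Finset.sum_add_distrib]
      ring
    rw [h2]
    have h3 : ∑ M ∈ Finset.range M0, (M : ℝ) ≤ M0 ^ 2 / 2 := sum_id_le M0
    have h5 : (K : ℝ) * ∑ M ∈ Finset.range M0, (M : ℝ) ≤ K * (M0 ^ 2 / 2) := by gcongr
    have h6 : (n0 : ℝ) * (M0 * (1 - 2 / L) - M0 ^ 2 / ((K + 1) * L)) = M0 * n0 - M0 * (K * (K + 1)) - K * (M0 ^ 2 / 2) := by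
      rw [hn0R]; field_simp
    rw [h6]; linarith
  have hfl : Real.log (n0.factorial) ≤ n0 * Real.log (K * (K + 1) / 2 * L) := by
    rw [← hn0R, ← Real.log_pow]
    apply Real.log_le_log (by exact_mod_cast Nat.factorial_pos n0)
    exact_mod_cast Nat.factorial_le_pow n0
  have hdgR : ((∑ c : ↥(tri K ×ˢ Finset.range L), (c.1.1.2.1 + c.1.1.2.2) : ℕ) : ℝ) = n0 * (2 / 3 * (K - 1)) := by
    rw [hsd]
    have h3 : (3 : ℝ) * (∑ q ∈ tri K, (q.2.1 + q.2.2) : ℕ) + K * (K + 1) = K * K * (K + 1) := by exact_mod_cast tri_deg K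
    rw [Nat.cast_mul, hn0R]
    have : ((∑ q ∈ tri K, (q.2.1 + q.2.2) : ℕ) : ℝ) = (K * K * (K + 1) - K * (K + 1)) / 3 := by linarith
    rw [this]; ring
  have hs1R : ((∑ c : ↥(tri K ×ˢ Finset.range L), c.1.2 : ℕ) : ℝ) = n0 * (((L : ℝ) - 1) / 2) := by
    have : (2 : ℝ) * (∑ c : ↥(tri K ×ˢ Finset.range L), c.1.2 : ℕ) = n0 * ((L - 1 : ℕ) : ℝ) := by exact_mod_cast h2s
    rw [Nat.cast_sub hL] at this
    push_cast at this ⊢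
    linarith
  rw [hdgR, hs1R] at key
  have hkR : (0 : ℝ) ≤ k := Nat.cast_nonneg _
  have g1 := mul_le_mul_of_nonneg_left hfl hkR
  have g2 := mul_le_mul_of_nonneg_right hTh hlogρ
  have g3 : ρ * ((∑ c : ↥(tri K ×ˢ Finset.range L), |((c.1.2 : ℕ) : ℝ) - ((L - 1 : ℕ) : ℝ) / 2|) * (1 / 2 * W)) ≤ ρ * ((n0 * (L / 4)) * (1 / 2 * W)) := by gcongr
  refine nonneg_of_mul_nonneg_right (a := (n0 : ℝ)) ?_ hn0p
  refine key.trans ?_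
  calc _ ≤ (k : ℝ) * (n0 * Real.log (K * (K + 1) / 2 * L)) + k * (n0 * (2 / 3 * (K - 1)) * Real.log X) +
      n0 * (((L : ℝ) - 1) / 2) * A + n0 * Real.log 2 - n0 * (M0 * (1 - 2 / L) - M0 ^ 2 / ((K + 1) * L)) * Real.log ρ +
      ρ * ((n0 * (L / 4)) * (1 / 2 * W)) := by linarith
    _ = _ := by ring

end

section

open Polynomial

theorem params_ok (q H L u v K D : ℕ) (hq : 8 ≤ q) (hH : 7 ≤ H) (hL : 1000 ≤ L) (hv : v = q * H * L ^ 2) (hu : u = q * v)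
    (hK : K = 960 * u) (hD : D + 1 = K) :
    (60 * u + L ≤ 120 * u) ∧ (∀ B, B * (94 * v) ≤ 2 * (L * D) → 60 * u + 57 * u + L * B ≤ 120 * u) ∧
    (∀ A, A * (60 * u) ≤ 2 * (L * D) → 94 * v + A + L * A ≤ 96 * v) ∧
    (2 * (L * D) ≤ 60 * u * (94 * v)) ∧ (L * D < 94 * v * (240 * q * L ^ 2)) ∧ (L * D < 60 * u * (240 * q * L ^ 2)) ∧
    ((L * D) ^ 2 < 60 * u * (94 * v) * (240 * q * L ^ 2)) ∧
    (10 * (L * D) * ((60 * u + 6 * u) * (94 * v + 10 * v) * (240 * q * L ^ 2)) ≤ (6 * u * (10 * v)) * (60 * u * (94 * v) * (240 * q * L ^ 2))) ∧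
    (10 * (L * D) ^ 2 * ((60 * u + 6 * u) * (94 * v + 10 * v) * (240 * q * L ^ 2)) < 9 * (60 * u * (94 * v) * (240 * q * L ^ 2)) ^ 2) := by
  have hqH : 56 ≤ q * H := by nlinarith
  have hL2 : 1000 * L ≤ L ^ 2 := by nlinarith
  have hv56 : 56 * L ^ 2 ≤ v := by rw [hv]; exact Nat.mul_le_mul_right _ hqH
  have hvL : 56000 * L ≤ v := by nlinarith
  have hvp : 0 < v := by omega
  have hup : 0 < u := by rw [hu]; positivity
  have hvu : 8 * v ≤ u := by rw [hu]; exact Nat.mul_le_mul_right _ hq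
  have hLD : L * D ≤ 960 * L * u := by
    have : D ≤ 960 * u := by omega
    calc L * D ≤ L * (960 * u) := Nat.mul_le_mul_left _ this
      _ = _ := by ring
  have hL0 : 0 < L := by omega
  refine ⟨by omega, ?_, ?_, ?_, ?_, ?_, ?_, ?_, ?_⟩
  · intro B hB
    have h1 : (94 * B) * v ≤ (1920 * L * q) * v := by rw [hu] at hLD; nlinarith
    have h2 : 94 * B ≤ 1920 * L * q := Nat.le_of_mul_le_mul_right h1 hvp
    have h3 : 94 * (L * B) ≤ 1920 * q * L ^ 2 := by nlinarith
    have h4 : 56 * (q * L ^ 2) ≤ u := by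
      rw [hu]; calc 56 * (q * L ^ 2) = q * (56 * L ^ 2) := by ring
        _ ≤ _ := Nat.mul_le_mul_left _ hv56
    have : 94 * (L * B) ≤ 35 * u := by nlinarith
    omega
  · intro A hA
    have h1 : (60 * A) * u ≤ (1920 * L) * u := by nlinarith
    have h2 : 60 * A ≤ 1920 * L := Nat.le_of_mul_le_mul_right h1 hup
    have h3 : A ≤ 32 * L := by omega
    have h4 : L * A ≤ 32 * L ^ 2 := by nlinarith
    omega
  · calc 2 * (L * D) ≤ 2 * (960 * L * u) := by omega
      _ = 1920 * u * L := by ring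
      _ ≤ 1920 * u * v := Nat.mul_le_mul_left _ (by omega)
      _ ≤ _ := by nlinarith [Nat.zero_le (u * v)]
  · calc L * D ≤ 960 * L * u := hLD
      _ = 960 * (q * v) * L := by rw [hu]; ring
      _ < 22560 * (q * v) * L ^ 2 := by
          have : 0 < q * v := by positivity
          nlinarith
      _ = _ := by ring
  · calc L * D ≤ 960 * L * u := hLD
      _ = 960 * u * L := by ring
      _ < 14400 * u * L ^ 2 := by nlinarith
      _ ≤ 14400 * u * L ^ 2 * q := Nat.le_mul_of_pos_right _ (by omega)
      _ = _ := by ring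
  · calc (L * D) ^ 2 ≤ (960 * L * u) ^ 2 := Nat.pow_le_pow_left hLD 2
      _ = 921600 * (u * u * L ^ 2) := by ring
      _ < 1353600 * (u * u * L ^ 2) := by
          have : 0 < u * u * L ^ 2 := by positivity
          omega
      _ = 1353600 * (u * (q * v) * L ^ 2) := by rw [← hu]
      _ = _ := by ring
  · calc 10 * (L * D) * ((60 * u + 6 * u) * (94 * v + 10 * v) * (240 * q * L ^ 2))
        ≤ 10 * (960 * L * u) * ((60 * u + 6 * u) * (94 * v + 10 * v) * (240 * q * L ^ 2)) := by gcongr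
      _ = (u ^ 2 * v * (240 * q * L ^ 2)) * (65894400 * L) := by ring
      _ ≤ (u ^ 2 * v * (240 * q * L ^ 2)) * (338400 * v) := Nat.mul_le_mul_left _ (by omega)
      _ = _ := by ring
  · calc 10 * (L * D) ^ 2 * ((60 * u + 6 * u) * (94 * v + 10 * v) * (240 * q * L ^ 2))
        ≤ 10 * (960 * L * u) ^ 2 * ((60 * u + 6 * u) * (94 * v + 10 * v) * (240 * q * L ^ 2)) := by gcongr
      _ = 15182069760000 * (u ^ 3 * (q * v) * L ^ 4) := by ring
      _ = 15182069760000 * (u ^ 4 * L ^ 4) := by rw [← hu]; ring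
      _ < 16490096640000 * (u ^ 4 * L ^ 4) := by
          have : 0 < u ^ 4 * L ^ 4 := by positivity
          omega
      _ = 16490096640000 * (u ^ 2 * (q * v) ^ 2 * L ^ 4) := by rw [← hu]; ring
      _ = _ := by ring

set_option maxHeartbeats 1600000 in
theorem baker (k N d L H u v K : ℕ) (hk : 2 ≤ k) (hL : 1000 ≤ L) (hH : 7 ≤ H)
    (hv : v = (k + 6) * H * L ^ 2) (hu : u = (k + 6) * v) (hK : K = 960 * u)
    (α : ℝ) (hα : 1 < α) (hα2 : α < 2) (f ν τ : ℤ[X]) (hf : f.Monic) (hfk : f.natDegree ≤ k) (hfα : aeval α f = 0)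
    (hconj : ∀ β : ℂ, aeval β f = 0 → β ≠ (α : ℂ) → ‖β‖ ≤ 1)
    (hν : 0 < aeval α ν) (hτ : 0 < aeval α τ) (Hν Hτ : ℝ) (hHν : 1 ≤ Hν) (hHτ : 1 ≤ Hτ)
    (hν1 : aeval α ν ≤ Hν) (hτ1 : aeval α τ ≤ Hτ)
    (hν2 : ∀ β : ℂ, ‖β‖ ≤ 1 → ‖aeval β ν‖ ≤ Hν) (hτ2 : ∀ β : ℂ, ‖β‖ ≤ 1 → ‖aeval β τ‖ ≤ Hτ)
    (hgh : |Real.log (aeval α ν / aeval α τ)| ≤ Real.log Hν + Real.log Hτ)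
    (hh : Real.log Hν + Real.log Hτ ≤ H)
    (hθ : ∀ A B : ℕ, 0 < A → 0 < B → α ^ B ≠ 10 ^ A)
    (hND : ∀ A B : ℕ, 0 < A → 0 < B → A ≤ 16 → Nat.Coprime A B →
      0.00005 * ((A : ℝ) + B) ≤ |B * Real.log α - A * Real.log 10|)
    (hNK : 3000 * K ≤ N) (hdK : K ≤ d)
    (X : ℝ) (hX1 : ((120 * u : ℕ) : ℝ) + N * (240 * (k + 6) * L ^ 2 : ℕ) ≤ X)
    (hX2 : ((96 * v : ℕ) : ℝ) + d * (240 * (k + 6) * L ^ 2 : ℕ) + 1 ≤ X)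
    (hlX : k * Real.log X ≤ L / 4) :
    Real.exp (-(1440 * ((k + 6 : ℕ) : ℝ) ^ 2 * H * L ^ 3)) < |N * Real.log α - d * Real.log 10 + Real.log (aeval α ν / aeval α τ)| := by
  by_contra hcon
  push Not at hcon
  set T := 240 * (k + 6) * L ^ 2 with hT
  set Λ := N * Real.log α - d * Real.log 10 + Real.log (aeval α ν / aeval α τ) with hΛ
  set h := Real.log Hν + Real.log Hτ with hhd
  set M0 := 480 * u * (L - 2) with hM0
  have hLR : (1000 : ℝ) ≤ L := by exact_mod_cast hL
  have hL56 : 56 * L ^ 2 ≤ v := by rw [hv]; exact Nat.mul_le_mul_right _ (by nlinarith)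
  have hvL : 56000 * L ≤ v := by
    have h0 : 1000 * L ≤ L * L := Nat.mul_le_mul_right L hL
    have h1 : L ^ 2 = L * L := sq L
    omega
  have hHv : H ≤ v := by
    rw [hv]
    calc H = 1 * H * 1 := by ring
      _ ≤ (k + 6) * H * L ^ 2 := by gcongr <;> first | omega | exact Nat.one_le_pow _ _ (by omega)
  have hvu : 8 * v ≤ u := by rw [hu]; exact Nat.mul_le_mul_right _ (by omega)
  have hup : 0 < u := by omega
  have hKbig : 56000000 ≤ K := by omega
  have hTK : T ≤ K := by
    rw [hT, hK, hu, hv]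
    calc 240 * (k + 6) * L ^ 2 = 240 * ((k + 6) * 1 * (1 * L ^ 2)) := by ring
      _ ≤ 960 * ((k + 6) * (k + 6) * (H * L ^ 2)) := by gcongr <;> omega
      _ = _ := by ring
  have hT1 : 1 ≤ T := by rw [hT]; exact Nat.one_le_iff_ne_zero.mpr (by positivity)
  have hKR : (K : ℝ) = 960 * u := by rw [hK]; push_cast; ring
  have hKRb : (56000000 : ℝ) ≤ K := by exact_mod_cast hKbig
  have huR : (u : ℝ) = ((k + 6 : ℕ) : ℝ) ^ 2 * H * L ^ 2 := by rw [hu, hv]; push_cast; ring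
  have hM0R : (M0 : ℝ) = K / 2 * (L - 2) := by
    rw [hM0, Nat.cast_mul, Nat.cast_sub (by omega), hKR]; push_cast; ring
  have hρe : Real.exp 3 ≤ 20.1 := by
    have := Real.exp_one_lt_d9
    have h3 : Real.exp 3 = Real.exp 1 ^ 3 := by rw [← Real.exp_nat_mul]; norm_num
    rw [h3]
    calc Real.exp 1 ^ 3 ≤ 2.7182818286 ^ 3 := by gcongr
      _ ≤ _ := by norm_num
  have hΛs : K * T * |Λ| * Real.exp 3 ^ M0 ≤ 1 := by
    have e1 : Real.exp 3 ^ M0 = Real.exp (3 * (K / 2 * (L - 2))) := by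
      rw [← Real.exp_nat_mul, hM0R]; ring_nf
    rw [e1]
    have hTKR : (T : ℝ) ≤ K := by exact_mod_cast hTK
    have hKe : (K : ℝ) ≤ Real.exp K := by have := Real.add_one_le_exp (K : ℝ); linarith
    calc K * T * |Λ| * Real.exp (3 * (K / 2 * (L - 2)))
        ≤ Real.exp K * Real.exp K * Real.exp (-(1440 * ((k + 6 : ℕ) : ℝ) ^ 2 * H * L ^ 3)) * Real.exp (3 * (K / 2 * (L - 2))) := by
          gcongr; exact hTKR.trans hKe
      _ = Real.exp (K + K + (-(1440 * ((k + 6 : ℕ) : ℝ) ^ 2 * H * L ^ 3)) + 3 * (K / 2 * (L - 2))) := by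
          rw [Real.exp_add, Real.exp_add, Real.exp_add]
      _ = Real.exp (- K) := by
          congr 1
          have : 1440 * ((k + 6 : ℕ) : ℝ) ^ 2 * H * L ^ 3 = 1440 * u * L := by rw [huR]; ring
          rw [this, hKR]; ring
      _ ≤ 1 := Real.exp_le_one_iff.mpr (by linarith)
  have hb10 : Real.log 10 ≤ 2.303 := by
    rw [Real.log_le_iff_le_exp (by norm_num)]
    have : Real.exp 2.303 = Real.exp 1 ^ 2 * Real.exp 0.303 := by
      rw [← Real.exp_nat_mul, ← Real.exp_add]; norm_num
    rw [this]
    have h1 := Real.exp_one_gt_d9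
    have h2 : 1 + 0.303 + 0.303 ^ 2 / 2 + 0.303 ^ 3 / 6 ≤ Real.exp 0.303 := by
      have := Real.sum_le_exp_of_nonneg (x := 0.303) (by norm_num) 4
      simp [Finset.sum_range_succ, Nat.factorial] at this
      norm_num at this ⊢
      linarith
    calc (10 : ℝ) ≤ 2.7182818283 ^ 2 * (1 + 0.303 + 0.303 ^ 2 / 2 + 0.303 ^ 3 / 6) := by norm_num
      _ ≤ _ := by gcongr
  have hb0 : 0 < Real.log 10 := Real.log_pos (by norm_num)
  have ha0 : 0 < Real.log α := Real.log_pos hα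
  have ha2 : Real.log α ≤ 0.6932 := by
    have := Real.log_le_log (by linarith) hα2.le
    have := Real.log_two_lt_d9
    linarith
  have hh0 : 0 ≤ h := by have := Real.log_nonneg hHν; have := Real.log_nonneg hHτ; linarith
  obtain ⟨p1, p2, p3, p4, p5, p6, p7, p8, p9⟩ := params_ok (k + 6) H L u v K (K - 1) (by omega) hH hL hv hu hK (by omega)
  have hΛ1 : |Λ| ≤ 1 := hcon.trans (Real.exp_le_one_iff.mpr (by
    have : (0 : ℝ) ≤ 1440 * ((k + 6 : ℕ) : ℝ) ^ 2 * H * L ^ 3 := by positivity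
    linarith))
  have hHK : (H : ℝ) + 1 ≤ 0.01 * K := by
    have h1 : (H : ℝ) ≤ v := by exact_mod_cast hHv
    have h2 : (8 : ℝ) * v ≤ u := by exact_mod_cast hvu
    linarith
  have key := core k N d (120 * u) (96 * v) T L K M0 (by omega) (by omega) (by omega) hT1 α hα f ν τ hf hfk hfα hconj hν hτ
    Hν Hτ hHν hHτ hν1 hτ1 hν2 hτ2 X (Real.exp 3) hgh hX1 hX2 (Real.one_le_exp (by norm_num)) hΛs (by
      intro P hP hv0
      refine zero_est N d (120 * u) (96 * v) T L (K - 1) (60 * u) (94 * v) (6 * u) (10 * v) (57 * u) α _ (by linarith) (by linarith)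
        (div_pos hν hτ) P hP hv0 (by omega) (by omega) (by omega) (by omega) p1 (by omega) p2 p3 p4 p5 p6 p7 p8 p9 hθ ?_
      intro A B hA hB hAB hr1
      have hA16 : A ≤ 16 := by
        by_contra hlt
        have : 57 * u * 17 ≤ 57 * u * A := Nat.mul_le_mul_left _ (by omega)
        omega
      have hnd := hND A B hA hB hA16 hAB
      have hreal : ((A * (60 * u) + B * (94 * v) : ℕ) : ℝ) ≤ |(B : ℝ) * d - A * N| := by
        have e : ((B : ℝ) * d - A * N) * Real.log 10 = N * (B * Real.log α - A * Real.log 10) + B * (Real.log (aeval α ν / aeval α τ) - Λ) := by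
          rw [hΛ]; ring
        have e2 : |(B : ℝ) * d - A * N| * Real.log 10 = |((B : ℝ) * d - A * N) * Real.log 10| := by
          rw [abs_mul, abs_of_pos hb0]
        have hBR : (0 : ℝ) < B := by exact_mod_cast hB
        have hAR : (0 : ℝ) < A := by exact_mod_cast hA
        have e3 : |(B : ℝ) * (Real.log (aeval α ν / aeval α τ) - Λ)| ≤ B * (H + 1) := by
          rw [abs_mul, abs_of_pos hBR]
          gcongr
          refine (abs_sub _ _).trans ?_
          linarith
        have hNKR : (3000 : ℝ) * K ≤ N := by exact_mod_cast hNK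
        have e4 : 0.15 * K * (A + B) ≤ |N * (B * Real.log α - A * Real.log 10)| := by
          rw [abs_mul, Nat.abs_cast]
          calc 0.15 * K * ((A : ℝ) + B) = (3000 * K) * (0.00005 * (A + B)) := by ring
            _ ≤ _ := by gcongr
        have e5 : |N * (B * Real.log α - A * Real.log 10)| - |(B : ℝ) * (Real.log (aeval α ν / aeval α τ) - Λ)| ≤
            |N * (B * Real.log α - A * Real.log 10) + B * (Real.log (aeval α ν / aeval α τ) - Λ)| := by
          have := abs_sub_abs_le_abs_sub (N * (B * Real.log α - A * Real.log 10)) (-(B * (Real.log (aeval α ν / aeval α τ) - Λ)))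
          rw [abs_neg, sub_neg_eq_add] at this
          exact this
        rw [← e, ← e2] at e5
        have e6 : (B : ℝ) * (H + 1) ≤ B * (0.01 * K) := by gcongr
        have hvuR : (8 : ℝ) * v ≤ u := by exact_mod_cast hvu
        have e7 : ((A * (60 * u) + B * (94 * v) : ℕ) : ℝ) * Real.log 10 ≤ |(B : ℝ) * d - A * N| * Real.log 10 := by
          refine le_trans ?_ ((by linarith : 0.15 * K * ((A : ℝ) + B) - B * (0.01 * K) ≤ _ ).trans e5)
          push_cast
          calc ((A : ℝ) * (60 * u) + B * (94 * v)) * Real.log 10 ≤ ((A : ℝ) * (60 * u) + B * (94 * (u / 8))) * 2.303 := by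
                gcongr; linarith
            _ ≤ _ := by rw [hKR]; linarith [mul_pos hAR (by exact_mod_cast hup : (0 : ℝ) < u), mul_pos hBR (by exact_mod_cast hup : (0 : ℝ) < u)]
        exact le_of_mul_le_mul_right e7 hb0
      have : ((A * (60 * u) + B * (94 * v) : ℕ) : ℝ) ≤ ((|(B : ℤ) * d - A * N| : ℤ) : ℝ) := by push_cast at hreal ⊢; exact hreal
      exact_mod_cast this)
  rw [Real.log_exp, hM0R] at key
  -- numerical contradiction
  have hKp : (0 : ℝ) < K := by linarith
  have hkR : (2 : ℝ) ≤ k := by exact_mod_cast hk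
  have hX0 : (1 : ℝ) ≤ X := by
    have : (0 : ℝ) ≤ ((96 * v : ℕ) : ℝ) + d * (T : ℕ) := by positivity
    linarith
  have hlX0 : 0 ≤ Real.log X := Real.log_nonneg hX0
  have hn0 : Real.log ((K : ℝ) * (K + 1) / 2 * L) ≤ 2 * Real.log X := by
    rw [← Nat.cast_two, ← Real.log_pow]
    apply Real.log_le_log (by positivity)
    have hXK : (K : ℝ) * L ≤ X := by
      refine le_trans ?_ hX1
      have g1 : (K : ℝ) ≤ N := by
        have : K ≤ N := by omega
        exact_mod_cast this
      have g2 : (L : ℝ) ≤ (T : ℕ) := by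
        have : L ≤ T := by
          rw [hT]
          calc L = 1 * 1 * L ^ 1 := by ring
            _ ≤ 240 * (k + 6) * L ^ 2 := by gcongr <;> omega
        exact_mod_cast this
      have : (K : ℝ) * L ≤ N * (T : ℕ) := by gcongr
      have : (0 : ℝ) ≤ ((120 * u : ℕ) : ℝ) := Nat.cast_nonneg _
      linarith
    calc (K : ℝ) * (K + 1) / 2 * L ≤ K * (K + K) / 2 * L := by gcongr; linarith
      _ = K * K * (L * 1) := by ring
      _ ≤ K * K * (L * L) := by gcongr; linarith
      _ = (K * L) ^ 2 := by ring
      _ ≤ X ^ 2 := by gcongr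
  have t1 : (k : ℝ) * (Real.log (K * (K + 1) / 2 * L) + 2 / 3 * (K - 1) * Real.log X) ≤ L / 2 + K * L / 6 := by
    calc (k : ℝ) * (Real.log (K * (K + 1) / 2 * L) + 2 / 3 * (K - 1) * Real.log X)
        ≤ (k : ℝ) * (2 * Real.log X + 2 / 3 * K * Real.log X) := by gcongr; linarith
      _ = (2 + 2 / 3 * K) * (k * Real.log X) := by ring
      _ ≤ (2 + 2 / 3 * K) * (L / 4) := by gcongr
      _ = _ := by ring
  have hq : ((k + 6 : ℕ) : ℝ) = k + 6 := by push_cast; ring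
  have hRu : ((120 * u : ℕ) : ℝ) = K / 8 := by rw [hKR]; push_cast; ring
  have hSv : ((96 * v : ℕ) : ℝ) * (k + 6) = K / 10 := by rw [hKR, hu]; push_cast; ring
  have hTv : (T : ℝ) * (k + 6) * H = K / 4 := by rw [hKR, huR, hT]; push_cast; ring
  have hST : (k + 6) * (((96 * v : ℕ) : ℝ) * Real.log 10 + T * h) ≤ 0.4803 * K := by
    calc (k + 6) * (((96 * v : ℕ) : ℝ) * Real.log 10 + T * h) ≤ (k + 6) * (((96 * v : ℕ) : ℝ) * 2.303 + T * H) := by gcongr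
      _ = (((96 * v : ℕ) : ℝ) * (k + 6)) * 2.303 + (T : ℝ) * (k + 6) * H := by ring
      _ = _ := by rw [hSv, hTv]; ring
  have hST0 : 0 ≤ ((96 * v : ℕ) : ℝ) * Real.log 10 + T * h := by positivity
  have t2 : ((L : ℝ) - 1) / 2 * (((120 * u : ℕ) : ℝ) * Real.log α + k * (((96 * v : ℕ) : ℝ) * Real.log 10 + T * h)) +
      Real.exp 3 * (L / 8 * (((120 * u : ℕ) : ℝ) * Real.log α + ((96 * v : ℕ) : ℝ) * Real.log 10 + T * h)) ≤ 0.5025 * K * L := by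
    rw [hRu]
    have hKa : 0 ≤ (K : ℝ) / 8 * Real.log α := by positivity
    calc _ ≤ (L : ℝ) / 2 * ((K : ℝ) / 8 * Real.log α + k * (((96 * v : ℕ) : ℝ) * Real.log 10 + T * h)) +
        20.1 * (L / 8 * ((K : ℝ) / 8 * Real.log α + ((96 * v : ℕ) : ℝ) * Real.log 10 + T * h)) := by
          gcongr
          linarith
      _ = (L : ℝ) / 2 * ((K : ℝ) / 8 * Real.log α * 6.025 + (k + 5.025) * (((96 * v : ℕ) : ℝ) * Real.log 10 + T * h)) := by ring
      _ ≤ (L : ℝ) / 2 * ((K : ℝ) / 8 * 0.6932 * 6.025 + (k + 6) * (((96 * v : ℕ) : ℝ) * Real.log 10 + T * h)) := by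
          gcongr; norm_num
      _ ≤ (L : ℝ) / 2 * ((K : ℝ) / 8 * 0.6932 * 6.025 + 0.4803 * K) := by gcongr
      _ ≤ _ := by linarith [mul_pos hKp (by linarith : (0 : ℝ) < L)]
  have t3 : (K : ℝ) * L / 4 - K ≤ (K / 2 * ((L : ℝ) - 2) * (1 - 2 / L) - (K / 2 * ((L : ℝ) - 2)) ^ 2 / ((K + 1) * L)) := by
    have hLp : (0 : ℝ) < L := by linarith
    have s1 : (K / 2 * ((L : ℝ) - 2)) ^ 2 / ((K + 1) * L) ≤ (K / 2 * ((L : ℝ) - 2)) ^ 2 / (K * L) := by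
      gcongr; linarith
    have s2 : K / 2 * ((L : ℝ) - 2) * (1 - 2 / L) - (K / 2 * ((L : ℝ) - 2)) ^ 2 / (K * L) = K * L / 4 - K + K / L := by
      field_simp; ring
    have : 0 < (K : ℝ) / L := by positivity
    linarith
  have hl2 : Real.log 2 ≤ 1 := by have := Real.log_two_lt_d9; linarith
  have hKL : 1000 * (K : ℝ) ≤ K * L := by linarith [mul_le_mul_of_nonneg_left hLR hKp.le]
  have hKL2 : 56000000 * (L : ℝ) ≤ K * L := mul_le_mul_of_nonneg_right (by linarith) (by linarith)
  linarith

end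

section

open Polynomial

theorem exists_root (k : ℕ) (hk : 2 ≤ k) : ∃ α : ℝ, 1.6 < α ∧ α < 2 ∧ α ^ k * (2 - α) = 1 := by
  have hc : ContinuousOn (fun x : ℝ => x ^ k * (2 - x)) (Set.Icc 1.6 2) := by fun_prop
  have h1 : (1.6 : ℝ) ^ 2 ≤ 1.6 ^ k := pow_le_pow_right₀ (by norm_num) hk
  have h16 : (1 : ℝ) < (1.6 : ℝ) ^ k * (2 - 1.6) := by norm_num at h1 ⊢; linarith
  have := intermediate_value_Icc' (by norm_num : (1.6 : ℝ) ≤ 2) hc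
  obtain ⟨x, ⟨hx1, hx2⟩, hx⟩ := this (show (1 : ℝ) ∈ Set.Icc ((2 : ℝ) ^ k * (2 - 2)) (1.6 ^ k * (2 - 1.6)) from ⟨by norm_num, h16.le⟩)
  refine ⟨x, lt_of_le_of_ne hx1 ?_, lt_of_le_of_ne hx2 ?_, hx⟩
  · rintro rfl; simp only at hx; linarith
  · rintro rfl; simp at hx

noncomputable def lucf (k : ℕ) : ℤ[X] := X ^ k - ∑ i ∈ Finset.range k, X ^ i

theorem lucf_deg (k : ℕ) : (∑ i ∈ Finset.range k, (X : ℤ[X]) ^ i).degree < k := by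
  rw [degree_lt_iff_coeff_zero]
  intro m hm
  rw [Polynomial.finsetSum_coeff]
  apply Finset.sum_eq_zero
  intro i hi
  rw [coeff_X_pow, if_neg]
  have := Finset.mem_range.mp hi
  omega

theorem lucf_monic (k : ℕ) : (lucf k).Monic := monic_X_pow_sub (lucf_deg k)

theorem lucf_natDegree (k : ℕ) : (lucf k).natDegree ≤ k := by
  apply natDegree_le_of_degree_le
  refine (degree_sub_le _ _).trans ?_
  rw [degree_X_pow]
  exact max_le le_rfl (lucf_deg k).le

theorem lucf_aeval {A : Type*} [CommRing A] (k : ℕ) (x : A) : aeval x (lucf k) = x ^ k - ∑ i ∈ Finset.range k, x ^ i := by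
  simp [lucf]

theorem lucf_geom {A : Type*} [CommRing A] (k : ℕ) (x : A) : (x - 1) * aeval x (lucf k) = 1 - x ^ k * (2 - x) := by
  rw [lucf_aeval]
  have := geom_sum_mul x k
  linear_combination - this

theorem lucf_root {k : ℕ} {α : ℝ} (h1 : 1.6 < α) (h : α ^ k * (2 - α) = 1) : aeval α (lucf k) = 0 := by
  have := lucf_geom k α
  rw [h, sub_self] at this
  rcases mul_eq_zero.mp this with h | h
  · linarith
  · exact h

theorem root_inv_sum {k : ℕ} {t : ℝ} (h1 : 1 < t) (h : t ^ k * (2 - t) = 1) : ∑ i ∈ Finset.range k, t⁻¹ ^ (i + 1) = 1 := by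
  have h0 : t ≠ 0 := by linarith
  have h2 : t⁻¹ ≠ 1 := by
    intro h; rw [inv_eq_one] at h; linarith
  simp only [pow_succ, ← Finset.sum_mul]
  rw [geom_sum_eq h2]
  have hd : t⁻¹ - 1 ≠ 0 := sub_ne_zero.mpr h2
  have h3 : t⁻¹ ^ k = 2 - t := by
    rw [inv_pow]; exact inv_eq_of_mul_eq_one_right h
  rw [h3]
  have h4 : 1 - t ≠ 0 := by intro h; linarith
  have h5 : t⁻¹ - 1 = (1 - t) * t⁻¹ := by field_simp
  rw [h5]
  field_simp
  ring

theorem root_unique {k : ℕ} (hk : 1 ≤ k) {α t : ℝ} (h1 : 1 < α) (h : α ^ k * (2 - α) = 1) (ht1 : 1 < t) (ht : t ^ k * (2 - t) = 1) : t = α := by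
  have key : ∀ x y : ℝ, 1 < x → x < y → ∑ i ∈ Finset.range k, y⁻¹ ^ (i + 1) < ∑ i ∈ Finset.range k, x⁻¹ ^ (i + 1) := by
    intro x y hx hxy
    apply Finset.sum_lt_sum_of_nonempty ⟨0, Finset.mem_range.mpr (by omega)⟩
    intro i _
    have hy : 0 < y := by linarith
    have : y⁻¹ < x⁻¹ := inv_strictAnti₀ (by linarith) hxy
    exact pow_lt_pow_left₀ this (by positivity) (by omega)
  have e1 := root_inv_sum h1 h
  have e2 := root_inv_sum ht1 ht
  rcases lt_trichotomy t α with hlt | heq | hgt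
  · have := key _ _ ht1 hlt; linarith
  · exact heq
  · have := key _ _ h1 hgt; linarith

theorem root_conj {k : ℕ} (hk : 2 ≤ k) {α : ℝ} (h1 : 1.6 < α) (h : α ^ k * (2 - α) = 1) (β : ℂ) (hβ : aeval β (lucf k) = 0)
    (hne : β ≠ (α : ℂ)) : ‖β‖ ≤ 1 := by
  by_contra hcon
  push Not at hcon
  set t := ‖β‖ with ht
  have e1 := lucf_geom k β
  rw [hβ, mul_zero] at e1
  have e2 : β ^ k * (2 - β) = 1 := by linear_combination e1
  have e3 : t ^ k * ‖2 - β‖ = 1 := by rw [ht, ← norm_pow, ← norm_mul, e2, norm_one]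
  have htk : 0 < t ^ k := by positivity
  have e4 : 2 - t ≤ ‖2 - β‖ := by
    have := norm_sub_norm_le (2 : ℂ) β
    simpa using this
  have e5 : t ^ k ≤ ∑ i ∈ Finset.range k, t ^ i := by
    rw [lucf_aeval, sub_eq_zero] at hβ
    rw [ht, ← norm_pow, hβ]
    refine (norm_sum_le _ _).trans (le_of_eq ?_)
    simp [norm_pow]
  have e6 := geom_sum_mul t k
  have e7 : t ^ k * (t - 1) ≤ t ^ k - 1 := by
    rw [← e6]; exact mul_le_mul_of_nonneg_right e5 (by linarith)
  have e8 : t ^ k * (2 - t) = 1 := by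
    apply le_antisymm
    · rw [← e3]; gcongr
    · linarith
  have e9 : ‖2 - β‖ = 2 - t := by
    have : t ^ k * ‖2 - β‖ = t ^ k * (2 - t) := by rw [e3, e8]
    exact mul_left_cancel₀ htk.ne' this
  have et := root_unique (by omega) (by linarith) h hcon e8
  apply hne
  -- real part
  have q1 : ‖2 - β‖ ^ 2 = (2 - β.re) ^ 2 + β.im ^ 2 := by
    rw [Complex.sq_norm, Complex.normSq_apply]; simp; ring
  have q2 : t ^ 2 = β.re ^ 2 + β.im ^ 2 := by
    rw [ht, Complex.sq_norm, Complex.normSq_apply]; ring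
  rw [e9] at q1
  have q3 : β.re = t := by nlinarith
  have q4 : β.im = 0 := by
    have : β.im ^ 2 = 0 := by rw [q3] at q2; linarith
    exact pow_eq_zero_iff (by norm_num) |>.mp this
  apply Complex.ext
  · rw [q3, et]; simp
  · rw [q4]; simp

theorem root_pow_ne {k : ℕ} (hk : 2 ≤ k) {α : ℝ} (h1 : 1.6 < α) (h : α ^ k * (2 - α) = 1) (A B : ℕ) (hA : 0 < A) (_hB : 0 < B) :
    α ^ B ≠ 10 ^ A := by
  intro hAB
  have hy := root_inv_sum (by linarith : (1 : ℝ) < α) h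
  have h_integral : IsIntegral ℤ (α⁻¹) := by
    refine ⟨(X ^ k + ((∑ i ∈ Finset.range (k - 1), X ^ (i + 1)) - 1) : ℤ[X]), ?_, ?_⟩
    · apply monic_X_pow_add
      rw [degree_lt_iff_coeff_zero]
      intro m hm
      rw [coeff_sub, Polynomial.finsetSum_coeff, coeff_one, if_neg (by omega), Finset.sum_eq_zero, sub_zero]
      intro i hi
      rw [coeff_X_pow, if_neg]
      have := Finset.mem_range.mp hi
      omega
    · have : k = (k - 1) + 1 := by omega
      rw [this, Finset.sum_range_succ] at hy
      rw [← this] at hy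
      simp [eval₂_finsetSum]
      simp at hy
      linarith
  have h2 : IsIntegral ℤ ((α⁻¹) ^ B) := h_integral.pow B
  rw [inv_pow, hAB] at h2
  have h3 : ((10 : ℝ) ^ A)⁻¹ = algebraMap ℚ ℝ ((10 ^ A)⁻¹) := by simp
  rw [h3, isIntegral_algebraMap_iff (algebraMap ℚ ℝ).injective] at h2
  obtain ⟨z, hz⟩ := IsIntegrallyClosed.isIntegral_iff.mp h2
  have h4 : (z : ℚ) * 10 ^ A = 1 := by
    have : (z : ℚ) = (10 ^ A)⁻¹ := by simpa using hz
    rw [this]; field_simp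
  have h5 : z * 10 ^ A = 1 := by exact_mod_cast h4
  have h6 : (10 : ℤ) ∣ 1 := by
    rw [← h5]; exact Dvd.dvd.mul_left (dvd_pow_self _ (by omega)) _
  omega

end

section

/-- shifted sequence -/
def lsh (k j : ℕ) : ℕ := if j < k - 2 then 0 else lucasK k (j - (k - 2))

theorem lucasK_zero (k : ℕ) : lucasK k 0 = 2 := by rw [lucasK]
theorem lucasK_one (k : ℕ) : lucasK k 1 = 1 := by rw [lucasK]
theorem lucasK_rec (k n : ℕ) : lucasK k (n + 2) = ∑ j ∈ Finset.range k, if j ≤ n + 1 then lucasK k (n + 1 - j) else 0 := by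
  rw [lucasK]; simp

theorem lsh_eq (k n : ℕ) : lsh k (n + (k - 2)) = lucasK k n := by
  unfold lsh
  rw [if_neg (by omega), Nat.add_sub_cancel]

theorem lsh_rec (k : ℕ) (hk : 2 ≤ k) (j : ℕ) : lsh k (j + k) = ∑ i ∈ Finset.range k, lsh k (j + i) := by
  have h1 : j + k = (j + 2) + (k - 2) := by omega
  rw [h1, lsh_eq, lucasK_rec, ← Finset.sum_range_reflect]
  apply Finset.sum_congr rfl
  intro i hi
  have := Finset.mem_range.mp hi
  unfold lsh
  by_cases h : j + i < k - 2
  · rw [if_pos h, if_neg (by omega)]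
  · rw [if_neg h, if_pos (by omega)]
    congr 1; omega

theorem lsh_rec2 (k : ℕ) (hk : 2 ≤ k) (j : ℕ) : lsh k (j + k + 1) + lsh k j = 2 * lsh k (j + k) := by
  have h1 := lsh_rec k hk (j + 1)
  have h2 := lsh_rec k hk j
  have h3 : ∑ i ∈ Finset.range k, lsh k (j + 1 + i) + lsh k j = ∑ i ∈ Finset.range (k + 1), lsh k (j + i) := by
    rw [Finset.sum_range_succ']
    congr 1
    apply Finset.sum_congr rfl
    intro i _; congr 1; ring
  rw [Finset.sum_range_succ, ← h2] at h3
  have : j + k + 1 = j + 1 + k := by ring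
  rw [this, h1, h3]; ring

theorem root_k_bound {k : ℕ} (hk : 2 ≤ k) {α : ℝ} (h1 : 1.6 < α) : (k : ℝ) * α⁻¹ ^ (k + 1) ≤ 0.489 := by
  have : ∀ k : ℕ, 2 ≤ k → (k : ℝ) * (1.6⁻¹ : ℝ) ^ (k + 1) ≤ 0.489 := by
    intro k hk
    induction k, hk using Nat.le_induction with
    | base => norm_num
    | succ n hn ih =>
      have hnR : (2 : ℝ) ≤ n := by exact_mod_cast hn
      rw [pow_succ]
      have hp : (0 : ℝ) < (1.6⁻¹ : ℝ) ^ (n + 1) := by positivity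
      push_cast
      have : ((n : ℝ) + 1) * (1.6⁻¹) ≤ n := by norm_num; linarith
      nlinarith
  refine le_trans ?_ (this k hk)
  have : α⁻¹ ≤ (1.6)⁻¹ := inv_anti₀ (by norm_num) h1.le
  have : 0 ≤ α⁻¹ := by positivity
  gcongr

/-- leading coefficient -/
noncomputable def lc (k : ℕ) (α : ℝ) : ℝ := (2 * α - 1) * (α - 1) / (α * ((k + 1) * α - 2 * k))

theorem root_inv {k : ℕ} {α : ℝ} (h : α ^ k * (2 - α) = 1) : α⁻¹ ^ k = 2 - α := by
  rw [inv_pow]; exact inv_eq_of_mul_eq_one_right h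

theorem mu_eq {k : ℕ} {α : ℝ} (h1 : 1.6 < α) (h : α ^ k * (2 - α) = 1) :
    ((k + 1) * α - 2 * k) = α * (1 - k * α⁻¹ ^ (k + 1)) := by
  have h0 : α ≠ 0 := by linarith
  rw [pow_succ, root_inv h]; field_simp; ring

theorem mu_pos {k : ℕ} (hk : 2 ≤ k) {α : ℝ} (h1 : 1.6 < α) (h : α ^ k * (2 - α) = 1) :
    0.8 ≤ (k + 1) * α - 2 * k := by
  rw [mu_eq h1 h]
  have := root_k_bound hk h1
  nlinarith

theorem lc_bounds {k : ℕ} (hk : 2 ≤ k) {α : ℝ} (h1 : 1.6 < α) (h2 : α < 2) (h : α ^ k * (2 - α) = 1) :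
    0.51 ≤ lc k α ∧ lc k α ≤ 1.5 := by
  have hb := root_k_bound hk h1
  have hp : 0 ≤ (k : ℝ) * α⁻¹ ^ (k + 1) := by have : 0 < α := by linarith
                                              positivity
  unfold lc
  rw [mu_eq h1 h]
  set x := (k : ℝ) * α⁻¹ ^ (k + 1)
  have hd : 0 < α * (α * (1 - x)) := by
    have : 0 < α := by linarith
    have : 0 < 1 - x := by linarith
    positivity
  constructor
  · rw [le_div_iff₀ hd]; nlinarith
  · rw [div_le_iff₀ hd]; nlinarith

theorem lsh_err (k : ℕ) (hk : 2 ≤ k) {α : ℝ} (h1 : 1.6 < α) (h2 : α < 2) (h : α ^ k * (2 - α) = 1) :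
    ∀ j, |(lsh k j : ℝ) - lc k α * α⁻¹ ^ (k - 2) * α ^ j| ≤ 3 := by
  have h0 : 0 < α := by linarith
  have hne : α ≠ 0 := h0.ne'
  obtain ⟨hc1, hc2⟩ := lc_bounds hk h1 h2 h
  have hμ := mu_pos hk h1 h
  have hik := root_inv h
  set c := lc k α with hc
  set c2 := c * α⁻¹ ^ (k - 2) with hc2d
  have hsum := root_inv_sum (by linarith : (1 : ℝ) < α) h
  set W : ℕ → ℝ := fun j => (lsh k (j + k) : ℝ) - ∑ i ∈ Finset.range k, α⁻¹ ^ (i + 1) * lsh k (j + i) with hW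
  have hWs : ∀ j, W (j + 1) = α * W j := by
    intro j
    have e1 : (lsh k (j + k + 1) : ℝ) + lsh k j = 2 * lsh k (j + k) := by exact_mod_cast lsh_rec2 k hk j
    have e2 : α * ∑ i ∈ Finset.range k, α⁻¹ ^ (i + 1) * (lsh k (j + i) : ℝ) + α⁻¹ ^ k * lsh k (j + k) =
        ∑ i ∈ Finset.range k, α⁻¹ ^ (i + 1) * (lsh k (j + 1 + i) : ℝ) + lsh k j := by
      have a1 : α * ∑ i ∈ Finset.range k, α⁻¹ ^ (i + 1) * (lsh k (j + i) : ℝ) = ∑ i ∈ Finset.range k, α⁻¹ ^ i * (lsh k (j + i) : ℝ) := by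
        rw [Finset.mul_sum]
        apply Finset.sum_congr rfl
        intro i _
        rw [pow_succ]; field_simp
      rw [a1, ← Finset.sum_range_succ (fun i => α⁻¹ ^ i * (lsh k (j + i) : ℝ)) k, Finset.sum_range_succ']
      simp only [pow_zero, one_mul, add_zero]
      congr 1
      apply Finset.sum_congr rfl
      intro i _
      congr 3; ring
    simp only [hW]
    have e3 : j + 1 + k = j + k + 1 := by ring
    rw [e3]
    rw [hik] at e2
    linear_combination e1 + e2
  have hW0 : W 0 = (2 * α - 1) * (α - 1) := by
    have b1 : lsh k (0 + k) = 3 := by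
      have : 0 + k = 2 + (k - 2) := by omega
      rw [this, lsh_eq, lucasK_rec]
      have hkk : k = (k - 2) + 1 + 1 := by omega
      rw [hkk, Finset.sum_range_succ', Finset.sum_range_succ', Finset.sum_eq_zero]
      · simp [lucasK_zero, lucasK_one]
      · intro i _; rw [if_neg (by omega)]
    have b2 : ∑ i ∈ Finset.range k, α⁻¹ ^ (i + 1) * (lsh k (0 + i) : ℝ) = α⁻¹ ^ k * 1 + α⁻¹ ^ (k - 1) * 2 := by
      have hkk : k = (k - 2) + 1 + 1 := by omega
      have : ∑ i ∈ Finset.range ((k - 2) + 1 + 1), α⁻¹ ^ (i + 1) * (lsh k (0 + i) : ℝ) = α⁻¹ ^ (k - 2 + 1 + 1) * 1 + α⁻¹ ^ (k - 2 + 1) * 2 := by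
        rw [Finset.sum_range_succ, Finset.sum_range_succ, Finset.sum_eq_zero]
        · have c0 : lsh k (0 + (k - 2)) = 2 := by rw [lsh_eq, lucasK_zero]
          have c1 : lsh k (0 + (k - 2 + 1)) = 1 := by
            have : 0 + (k - 2 + 1) = 1 + (k - 2) := by ring
            rw [this, lsh_eq, lucasK_one]
          rw [c0, c1]; push_cast; ring
        · intro i hi
          have := Finset.mem_range.mp hi
          unfold lsh
          rw [if_pos (by omega)]; simp
      rw [← hkk] at this
      have hk1 : k - 2 + 1 = k - 1 := by omega
      rw [this, hk1]
    have b3 : α⁻¹ ^ (k - 1) = α * (2 - α) := by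
      rw [← hik]
      have : k = (k - 1) + 1 := by omega
      conv_rhs => rw [this, pow_succ]
      field_simp
    simp only [hW]
    rw [b1, b2, b3, hik]; push_cast; ring
  have hWj : ∀ j, W j = (2 * α - 1) * (α - 1) * α ^ j := by
    intro j
    induction j with
    | zero => simp [hW0]
    | succ j ih => rw [hWs, ih]; ring
  -- the recurrence for the error
  have hc2W : ∀ j, c2 * α ^ (j + k) - ∑ i ∈ Finset.range k, α⁻¹ ^ (i + 1) * (c2 * α ^ (j + i)) = (2 * α - 1) * (α - 1) * α ^ j := by
    intro j
    have a1 : ∑ i ∈ Finset.range k, α⁻¹ ^ (i + 1) * (c2 * α ^ (j + i)) = k * (α⁻¹ * c2 * α ^ j) := by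
      rw [Finset.sum_congr rfl (g := fun _ => α⁻¹ * c2 * α ^ j)]
      · simp
      · intro i _
        rw [pow_add, pow_succ, inv_pow]; field_simp; rw [pow_add]; ring
    have a2 : c2 * α ^ k = c * α ^ 2 := by
      rw [hc2d]
      have : k = (k - 2) + 2 := by omega
      conv_lhs => rw [this, pow_add]
      simp only [Nat.add_sub_cancel, inv_pow]
      field_simp
    have a3 : c2 = c * α ^ 2 * (2 - α) := by
      rw [← a2, mul_assoc, h, mul_one]
    have a4 : c * (α * ((k + 1) * α - 2 * k)) = (2 * α - 1) * (α - 1) := by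
      rw [hc, lc, div_mul_cancel₀]
      exact mul_ne_zero hne (by linarith)
    have a5 : α⁻¹ * c2 = c * α * (2 - α) := by rw [a3]; field_simp
    rw [a1, a5, pow_add, ← a4]
    have : c2 * (α ^ j * α ^ k) = c * α ^ 2 * α ^ j := by rw [← a2]; ring
    rw [this]; ring
  intro j
  induction j using Nat.strong_induction_on with
  | _ j ih =>
  by_cases hj : j < k
  · -- initial values
    have hcp : 0 < c := by linarith
    by_cases h3 : j < k - 2
    · have : lsh k j = 0 := by unfold lsh; rw [if_pos h3]
      rw [this, Nat.cast_zero, zero_sub, abs_neg, abs_of_nonneg (by positivity)]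
      have : α⁻¹ ^ (k - 2) * α ^ j ≤ 1 := by
        have : k - 2 = j + (k - 2 - j) := by omega
        rw [this, pow_add]
        have e : α⁻¹ ^ j * α ^ j = 1 := by rw [← mul_pow]; field_simp; simp
        calc _ = α⁻¹ ^ (k - 2 - j) * (α⁻¹ ^ j * α ^ j) := by ring
          _ = α⁻¹ ^ (k - 2 - j) := by rw [e, mul_one]
          _ ≤ 1 := pow_le_one₀ (by positivity) (inv_le_one_of_one_le₀ (by linarith))
      calc c2 * α ^ j = c * (α⁻¹ ^ (k - 2) * α ^ j) := by rw [hc2d]; ring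
        _ ≤ c * 1 := by gcongr
        _ ≤ 3 := by linarith
    · have e0 : α⁻¹ ^ (k - 2) * α ^ (k - 2) = 1 := by rw [← mul_pow]; field_simp; simp
      have : j = 0 + (k - 2) ∨ j = 1 + (k - 2) := by omega
      rcases this with rfl | rfl
      · rw [lsh_eq, lucasK_zero, pow_add, hc2d]
        have : c * α⁻¹ ^ (k - 2) * (α ^ 0 * α ^ (k - 2)) = c := by
          rw [pow_zero, one_mul, mul_assoc, e0, mul_one]
        rw [this, abs_le]; push_cast; constructor <;> linarith
      · rw [lsh_eq, lucasK_one, pow_add, hc2d]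
        have : c * α⁻¹ ^ (k - 2) * (α ^ 1 * α ^ (k - 2)) = c * α := by
          rw [pow_one]; linear_combination c * α * e0
        rw [this, abs_le]; push_cast; constructor <;> nlinarith
  · have hjk : j = (j - k) + k := by omega
    set p := j - k with hp
    have r1 := hWj p
    have r2 := hc2W p
    simp only [hW] at r1
    have r3 : (lsh k j : ℝ) - c2 * α ^ j = ∑ i ∈ Finset.range k, α⁻¹ ^ (i + 1) * ((lsh k (p + i) : ℝ) - c2 * α ^ (p + i)) := by
      rw [hjk]
      simp only [mul_sub, Finset.sum_sub_distrib]
      linear_combination r1 - r2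
    rw [r3]
    refine (Finset.abs_sum_le_sum_abs _ _).trans ?_
    calc ∑ i ∈ Finset.range k, |α⁻¹ ^ (i + 1) * ((lsh k (p + i) : ℝ) - c2 * α ^ (p + i))|
        ≤ ∑ i ∈ Finset.range k, α⁻¹ ^ (i + 1) * 3 := by
          apply Finset.sum_le_sum
          intro i hi
          have := Finset.mem_range.mp hi
          rw [abs_mul, abs_of_pos (by positivity)]
          gcongr
          exact ih (p + i) (by omega)
      _ = 3 := by rw [← Finset.sum_mul, hsum, one_mul]

theorem lucas_err (k : ℕ) (hk : 2 ≤ k) {α : ℝ} (h1 : 1.6 < α) (h2 : α < 2) (h : α ^ k * (2 - α) = 1) (n : ℕ) :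
    |(lucasK k n : ℝ) - lc k α * α ^ n| ≤ 3 := by
  have := lsh_err k hk h1 h2 h (n + (k - 2))
  rw [lsh_eq] at this
  have e0 : α⁻¹ ^ (k - 2) * α ^ (k - 2) = 1 := by
    have : α ≠ 0 := by linarith
    rw [← mul_pow]; field_simp; simp
  have : lc k α * α⁻¹ ^ (k - 2) * α ^ (n + (k - 2)) = lc k α * α ^ n := by
    rw [pow_add]; linear_combination lc k α * α ^ n * e0
  rwa [← this]

end

section

open Polynomial

theorem inv_sum_lt {k : ℕ} (hk : 1 ≤ k) (x y : ℝ) (hx : 1 < x) (hxy : x < y) :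
    ∑ i ∈ Finset.range k, y⁻¹ ^ (i + 1) < ∑ i ∈ Finset.range k, x⁻¹ ^ (i + 1) := by
  apply Finset.sum_lt_sum_of_nonempty ⟨0, Finset.mem_range.mpr (by omega)⟩
  intro i _
  have hy : 0 < y := by linarith
  have : y⁻¹ < x⁻¹ := inv_strictAnti₀ (by linarith) hxy
  exact pow_lt_pow_left₀ this (by positivity) (by omega)

theorem inv_sum_eq (k : ℕ) (t : ℝ) (ht : 1 < t) : (t - 1) * ∑ i ∈ Finset.range k, t⁻¹ ^ (i + 1) = 1 - t⁻¹ ^ k := by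
  have h0 : t ≠ 0 := by linarith
  induction k with
  | zero => simp
  | succ k ih =>
    rw [Finset.sum_range_succ, mul_add, ih, pow_succ]; field_simp; ring

theorem root_le_of {k : ℕ} (hk : 1 ≤ k) {α t : ℝ} (h1 : 1 < α) (h : α ^ k * (2 - α) = 1) (ht : 1 < t) (hg : t ^ k * (2 - t) ≤ 1) : α ≤ t := by
  by_contra hcon
  push Not at hcon
  have a1 := inv_sum_lt hk t α ht hcon
  rw [root_inv_sum h1 h] at a1
  have a2 := inv_sum_eq k t ht
  have a3 : t - 1 < 1 - t⁻¹ ^ k := by rw [← a2]; nlinarith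
  have htk : 0 < t ^ k := by positivity
  have a4 : t ^ k * t⁻¹ ^ k = 1 := by rw [← mul_pow, mul_inv_cancel₀ (by linarith), one_pow]
  nlinarith

theorem le_root_of {k : ℕ} (hk : 1 ≤ k) {α t : ℝ} (h1 : 1 < α) (h : α ^ k * (2 - α) = 1) (ht : 1 < t) (hg : 1 ≤ t ^ k * (2 - t)) : t ≤ α := by
  by_contra hcon
  push Not at hcon
  have a1 := inv_sum_lt hk α t h1 hcon
  rw [root_inv_sum h1 h] at a1
  have a2 := inv_sum_eq k t ht
  have a3 : 1 - t⁻¹ ^ k < t - 1 := by rw [← a2]; nlinarith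
  have htk : 0 < t ^ k := by positivity
  have a4 : t ^ k * t⁻¹ ^ k = 1 := by rw [← mul_pow, mul_inv_cancel₀ (by linarith), one_pow]
  nlinarith

def ndc (lo hi A B : ℕ) : Bool :=
  Nat.gcd A B != 1 || Nat.ble (hi ^ B * 20000) (10 ^ (A + 7 * B) * (20000 - (A + B))) ||
    Nat.ble (10 ^ (A + 7 * B) * 20000) (lo ^ B * (20000 - (A + B)))

def ndall (lo hi : ℕ) : Bool := (List.range 16).all fun A => (List.range 95).all fun B => ndc lo hi (A + 1) (B + 1)

theorem nd_of (lo hi : ℕ) (hc : ndall lo hi = true) (hlo : 0 < lo) {α : ℝ} (h1 : 1.6 < α) (hl : (lo : ℝ) / 10 ^ 7 ≤ α) (hh : α ≤ (hi : ℝ) / 10 ^ 7)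
    (A B : ℕ) (hA : 0 < A) (hB : 0 < B) (hA16 : A ≤ 16) (hAB : Nat.Coprime A B) :
    0.00005 * ((A : ℝ) + B) ≤ |B * Real.log α - A * Real.log 10| := by
  have hb10 : Real.log 10 ≤ 2.303 := by
    rw [Real.log_le_iff_le_exp (by norm_num)]
    have : Real.exp 2.303 = Real.exp 1 ^ 2 * Real.exp 0.303 := by
      rw [← Real.exp_nat_mul, ← Real.exp_add]; norm_num
    rw [this]
    have h1 := Real.exp_one_gt_d9
    have h2 : 1 + 0.303 + 0.303 ^ 2 / 2 + 0.303 ^ 3 / 6 ≤ Real.exp 0.303 := by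
      have := Real.sum_le_exp_of_nonneg (x := 0.303) (by norm_num) 4
      simp [Finset.sum_range_succ, Nat.factorial] at this
      norm_num at this ⊢
      linarith
    calc (10 : ℝ) ≤ 2.7182818283 ^ 2 * (1 + 0.303 + 0.303 ^ 2 / 2 + 0.303 ^ 3 / 6) := by norm_num
      _ ≤ _ := by gcongr
  have hα0 : 0 < α := by linarith
  have ha : 0.4 ≤ Real.log α := by
    rw [Real.le_log_iff_exp_le hα0]
    have : Real.exp 0.4 ≤ 1.6 := by
      have := Real.exp_bound_div_one_sub_of_interval (x := 0.2) (by norm_num) (by norm_num)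
      have e : Real.exp 0.4 = Real.exp 0.2 ^ 2 := by rw [← Real.exp_nat_mul]; norm_num
      rw [e]
      calc Real.exp 0.2 ^ 2 ≤ (1 / (1 - 0.2)) ^ 2 := by gcongr
        _ ≤ 1.6 := by norm_num
    linarith
  have hAR : (0 : ℝ) < A := by exact_mod_cast hA
  have hBR : (0 : ℝ) < B := by exact_mod_cast hB
  by_cases hBA : 6 * A ≤ B
  · have hBA' : (6 : ℝ) * A ≤ B := by exact_mod_cast hBA
    refine le_trans ?_ (le_abs_self _)
    have : (A : ℝ) * Real.log 10 ≤ A * 2.303 := by gcongr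
    have : (B : ℝ) * 0.4 ≤ B * Real.log α := by gcongr
    linarith
  · have hB95 : B ≤ 95 := by omega
    have hcc : ndc lo hi A B = true := by
      unfold ndall at hc
      rw [List.all_eq_true] at hc
      have h1 := hc (A - 1) (List.mem_range.mpr (by omega))
      rw [List.all_eq_true] at h1
      have h2 := h1 (B - 1) (List.mem_range.mpr (by omega))
      rwa [Nat.sub_add_cancel (by omega), Nat.sub_add_cancel (by omega)] at h2
    unfold ndc at hcc
    simp only [Bool.or_eq_true, bne_iff_ne, Nat.ble_eq] at hcc
    have hsub : ((20000 - (A + B) : ℕ) : ℝ) = 20000 - (A + B) := by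
      rw [Nat.cast_sub (by omega)]; push_cast; ring
    set t : ℝ := 0.00005 * ((A : ℝ) + B) with ht
    have ht1 : t ≤ 0.01 := by
      have : (A : ℝ) ≤ 16 := by exact_mod_cast hA16
      have : (B : ℝ) ≤ 95 := by exact_mod_cast hB95
      rw [ht]; linarith
    have hlt : Real.log (1 - t) ≤ - t := by
      have := Real.log_le_sub_one_of_pos (by linarith : 0 < 1 - t)
      linarith
    have ht0 : 0 < t := by positivity
    rcases hcc with (hcc | hcc) | hcc
    · exact absurd hAB hcc
    · have hR : ((hi : ℝ) ^ B * 20000) ≤ (10 ^ (A + 7 * B) * (20000 - (A + B))) := by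
        rw [← hsub]; exact_mod_cast hcc
      have h3 : α ^ B ≤ 10 ^ A * (1 - t) := by
        calc α ^ B ≤ ((hi : ℝ) / 10 ^ 7) ^ B := by gcongr
          _ = (hi : ℝ) ^ B * 20000 / (20000 * 10 ^ (7 * B)) := by rw [div_pow, ← pow_mul]; field_simp
          _ ≤ (10 ^ (A + 7 * B) * (20000 - (A + B))) / (20000 * 10 ^ (7 * B)) := by gcongr
          _ = _ := by rw [pow_add, ht]; field_simp; ring
      have h4 := Real.log_le_log (by positivity) h3
      rw [Real.log_pow, Real.log_mul (by positivity) (by linarith), Real.log_pow] at h4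
      rw [abs_sub_comm]
      refine le_trans ?_ (le_abs_self _)
      linarith
    · have hR : (10 ^ (A + 7 * B) * 20000 : ℝ) ≤ lo ^ B * (20000 - (A + B)) := by
        rw [← hsub]; exact_mod_cast hcc
      have h3 : 10 ^ A ≤ α ^ B * (1 - t) := by
        calc (10 : ℝ) ^ A = (10 ^ (A + 7 * B) * 20000) / (20000 * 10 ^ (7 * B)) := by rw [pow_add]; field_simp
          _ ≤ (lo ^ B * (20000 - (A + B))) / (20000 * 10 ^ (7 * B)) := by gcongr
          _ = ((lo : ℝ) / 10 ^ 7) ^ B * (1 - t) := by rw [div_pow, ← pow_mul, ht]; field_simp; ring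
          _ ≤ _ := by gcongr; linarith
      have h4 := Real.log_le_log (by positivity) h3
      rw [Real.log_pow, Real.log_mul (by positivity) (by linarith), Real.log_pow] at h4
      refine le_trans ?_ (le_abs_self _)
      linarith

def ndlist : List (ℕ × ℕ) := [(2, 16180339), (3, 18392867), (4, 19275619), (5, 19659482), (6, 19835828), (7, 19919641), (8, 19960311),
  (9, 19980294), (10, 19990186), (11, 19995104), (12, 19997555), (13, 19998778), (14, 19999389), (15, 19999694), (16, 19999847),
  (17, 19999923), (18, 19999961), (19, 19999980)]

def ndroot (k x : ℕ) : Bool := Nat.ble (10 ^ (7 * (k + 1))) (x ^ k * (20000000 - x)) && Nat.ble ((x + 1) ^ k * (20000000 - (x + 1))) (10 ^ (7 * (k + 1)))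
  && Nat.ble (x + 1) 20000000 && Nat.ble 16000000 x

theorem ndlist_ok : (ndlist.all fun p => ndroot p.1 p.2 && ndall p.2 (p.2 + 1)) = true := by decide +kernel

theorem nd_big : ndall 19999160 20000000 = true := by decide +kernel

theorem nd_ok {k : ℕ} (hk : 2 ≤ k) {α : ℝ} (h1 : 1.6 < α) (h2 : α < 2) (h : α ^ k * (2 - α) = 1)
    (A B : ℕ) (hA : 0 < A) (hB : 0 < B) (hA16 : A ≤ 16) (hAB : Nat.Coprime A B) :
    0.00005 * ((A : ℝ) + B) ≤ |B * Real.log α - A * Real.log 10| := by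
  by_cases hk20 : 20 ≤ k
  · refine nd_of 19999160 20000000 nd_big (by norm_num) h1 ?_ (by norm_num; linarith) A B hA hB hA16 hAB
    have h3 : (1.6 : ℝ) ^ 20 ≤ α ^ k := (pow_le_pow_right₀ (by norm_num) hk20).trans (by gcongr)
    have h4 : (1.6 : ℝ) ^ 20 * (2 - α) ≤ 1 := by rw [← h]; gcongr
    norm_num at h4 ⊢
    linarith
  · have hex : ∃ p ∈ ndlist, p.1 = k := by
      have : ∀ j ∈ Finset.Icc 2 19, ∃ p ∈ ndlist, p.1 = j := by decide
      exact this k (Finset.mem_Icc.mpr ⟨hk, by omega⟩)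
    obtain ⟨⟨k', x⟩, hp, hpk⟩ := hex
    simp only at hpk
    subst hpk
    have := List.all_eq_true.mp ndlist_ok _ hp
    simp only [Bool.and_eq_true, ndroot, Nat.ble_eq] at this
    obtain ⟨⟨⟨⟨r1, r2⟩, r3⟩, r4⟩, r5⟩ := this
    have r4R : (16000000 : ℝ) ≤ x := by exact_mod_cast r4
    have r3R : (x : ℝ) + 1 ≤ 20000000 := by exact_mod_cast r3
    have r1R : (10 : ℝ) ^ (7 * (k' + 1)) ≤ (x : ℝ) ^ k' * (20000000 - x) := by
      have : ((20000000 - x : ℕ) : ℝ) = 20000000 - x := by rw [Nat.cast_sub (by omega)]; norm_num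
      rw [← this]; exact_mod_cast r1
    have r2R : ((x : ℝ) + 1) ^ k' * (20000000 - (x + 1)) ≤ (10 : ℝ) ^ (7 * (k' + 1)) := by
      have : ((20000000 - (x + 1) : ℕ) : ℝ) = 20000000 - (x + 1) := by rw [Nat.cast_sub (by omega)]; push_cast; ring
      rw [← this]; exact_mod_cast r2
    have key : ∀ y : ℝ, (y / 10 ^ 7) ^ k' * (2 - y / 10 ^ 7) = (y ^ k' * (20000000 - y)) / 10 ^ (7 * (k' + 1)) := by
      intro y
      rw [div_pow, ← pow_mul, mul_add, pow_add]; field_simp; norm_num; ring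
    refine nd_of x (x + 1) r5 (by omega) h1 ?_ ?_ A B hA hB hA16 hAB
    · apply le_root_of (by omega) (by linarith) h
      · rw [lt_div_iff₀ (by norm_num)]; linarith
      · rw [key, le_div_iff₀ (by positivity)]; linarith
    · push_cast
      apply root_le_of (by omega) (by linarith) h
      · rw [lt_div_iff₀ (by norm_num)]; linarith
      · rw [key, div_le_iff₀ (by positivity)]; linarith

end

section

open Polynomial

set_option maxHeartbeats 1600000 in
theorem stage_baker (k N d L H E a j : ℕ) (hk : 2 ≤ k) (hL : 1000 ≤ L) (hE : 1 ≤ E) (ha1 : 1 ≤ a) (ha9 : a ≤ 9) (hj : j ≤ 3) (n : ℕ)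
    {α : ℝ} (h1 : 1.6 < α) (h2 : α < 2) (h : α ^ k * (2 - α) = 1)
    (hh : Real.log (1944 * E) + Real.log (9 * (3 * k + 1) ^ 3) ≤ H)
    (hnN : n ≤ N) (hN3 : N ≤ 3 * n) (hd2 : d ≤ 2 * n) (hd1 : n ≤ 100 * d)
    (hbig : 2 * (1440 * ((k + 6 : ℕ) : ℝ) ^ 2 * L ^ 3 * H) ≤ n)
    (hlX : k * Real.log (n * (721 * (k + 6) * L ^ 2)) ≤ L / 4) :
    Real.exp (-(1440 * ((k + 6 : ℕ) : ℝ) ^ 2 * L ^ 3 * H)) < |N * Real.log α - d * Real.log 10 + Real.log (9 * E * lc k α ^ j / a)| := by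
  have hkR : (2 : ℝ) ≤ k := by exact_mod_cast hk
  have hER : (1 : ℝ) ≤ E := by exact_mod_cast hE
  have haR : (1 : ℝ) ≤ a := by exact_mod_cast ha1
  have haR9 : (a : ℝ) ≤ 9 := by exact_mod_cast ha9
  have hLR : (1000 : ℝ) ≤ L := by exact_mod_cast hL
  have hmu := mu_pos hk h1 h
  set ν : ℤ[X] := C (9 * (E : ℤ)) * ((C 2 * X - 1) * (X - 1)) ^ j with hν
  set τ : ℤ[X] := C (a : ℤ) * (X * (C ((k : ℤ) + 1) * X - C (2 * (k : ℤ)))) ^ j with hτ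
  have eν : aeval α ν = 9 * E * ((2 * α - 1) * (α - 1)) ^ j := by
    simp only [hν, map_mul, map_add, map_pow, map_sub, map_one, aeval_C, aeval_X, algebraMap_int_eq, Int.coe_castRingHom]; push_cast; ring
  have eτ : aeval α τ = a * (α * ((k + 1) * α - 2 * k)) ^ j := by
    simp only [hτ, map_mul, map_add, map_pow, map_sub, map_one, aeval_C, aeval_X, algebraMap_int_eq, Int.coe_castRingHom]; push_cast; ring
  have eνc : ∀ β : ℂ, aeval β ν = 9 * E * ((2 * β - 1) * (β - 1)) ^ j := by
    intro β; simp only [hν, map_mul, map_add, map_pow, map_sub, map_one, aeval_C, aeval_X, algebraMap_int_eq, Int.coe_castRingHom]; push_cast; ring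
  have eτc : ∀ β : ℂ, aeval β τ = a * (β * ((k + 1) * β - 2 * k)) ^ j := by
    intro β; simp only [hτ, map_mul, map_add, map_pow, map_sub, map_one, aeval_C, aeval_X, algebraMap_int_eq, Int.coe_castRingHom]; push_cast; ring
  have pow6 : (6 : ℝ) ^ j ≤ 216 := by
    calc (6 : ℝ) ^ j ≤ 6 ^ 3 := pow_le_pow_right₀ (by norm_num) hj
      _ = 216 := by norm_num
  have powk : ((3 * (k : ℝ) + 1)) ^ j ≤ (3 * k + 1) ^ 3 := pow_le_pow_right₀ (by linarith) hj
  have hν0 : (1 : ℝ) ≤ ((2 * α - 1) * (α - 1)) ^ j := one_le_pow₀ (by nlinarith)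
  have hτ0 : (1 : ℝ) ≤ (α * ((k + 1) * α - 2 * k)) ^ j := one_le_pow₀ (by nlinarith)
  have hν9 : (1 : ℝ) ≤ aeval α ν := by rw [eν]; nlinarith
  have hτ1 : (1 : ℝ) ≤ aeval α τ := by rw [eτ]; nlinarith
  have hq : aeval α ν / aeval α τ = 9 * E * lc k α ^ j / a := by
    rw [eν, eτ, lc, div_pow]
    have : (α * ((k + 1) * α - 2 * k)) ^ j ≠ 0 := by positivity
    field_simp
  have hν1 : aeval α ν ≤ 1944 * E := by
    rw [eν]
    calc 9 * E * ((2 * α - 1) * (α - 1)) ^ j ≤ 9 * E * 6 ^ j := by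
          have hb1 : (2 * α - 1) * (α - 1) ≤ 6 := by nlinarith
          have hb0 : 0 ≤ (2 * α - 1) * (α - 1) := by nlinarith
          gcongr
      _ ≤ 9 * E * 216 := by gcongr
      _ = _ := by ring
  have hτu : aeval α τ ≤ 9 * (3 * k + 1) ^ 3 := by
    rw [eτ]
    have hb : (k + 1) * α - 2 * k ≤ 2 := by nlinarith
    have hb2 : α * ((k + 1) * α - 2 * k) ≤ 3 * k + 1 := by nlinarith
    have hb0 : 0 ≤ α * ((k + 1) * α - 2 * k) := by nlinarith
    calc a * (α * ((k + 1) * α - 2 * k)) ^ j ≤ 9 * (3 * k + 1) ^ j := by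
          gcongr
      _ ≤ _ := by gcongr
  have hν2 : ∀ β : ℂ, ‖β‖ ≤ 1 → ‖aeval β ν‖ ≤ 1944 * E := by
    intro β hβ
    rw [eνc]
    have b1 : ‖2 * β - 1‖ ≤ 3 := by
      refine (norm_sub_le _ _).trans ?_
      simp only [norm_mul, RCLike.norm_ofNat, norm_one]; linarith
    have b2 : ‖β - 1‖ ≤ 2 := by
      refine (norm_sub_le _ _).trans ?_
      simp only [norm_one]; linarith
    have : ‖(9 * E * ((2 * β - 1) * (β - 1)) ^ j : ℂ)‖ = 9 * E * (‖2 * β - 1‖ * ‖β - 1‖) ^ j := by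
      simp [norm_mul, norm_pow]
    rw [this]
    calc 9 * (E : ℝ) * (‖2 * β - 1‖ * ‖β - 1‖) ^ j ≤ 9 * E * (3 * 2) ^ j := by gcongr
      _ ≤ 9 * E * 216 := by gcongr; norm_num; exact pow6
      _ = _ := by ring
  have hτ2 : ∀ β : ℂ, ‖β‖ ≤ 1 → ‖aeval β τ‖ ≤ 9 * (3 * k + 1) ^ 3 := by
    intro β hβ
    rw [eτc]
    have b1 : ‖((k : ℂ) + 1) * β - 2 * k‖ ≤ 3 * k + 1 := by
      refine (norm_sub_le _ _).trans ?_
      have e1 : ‖((k : ℂ) + 1)‖ = k + 1 := by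
        have : ((k : ℂ) + 1) = ((k + 1 : ℕ) : ℂ) := by push_cast; ring
        rw [this, Complex.norm_natCast]; push_cast; ring
      rw [norm_mul, e1, norm_mul, Complex.norm_natCast, RCLike.norm_ofNat]
      have := mul_le_mul_of_nonneg_left hβ (show (0 : ℝ) ≤ k + 1 by positivity)
      linarith
    have : ‖(a * (β * ((k + 1) * β - 2 * k)) ^ j : ℂ)‖ = a * (‖β‖ * ‖((k : ℂ) + 1) * β - 2 * k‖) ^ j := by
      simp [norm_mul, norm_pow]
    rw [this]
    calc (a : ℝ) * (‖β‖ * ‖((k : ℂ) + 1) * β - 2 * k‖) ^ j ≤ 9 * (1 * (3 * k + 1)) ^ j := by gcongr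
      _ ≤ _ := by rw [one_mul]; gcongr
  have hHν : (1 : ℝ) ≤ 1944 * E := by linarith
  have hHτ : (1 : ℝ) ≤ 9 * (3 * k + 1) ^ 3 := by
    have : (1 : ℝ) ≤ (3 * k + 1) ^ 3 := one_le_pow₀ (by linarith)
    linarith
  have hgh : |Real.log (aeval α ν / aeval α τ)| ≤ Real.log (1944 * E) + Real.log (9 * (3 * k + 1) ^ 3) := by
    rw [Real.log_div (by linarith) (by linarith)]
    have l1 := Real.log_nonneg hν9
    have l2 := Real.log_nonneg hτ1
    have l3 := Real.log_le_log (by linarith) hν1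
    have l4 := Real.log_le_log (by linarith) hτu
    rw [abs_le]; constructor <;> linarith
  have hH7 : 7 ≤ H := by
    have g1 : Real.log 1024 ≤ Real.log (1944 * E) := Real.log_le_log (by norm_num) (by linarith)
    have g2 : Real.log 1024 ≤ Real.log (9 * (3 * k + 1) ^ 3) := by
      apply Real.log_le_log (by norm_num)
      have : (7 : ℝ) ^ 3 ≤ (3 * k + 1) ^ 3 := by gcongr; linarith
      linarith
    have g3 : Real.log 1024 = 10 * Real.log 2 := by
      rw [show (1024 : ℝ) = 2 ^ 10 by norm_num, Real.log_pow]; norm_num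
    have := Real.log_two_gt_d9
    have : (7 : ℝ) ≤ H := by linarith
    exact_mod_cast this
  have hHR : (7 : ℝ) ≤ H := by exact_mod_cast hH7
  set u := (k + 6) * ((k + 6) * H * L ^ 2) with hu
  have huR : (u : ℝ) = ((k + 6 : ℕ) : ℝ) ^ 2 * H * L ^ 2 := by rw [hu]; push_cast; ring
  have hu0 : (0 : ℝ) ≤ u := Nat.cast_nonneg _
  have hun : 3000 * (960 * (u : ℝ)) ≤ n := by
    refine le_trans ?_ hbig
    calc 3000 * (960 * (u : ℝ)) ≤ 2 * 1440 * u * 1000 := by linarith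
      _ ≤ 2 * 1440 * u * L := by gcongr
      _ = _ := by rw [huR]; ring
  have hunN : 3000 * (960 * u) ≤ n := by exact_mod_cast hun
  have hvu : (k + 6) * H * L ^ 2 ≤ u := Nat.le_mul_of_pos_left _ (by omega)
  have hu1 : 1 ≤ u := by
    have : 0 < u := by rw [hu]; positivity
    omega
  have hnNR : (N : ℝ) ≤ 3 * n := by exact_mod_cast hN3
  have hdR : (d : ℝ) ≤ 2 * n := by exact_mod_cast hd2
  have hT : ((240 * (k + 6) * L ^ 2 : ℕ) : ℝ) = 240 * (k + 6) * L ^ 2 := by push_cast; ring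
  have hT1 : (1 : ℝ) ≤ (k + 6) * L ^ 2 := by
    have : (1 : ℝ) ≤ L ^ 2 := one_le_pow₀ (by linarith)
    have h0 : (0 : ℝ) ≤ k * L ^ 2 := by positivity
    linarith
  have hnR : (1 : ℝ) ≤ n := by
    have : (1 : ℝ) ≤ u := by exact_mod_cast hu1
    linarith
  have key := baker k N d L H u ((k + 6) * H * L ^ 2) (960 * u) hk hL hH7 rfl rfl rfl α (by linarith) h2 (lucf k) ν τ (lucf_monic k) (lucf_natDegree k)
    (lucf_root h1 h) (root_conj hk h1 h) (by linarith) (by linarith) (1944 * E) (9 * (3 * k + 1) ^ 3) hHν hHτ hν1 hτu hν2 hτ2 hgh hh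
    (root_pow_ne hk h1 h) (nd_ok hk h1 h2 h) (by omega) (by omega) (n * (721 * (k + 6) * L ^ 2)) (by
      rw [hT]
      have : (N : ℝ) * (240 * (k + 6) * L ^ 2) ≤ 3 * n * (240 * (k + 6) * L ^ 2) := by gcongr
      have : (n : ℝ) * 1 ≤ n * ((k + 6) * L ^ 2) := by gcongr
      push_cast
      nlinarith) (by
      rw [hT]
      have hv : (((k + 6) * H * L ^ 2 : ℕ) : ℝ) ≤ u := by exact_mod_cast hvu
      have : (d : ℝ) * (240 * (k + 6) * L ^ 2) ≤ 2 * n * (240 * (k + 6) * L ^ 2) := by gcongr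
      have : (n : ℝ) * 1 ≤ n * ((k + 6) * L ^ 2) := by gcongr
      rw [Nat.cast_mul 96]
      push_cast at hv ⊢
      nlinarith) hlX
  rw [hq] at key
  convert key using 2
  ring

end

section

theorem lucas_pos {k : ℕ} (hk : 2 ≤ k) (n : ℕ) : 1 ≤ lucasK k n := by
  induction n using Nat.strong_induction_on with
  | _ n ih =>
    match n, ih with
    | 0, _ => rw [lucasK_zero]; norm_num
    | 1, _ => rw [lucasK_one]
    | n + 2, ih =>
      rw [lucasK_rec]
      refine (ih (n + 1) (by omega)).trans ?_
      have := Finset.single_le_sum (f := fun j => if j ≤ n + 1 then lucasK k (n + 1 - j) else 0) (fun i _ => Nat.zero_le _)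
        (Finset.mem_range.mpr (by omega : 0 < k))
      simpa using this

theorem lucas_lower {k : ℕ} (hk : 2 ≤ k) {α : ℝ} (h1 : 1.6 < α) (h2 : α < 2) (h : α ^ k * (2 - α) = 1) (n : ℕ) :
    α ^ n ≤ 8 * (lucasK k n : ℝ) := by
  have hp : (1 : ℝ) ≤ lucasK k n := by exact_mod_cast lucas_pos hk n
  have he := (abs_le.mp (lucas_err k hk h1 h2 h n)).1
  have hc := (lc_bounds hk h1 h2 h).1
  have hα : 0 < α ^ n := by have : 0 < α := by linarith
                            positivity
  nlinarith

theorem lucas_upper {k : ℕ} (hk : 2 ≤ k) {α : ℝ} (h1 : 1.6 < α) (h2 : α < 2) (h : α ^ k * (2 - α) = 1) (n : ℕ) :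
    (lucasK k n : ℝ) ≤ 4.5 * α ^ n := by
  have he := (abs_le.mp (lucas_err k hk h1 h2 h n)).2
  have hc := (lc_bounds hk h1 h2 h).2
  have hα : 1 ≤ α ^ n := one_le_pow₀ (by linarith)
  nlinarith

theorem prod_near {p x P y : ℝ} (hp : |p - 1| ≤ P) (hx : |x - 1| ≤ y) : |p * x - 1| ≤ (1 + P) * (1 + y) - 1 := by
  have hP : 0 ≤ P := (abs_nonneg _).trans hp
  have e : p * x - 1 = (p - 1) * (x - 1) + (p - 1) + (x - 1) := by ring
  rw [e]
  refine (abs_add_le _ _).trans ?_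
  have a1 := abs_add_le ((p - 1) * (x - 1)) (p - 1)
  rw [abs_mul] at a1
  have : |p - 1| * |x - 1| ≤ P * y := by gcongr
  nlinarith

theorem prod_near4 {x1 x2 x3 δ y : ℝ} (hy : y ≤ 24) (hx1 : |x1 - 1| ≤ y) (hx2 : |x2 - 1| ≤ y) (hx3 : |x3 - 1| ≤ y) (hδ0 : 0 ≤ δ) (hδ : δ ≤ y) :
    |x1 * x2 * x3 * (1 - δ) - 1| ≤ 16276 * y := by
  have h4 : |(1 - δ) - 1| ≤ y := by rw [show (1 - δ) - 1 = -δ by ring, abs_neg, abs_of_nonneg hδ0]; exact hδ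
  have := prod_near (prod_near (prod_near hx1 hx2) hx3) h4
  refine this.trans ?_
  have hy0 : 0 ≤ y := hδ0.trans hδ
  have q2 : y * y ≤ 24 * y := by nlinarith
  have q3 : y * y * y ≤ 576 * y := by nlinarith
  have q4 : y * y * y * y ≤ 13824 * y := by nlinarith
  nlinarith

theorem log_near {Λ ε : ℝ} (hε : ε ≤ 1 / 2) (h : |Real.exp Λ - 1| ≤ ε) : |Λ| ≤ 2 * ε := by
  obtain ⟨h1, h2⟩ := abs_le.mp h
  have a1 := Real.add_one_le_exp Λ
  have a2 := Real.add_one_le_exp (-Λ)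
  have hp := Real.exp_pos Λ
  have hm : Real.exp (-Λ) * Real.exp Λ = 1 := by rw [← Real.exp_add]; simp
  have hn := Real.exp_pos (-Λ)
  rw [abs_le]
  constructor
  · have : Real.exp (-Λ) ≤ 1 + 2 * ε := by
      have : (1 + 2 * ε) * Real.exp Λ ≥ 1 := by nlinarith
      nlinarith
    linarith
  · linarith

theorem log_const : Real.log 781248 ≤ 14 := by
  rw [Real.log_le_iff_le_exp (by norm_num)]
  have : Real.exp 14 = Real.exp 1 ^ 14 := by rw [← Real.exp_nat_mul]; norm_num
  rw [this]
  have h1 := Real.exp_one_gt_d9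
  calc (781248 : ℝ) ≤ 2.7182818283 ^ 14 := by norm_num
    _ ≤ _ := by gcongr

theorem stage_end {α x1 x2 x3 δ Λ Y : ℝ} (s : ℕ) (hα : 1 < α) (hx1 : |x1 - 1| ≤ 24 / α ^ s) (hx2 : |x2 - 1| ≤ 24 / α ^ s) (hx3 : |x3 - 1| ≤ 24 / α ^ s)
    (hδ0 : 0 ≤ δ) (hδ : δ ≤ 24 / α ^ s) (hΛ : Real.exp Λ = x1 * x2 * x3 * (1 - δ)) (hY : 0 ≤ Y) (hl : Real.exp (-Y) < |Λ|) :
    s * Real.log α ≤ Y + 14 := by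
  have hs : 1 ≤ α ^ s := one_le_pow₀ hα.le
  have hs0 : 0 < α ^ s := by linarith
  have hy : 24 / α ^ s ≤ 24 := div_le_self (by norm_num) hs
  have hn := prod_near4 hy hx1 hx2 hx3 hδ0 hδ
  rw [← hΛ] at hn
  have hlog : s * Real.log α = Real.log (α ^ s) := by rw [Real.log_pow]
  have key : α ^ s ≤ 781248 * Real.exp Y := by
    by_cases hc : 16276 * (24 / α ^ s) ≤ 1 / 2
    · have := log_near hc hn
      have h3 : Real.exp (-Y) < 781248 / α ^ s := by
        refine lt_of_lt_of_le hl (this.trans (le_of_eq ?_)); ring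
      rw [Real.exp_neg, lt_div_iff₀ hs0, inv_mul_lt_iff₀ (Real.exp_pos _)] at h3
      linarith
    · push Not at hc
      have : 1 / 2 * α ^ s < 390624 := by
        have e : 16276 * (24 / α ^ s) = 390624 / α ^ s := by ring
        rw [e, lt_div_iff₀ hs0] at hc
        exact hc
      have : 1 ≤ Real.exp Y := Real.one_le_exp hY
      linarith
  rw [hlog]
  have := Real.log_le_log hs0 key
  rw [Real.log_mul (by norm_num) (Real.exp_pos _).ne', Real.log_exp] at this
  have := log_const
  linarith

theorem stage_full (k N d L E a j s n : ℕ) (hk : 2 ≤ k) (hL : 1000 ≤ L) (hE : 1 ≤ E) (ha1 : 1 ≤ a) (ha9 : a ≤ 9) (hj : j ≤ 3)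
    {α x1 x2 x3 δ h G : ℝ} (h1 : 1.6 < α) (h2 : α < 2) (hr : α ^ k * (2 - α) = 1)
    (hG : G = 1440 * ((k + 6 : ℕ) : ℝ) ^ 2 * L ^ 3)
    (hh : h = Real.log (1944 * E) + Real.log (9 * (3 * k + 1) ^ 3))
    (hnN : n ≤ N) (hN3 : N ≤ 3 * n) (hd2 : d ≤ 2 * n) (hd1 : n ≤ 100 * d)
    (hbig : 2 * (G * (h + 1)) ≤ n)
    (hlX : k * Real.log (n * (721 * (k + 6) * L ^ 2)) ≤ L / 4)
    (hx1 : |x1 - 1| ≤ 24 / α ^ s) (hx2 : |x2 - 1| ≤ 24 / α ^ s) (hx3 : |x3 - 1| ≤ 24 / α ^ s)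
    (hδ0 : 0 ≤ δ) (hδ : δ ≤ 24 / α ^ s) (hΛ : α ^ N * (9 * E * lc k α ^ j / a) / 10 ^ d = x1 * x2 * x3 * (1 - δ)) :
    s * Real.log α ≤ G * (h + 1) + 14 := by
  have hER : (1 : ℝ) ≤ E := by exact_mod_cast hE
  have hh0 : 0 ≤ h := by
    rw [hh]
    have : (1 : ℝ) ≤ (3 * k + 1) ^ 3 := one_le_pow₀ (by have : (0 : ℝ) ≤ k := Nat.cast_nonneg _
                                                        linarith)
    exact add_nonneg (Real.log_nonneg (by linarith)) (Real.log_nonneg (by linarith))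
  have hG0 : 0 ≤ G := by rw [hG]; positivity
  have hce : (⌈h⌉₊ : ℝ) ≤ h + 1 := (Nat.ceil_lt_add_one hh0).le
  have hGH : G * (⌈h⌉₊ : ℝ) ≤ G * (h + 1) := by gcongr
  have key := stage_baker k N d L ⌈h⌉₊ E a j hk hL hE ha1 ha9 hj n h1 h2 hr (by rw [← hh]; exact Nat.le_ceil _) hnN hN3 hd2 hd1
    (by rw [← hG]; linarith) hlX
  rw [← hG] at key
  have hlc : 0 < lc k α := by have := (lc_bounds hk h1 h2 hr).1; linarith
  have hα0 : 0 < α := by linarith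
  have haR : (0 : ℝ) < a := by exact_mod_cast ha1
  have hq : 0 < 9 * E * lc k α ^ j / a := by positivity
  have := stage_end s (by linarith) hx1 hx2 hx3 hδ0 hδ (by
    rw [← hΛ, Real.exp_add, Real.exp_sub, Real.exp_log hq, Real.exp_nat_mul, Real.exp_nat_mul, Real.exp_log hα0, Real.exp_log (by norm_num)]
    ring) (by positivity) key
  linarith

set_option maxHeartbeats 1600000 in
theorem chain (k n m l d a L : ℕ) (hk : 2 ≤ k) (hL : 1000 ≤ L) (hnm : m ≤ n) (hml : l ≤ m) (ha1 : 1 ≤ a) (ha9 : a ≤ 9)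
    (heq : 9 * (lucasK k n * lucasK k m * lucasK k l) + a = a * 10 ^ d) {G S : ℝ}
    (hG : G = 1440 * ((k + 6 : ℕ) : ℝ) ^ 2 * L ^ 3)
    (hS : S = Real.log 1944 + Real.log (9 * (3 * k + 1) ^ 3) + 5)
    (hlX : k * Real.log (n * (721 * (k + 6) * L ^ 2)) ≤ L / 4) : (n : ℝ) ≤ 2.5 * G * (G + 1) ^ 2 * S := by
  by_contra hcon
  push Not at hcon
  obtain ⟨α, h1, h2, hr⟩ := exists_root k hk
  have hα0 : 0 < α := by linarith
  have hαn : ∀ i : ℕ, 0 < α ^ i := fun i => by positivity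
  have hLp : ∀ i, (1 : ℝ) ≤ lucasK k i := fun i => by exact_mod_cast lucas_pos hk i
  have hlow := lucas_lower hk h1 h2 hr
  have hup := lucas_upper hk h1 h2 hr
  have herr := lucas_err k hk h1 h2 hr
  set c := lc k α with hc
  have hkR : (2 : ℝ) ≤ k := by exact_mod_cast hk
  have haR : (1 : ℝ) ≤ a := by exact_mod_cast ha1
  have haR9 : (a : ℝ) ≤ 9 := by exact_mod_cast ha9
  have hLR : (1000 : ℝ) ≤ L := by exact_mod_cast hL
  have heqR : 9 * ((lucasK k n : ℝ) * lucasK k m * lucasK k l) + a = a * 10 ^ d := by exact_mod_cast heq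
  have hG9 : 1000000000 ≤ G := by
    rw [hG]
    have : (8 : ℝ) ≤ ((k + 6 : ℕ) : ℝ) := by push_cast; linarith
    calc (1000000000 : ℝ) ≤ 1440 * 8 ^ 2 * 1000 ^ 3 := by norm_num
      _ ≤ _ := by gcongr
  have ha0 : 0.4 ≤ Real.log α := by
    rw [Real.le_log_iff_exp_le hα0]
    have : Real.exp 0.4 ≤ 1.6 := by
      have := Real.exp_bound_div_one_sub_of_interval (x := 0.2) (by norm_num) (by norm_num)
      have e : Real.exp 0.4 = Real.exp 0.2 ^ 2 := by rw [← Real.exp_nat_mul]; norm_num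
      rw [e]
      calc Real.exp 0.2 ^ 2 ≤ (1 / (1 - 0.2)) ^ 2 := by gcongr
        _ ≤ 1.6 := by norm_num
    linarith
  have hS5 : 5 ≤ S := by
    rw [hS]
    have : (1 : ℝ) ≤ (3 * k + 1) ^ 3 := one_le_pow₀ (by linarith)
    have := Real.log_nonneg (by norm_num : (1 : ℝ) ≤ 1944)
    have := Real.log_nonneg (by linarith : (1 : ℝ) ≤ 9 * (3 * k + 1) ^ 3)
    linarith
  have hn9 : (1000 : ℝ) ≤ n := by
    refine le_trans ?_ hcon.le
    calc (1000 : ℝ) ≤ 2.5 * 1000000000 * (0 + 1) ^ 2 * 5 := by norm_num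
      _ ≤ _ := by gcongr; linarith
  have hn9N : 1000 ≤ n := by exact_mod_cast hn9
  -- size of d
  have hd2 : d ≤ 2 * n := by
    by_contra hlt
    push Not at hlt
    have e1 : (10 : ℝ) ^ (2 * n + 1) ≤ 10 ^ d := pow_le_pow_right₀ (by norm_num) (by omega)
    have u : ∀ i ≤ n, (lucasK k i : ℝ) ≤ 4.5 * 2 ^ n := by
      intro i hi
      refine (hup i).trans ?_
      gcongr
      calc α ^ i ≤ α ^ n := pow_le_pow_right₀ (by linarith) hi
        _ ≤ 2 ^ n := by gcongr
    have e2 : (lucasK k n : ℝ) * lucasK k m * lucasK k l ≤ (4.5 * 2 ^ n) * (4.5 * 2 ^ n) * (4.5 * 2 ^ n) := by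
      gcongr
      · exact u n le_rfl
      · exact u m hnm
      · exact u l (by omega)
    have e3 : ((4.5 : ℝ) * 2 ^ n) * (4.5 * 2 ^ n) * (4.5 * 2 ^ n) = 91.125 * 8 ^ n := by
      rw [show (8 : ℝ) = 2 * 2 * 2 by norm_num, mul_pow, mul_pow]; ring
    have e4 : (10 : ℝ) ^ (2 * n + 1) = 10 * 10 ^ n * 10 ^ n := by rw [pow_succ, two_mul, pow_add]; ring
    have e5 : (8 : ℝ) ^ n ≤ 10 ^ n := by gcongr; norm_num
    have e6 : (10 : ℝ) ^ 3 ≤ 10 ^ n := pow_le_pow_right₀ (by norm_num) (by omega)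
    have e7 : (1 : ℝ) * 10 ^ d ≤ a * 10 ^ d := by gcongr
    nlinarith
  have h10d : α ^ n ≤ 8 * 10 ^ d := by
    have e1 : (lucasK k n : ℝ) * 1 * 1 ≤ (lucasK k n : ℝ) * lucasK k m * lucasK k l := by
      gcongr
      · exact hLp m
      · exact hLp l
    have e2 : (a : ℝ) * 10 ^ d ≤ 9 * 10 ^ d := by gcongr
    have := hlow n
    linarith
  have hd1 : n ≤ 100 * d := by
    have e1 := Real.log_le_log (hαn n) h10d
    rw [Real.log_pow, Real.log_mul (by norm_num) (by positivity), Real.log_pow] at e1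
    have e2 : Real.log 8 ≤ 7 := (Real.log_le_sub_one_of_pos (by norm_num)).trans (by norm_num)
    have e3 : Real.log 10 ≤ 9 := (Real.log_le_sub_one_of_pos (by norm_num)).trans (by norm_num)
    have e4 : (n : ℝ) * 0.4 ≤ n * Real.log α := by gcongr
    have e5 : (d : ℝ) * Real.log 10 ≤ d * 9 := by gcongr
    have : (n : ℝ) ≤ 100 * d := by linarith
    exact_mod_cast this
  -- the three quotients
  have hx : ∀ s i : ℕ, s ≤ i → |c * α ^ i / lucasK k i - 1| ≤ 24 / α ^ s := by
    intro s i hsi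
    have hp : (0 : ℝ) < lucasK k i := by linarith [hLp i]
    have e : c * α ^ i / lucasK k i - 1 = -((lucasK k i : ℝ) - c * α ^ i) / lucasK k i := by field_simp; ring
    rw [e, abs_div, abs_neg, abs_of_pos hp]
    have e1 : |(lucasK k i : ℝ) - c * α ^ i| / lucasK k i ≤ 3 / (α ^ i / 8) := by
      exact div_le_div₀ (by norm_num) (herr i) (div_pos (hαn i) (by norm_num)) (by linarith [hlow i])
    refine e1.trans ?_
    rw [div_div_eq_mul_div]
    have : α ^ s ≤ α ^ i := pow_le_pow_right₀ (by linarith) hsi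
    have := hαn s
    norm_num
    gcongr
  have hone : ∀ s : ℕ, |(1 : ℝ) - 1| ≤ 24 / α ^ s := by
    intro s; have := hαn s; rw [sub_self, abs_zero]; positivity
  have hδ : ∀ s : ℕ, s ≤ n → 1 / (10 : ℝ) ^ d ≤ 24 / α ^ s := by
    intro s hs
    have : α ^ s ≤ α ^ n := pow_le_pow_right₀ (by linarith) hs
    rw [div_le_div_iff₀ (by positivity) (hαn s)]
    have : (0 : ℝ) < 10 ^ d := by positivity
    linarith
  have hδ0 : 0 ≤ 1 / (10 : ℝ) ^ d := by positivity
  have hD : 9 * ((lucasK k n : ℝ) * lucasK k m * lucasK k l) / (a * 10 ^ d) = 1 - 1 / 10 ^ d := by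
    have : (0 : ℝ) < 10 ^ d := by positivity
    field_simp
    linear_combination heqR
  set hA := Real.log 1944 + Real.log (9 * (3 * k + 1) ^ 3) with hhA
  have hS' : hA = S - 5 := by rw [hS]; ring
  have hLl : ∀ i : ℕ, Real.log (lucasK k i) ≤ i * Real.log α + 1.51 := by
    intro i
    have e1 := Real.log_le_log (by linarith [hLp i]) (hup i)
    rw [Real.log_mul (by norm_num) (hαn i).ne', Real.log_pow] at e1
    have : Real.log 4.5 ≤ 1.51 := by
      rw [Real.log_le_iff_le_exp (by norm_num)]
      have : Real.exp 1.51 = Real.exp 1 * Real.exp 0.51 := by rw [← Real.exp_add]; norm_num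
      rw [this]
      have h1 := Real.exp_one_gt_d9
      have h2 : 1 + 0.51 + 0.51 ^ 2 / 2 + 0.51 ^ 3 / 6 ≤ Real.exp 0.51 := by
        have := Real.sum_le_exp_of_nonneg (x := 0.51) (by norm_num) 4
        simp [Finset.sum_range_succ, Nat.factorial] at this
        norm_num at this ⊢
        linarith
      calc (4.5 : ℝ) ≤ 2.7182818283 * (1 + 0.51 + 0.51 ^ 2 / 2 + 0.51 ^ 3 / 6) := by norm_num
        _ ≤ _ := by gcongr
    linarith
  have hG0 : 0 < G := by linarith
  have hGS : 0 < G * S := by positivity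
  have hne : ∀ i, (lucasK k i : ℝ) ≠ 0 := fun i => by linarith [hLp i]
  have hcon' : 2 * (G * ((G + 1) ^ 2 * S)) ≤ n := by
    have : 0 ≤ G * ((G + 1) ^ 2 * S) := by positivity
    have e : 2.5 * G * (G + 1) ^ 2 * S = 2.5 * (G * ((G + 1) ^ 2 * S)) := by ring
    linarith
  have r1 : (G + 1) * S = G * S + S := by ring
  have r2 : (G + 1) ^ 2 * S = G * (G * S) + 2 * (G * S) + S := by ring
  have r3 : 0 ≤ G * (G * S) := by positivity
  have r4 : G * (G + 1) * S = G * (G * S) + G * S := by ring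
  -- stage A
  have sA : l * Real.log α ≤ G * S := by
    have hE : Real.log (1944 * ((1 : ℕ) : ℝ)) + Real.log (9 * (3 * k + 1) ^ 3) = hA := by rw [Nat.cast_one, mul_one]
    have := stage_full k (n + m + l) d L 1 a 3 l n hk hL le_rfl ha1 ha9 le_rfl h1 h2 hr hG hE.symm (by omega) (by omega) hd2 hd1
      (by
        refine le_trans ?_ hcon'
        rw [hS']
        have : S - 5 + 1 ≤ (G + 1) ^ 2 * S := by linarith
        gcongr) hlX (hx l n (by omega)) (hx l m hml) (hx l l le_rfl) hδ0 (hδ l (by omega))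
      (by
        rw [← hD, ← hc, pow_add, pow_add]
        have := hne n; have := hne m; have := hne l
        field_simp
        push_cast; ring)
    have e : G * (hA + 1) = G * S - 4 * G := by rw [hS']; ring
    linarith
  have sB : m * Real.log α ≤ G * (G + 1) * S := by
    have hE : Real.log (1944 * ((lucasK k l : ℕ) : ℝ)) + Real.log (9 * (3 * k + 1) ^ 3) = hA + Real.log (lucasK k l) := by
      rw [Real.log_mul (by norm_num) (hne l)]; ring
    have hl1 := hLl l
    have hle : hA + Real.log (lucasK k l) + 1 ≤ (G + 1) * S - 2 := by rw [hS']; linarith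
    have := stage_full k (n + m) d L (lucasK k l) a 2 m n hk hL (lucas_pos hk l) ha1 ha9 (by norm_num) h1 h2 hr hG hE.symm (by omega) (by omega) hd2 hd1
      (by
        refine le_trans ?_ hcon'
        have : hA + Real.log (lucasK k l) + 1 ≤ (G + 1) ^ 2 * S := by linarith
        gcongr) hlX (hx m n hnm) (hx m m le_rfl) (hone m) hδ0 (hδ m hnm)
      (by
        rw [← hD, ← hc, pow_add]
        have := hne n; have := hne m; have := hne l
        field_simp)
    have : G * (hA + Real.log (lucasK k l) + 1) ≤ G * ((G + 1) * S - 2) := by gcongr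
    have e : G * ((G + 1) * S - 2) = G * (G + 1) * S - 2 * G := by ring
    linarith
  have sC : n * Real.log α ≤ G * (G + 1) ^ 2 * S := by
    have hE : Real.log (1944 * ((lucasK k m * lucasK k l : ℕ) : ℝ)) + Real.log (9 * (3 * k + 1) ^ 3) = hA + Real.log (lucasK k m) + Real.log (lucasK k l) := by
      rw [Nat.cast_mul, Real.log_mul (by norm_num) (mul_ne_zero (hne m) (hne l)), Real.log_mul (hne m) (hne l)]; ring
    have hl1 := hLl l
    have hm1 := hLl m
    have hle : hA + Real.log (lucasK k m) + Real.log (lucasK k l) + 1 ≤ (G + 1) ^ 2 * S - 0.9 := by rw [hS']; linarith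
    have := stage_full k n d L (lucasK k m * lucasK k l) a 1 n n hk hL (Nat.mul_pos (lucas_pos hk m) (lucas_pos hk l)) ha1 ha9 (by norm_num) h1 h2 hr hG hE.symm le_rfl (by omega) hd2 hd1
      (by
        refine le_trans ?_ hcon'
        have : hA + Real.log (lucasK k m) + Real.log (lucasK k l) + 1 ≤ (G + 1) ^ 2 * S := by linarith
        gcongr) hlX (hx n n le_rfl) (hone n) (hone n) hδ0 (hδ n le_rfl)
      (by
        rw [← hD, ← hc]
        have := hne n; have := hne m; have := hne l
        field_simp
        push_cast; ring)
    have : G * (hA + Real.log (lucasK k m) + Real.log (lucasK k l) + 1) ≤ G * ((G + 1) ^ 2 * S - 0.9) := by gcongr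
    have e : G * ((G + 1) ^ 2 * S - 0.9) = G * (G + 1) ^ 2 * S - 0.9 * G := by ring
    linarith
  have : (n : ℝ) * 0.4 ≤ n * Real.log α := by gcongr
  linarith

end

section

def bb : ℕ → ℕ → ℕ
  | _, 0 => 2
  | 0, 1 => 1
  | 0, r + 2 => 3 * 2 ^ r
  | q + 1, r + 1 => 2 * bb (q + 1) r + bb q (r + 1)
termination_by q r => (q, r)

theorem bb_zero (q : ℕ) : bb q 0 = 2 := by cases q <;> rw [bb]
theorem bb_z1 : bb 0 1 = 1 := by rw [bb]
theorem bb_z2 (r : ℕ) : bb 0 (r + 2) = 3 * 2 ^ r := by rw [bb]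
theorem bb_ss (q r : ℕ) : bb (q + 1) (r + 1) = 2 * bb (q + 1) r + bb q (r + 1) := by rw [bb]

theorem bb_pos (q r : ℕ) : 1 ≤ bb q r := by
  induction q with
  | zero =>
    match r with
    | 0 => rw [bb_zero]; norm_num
    | 1 => rw [bb_z1]
    | r + 2 => rw [bb_z2]; have := Nat.one_le_two_pow (n := r); omega
  | succ q ih =>
    cases r with
    | zero => rw [bb_zero]; norm_num
    | succ r => rw [bb_ss]; omega

theorem bb_two (q r : ℕ) : 2 ≤ bb (q + 1) r := by
  cases r with
  | zero => rw [bb_zero]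
  | succ r => rw [bb_ss]; have := bb_pos (q + 1) r; omega

theorem bb_dvd (q r : ℕ) : 2 ^ (r - 2) ∣ bb q r := by
  induction q generalizing r with
  | zero =>
    match r with
    | 0 => simp
    | 1 => simp
    | r + 2 => rw [bb_z2, Nat.add_sub_cancel]; exact Dvd.intro_left _ rfl
  | succ q ih =>
    induction r with
    | zero => simp
    | succ r ihr =>
      rw [bb_ss]
      refine dvd_add ?_ (ih (r + 1))
      have h1 : 2 ^ (r + 1 - 2) ∣ 2 ^ (r - 2 + 1) := pow_dvd_pow 2 (by omega)
      refine h1.trans ?_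
      rw [pow_succ, mul_comm]
      exact Nat.mul_dvd_mul_left 2 ihr

theorem bb_le (q r : ℕ) : bb q r ≤ 2 ^ (r + 1) * (q + 1) ^ r := by
  induction q generalizing r with
  | zero =>
    match r with
    | 0 => rw [bb_zero]; norm_num
    | 1 => rw [bb_z1]; norm_num
    | r + 2 => rw [bb_z2]; simp only [zero_add, one_pow, mul_one]; rw [pow_succ, pow_succ, pow_succ]; have := Nat.one_le_two_pow (n := r); omega
  | succ q ih =>
    induction r with
    | zero => rw [bb_zero]; norm_num
    | succ r ihr =>
      rw [bb_ss]
      have h2 := ih (r + 1)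
      have h3 : (q + 1) ^ r ≤ (q + 1 + 1) ^ r := Nat.pow_le_pow_left (by omega) r
      calc 2 * bb (q + 1) r + bb q (r + 1) ≤ 2 * (2 ^ (r + 1) * (q + 1 + 1) ^ r) + 2 ^ (r + 1 + 1) * (q + 1) ^ (r + 1) := by omega
        _ = 2 ^ (r + 1 + 1) * ((q + 1 + 1) ^ r + (q + 1) * (q + 1) ^ r) := by ring
        _ ≤ 2 ^ (r + 1 + 1) * ((q + 1 + 1) ^ r + (q + 1) * (q + 1 + 1) ^ r) := by gcongr
        _ = _ := by ring

theorem lucas_rec2 {k : ℕ} (hk : 2 ≤ k) (i : ℕ) : lucasK k (i + k + 1) + lucasK k i = 2 * lucasK k (i + k) := by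
  have := lsh_rec2 k hk (i + (k - 2))
  rw [show i + (k - 2) + k + 1 = (i + k + 1) + (k - 2) by ring, show i + (k - 2) + k = (i + k) + (k - 2) by ring, lsh_eq, lsh_eq, lsh_eq] at this
  exact this

theorem lucas_init {k : ℕ} (hk : 2 ≤ k) (r : ℕ) (hr : r + 2 ≤ k) : lucasK k (r + 2) = 3 * 2 ^ r := by
  induction r with
  | zero =>
    rw [lucasK_rec]
    have hkk : k = (k - 2) + 1 + 1 := by omega
    rw [hkk, Finset.sum_range_succ', Finset.sum_range_succ', Finset.sum_eq_zero]
    · simp [lucasK_zero, lucasK_one]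
    · intro i _; rw [if_neg (by omega)]
  | succ r ih =>
    have := lsh_rec2 k hk r
    rw [show r + k + 1 = (r + 1 + 2) + (k - 2) by omega, show r + k = (r + 2) + (k - 2) by omega, lsh_eq, lsh_eq, ih (by omega)] at this
    have h0 : lsh k r = 0 := by unfold lsh; rw [if_pos (by omega)]
    rw [h0] at this
    rw [pow_succ]; omega

theorem lucas_bb {k : ℕ} (hk : 2 ≤ k) (q r : ℕ) (hr : r ≤ k) :
    ((2 : ℤ) ^ (k - 1)) ∣ (lucasK k ((k + 1) * q + r) : ℤ) - (-1) ^ q * bb q r := by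
  induction q generalizing r with
  | zero =>
    have : lucasK k ((k + 1) * 0 + r) = bb 0 r := by
      rw [mul_zero, zero_add]
      match r, hr with
      | 0, _ => rw [bb_zero, lucasK_zero]
      | 1, _ => rw [bb_z1, lucasK_one]
      | r + 2, hr => rw [bb_z2, lucas_init hk r hr]
    rw [this]; simp
  | succ q ih =>
    induction r with
    | zero =>
      have h1 := lucas_rec2 hk ((k + 1) * q)
      have e : (k + 1) * (q + 1) + 0 = (k + 1) * q + k + 1 := by ring
      rw [e]
      have h1Z : (lucasK k ((k + 1) * q + k + 1) : ℤ) = 2 * lucasK k ((k + 1) * q + k) - lucasK k ((k + 1) * q + 0) := by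
        rw [add_zero]; have : ((lucasK k ((k + 1) * q + k + 1) + lucasK k ((k + 1) * q) : ℕ) : ℤ) = ((2 * lucasK k ((k + 1) * q + k) : ℕ) : ℤ) := by rw [h1]
        push_cast at this; linarith
      have h2 := ih k le_rfl
      have h3 := ih 0 (by omega)
      have h4 : (2 : ℤ) ^ (k - 1) ∣ 2 * bb q k := by
        have : 2 ^ (k - 1) ∣ 2 * bb q k := by
          rw [show k - 1 = (k - 2) + 1 by omega, pow_succ, mul_comm]
          exact Nat.mul_dvd_mul_left 2 (bb_dvd q k)
        exact_mod_cast this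
      rw [bb_zero] at h3 ⊢
      rw [h1Z]
      have : (2 : ℤ) * lucasK k ((k + 1) * q + k) - lucasK k ((k + 1) * q + 0) - (-1) ^ (q + 1) * ((2 : ℕ) : ℤ) =
        2 * ((lucasK k ((k + 1) * q + k) : ℤ) - (-1) ^ q * bb q k) + (-1) ^ q * (2 * bb q k) - ((lucasK k ((k + 1) * q + 0) : ℤ) - (-1) ^ q * ((2 : ℕ) : ℤ)) := by
        rw [pow_succ]; push_cast; ring
      rw [this]
      exact dvd_sub (dvd_add (Dvd.dvd.mul_left h2 _) (Dvd.dvd.mul_left h4 _)) h3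
    | succ r ihr =>
      have h1 := lucas_rec2 hk ((k + 1) * q + (r + 1))
      have e : (k + 1) * (q + 1) + (r + 1) = (k + 1) * q + (r + 1) + k + 1 := by ring
      have e2 : (k + 1) * q + (r + 1) + k = (k + 1) * (q + 1) + r := by ring
      rw [e]
      have h1Z : (lucasK k ((k + 1) * q + (r + 1) + k + 1) : ℤ) = 2 * lucasK k ((k + 1) * (q + 1) + r) - lucasK k ((k + 1) * q + (r + 1)) := by
        have : ((lucasK k ((k + 1) * q + (r + 1) + k + 1) + lucasK k ((k + 1) * q + (r + 1)) : ℕ) : ℤ) = ((2 * lucasK k ((k + 1) * q + (r + 1) + k) : ℕ) : ℤ) := by rw [h1]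
        rw [e2] at this ⊢
        push_cast at this; linarith
      have h2 := ihr (by omega)
      have h3 := ih (r + 1) hr
      rw [h1Z, bb_ss]
      have : (2 : ℤ) * lucasK k ((k + 1) * (q + 1) + r) - lucasK k ((k + 1) * q + (r + 1)) - (-1) ^ (q + 1) * ((2 * bb (q + 1) r + bb q (r + 1) : ℕ) : ℤ) =
        2 * ((lucasK k ((k + 1) * (q + 1) + r) : ℤ) - (-1) ^ (q + 1) * bb (q + 1) r) - ((lucasK k ((k + 1) * q + (r + 1)) : ℤ) - (-1) ^ q * bb q (r + 1)) := by
        rw [pow_succ]; push_cast; ring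
      rw [this]
      exact dvd_sub (Dvd.dvd.mul_left h2 _) h3

theorem lucas_form {k : ℕ} (hk : 2 ≤ k) (i : ℕ) : ∃ q r : ℕ, i = (k + 1) * q + r ∧ r ≤ k ∧
    ((2 : ℤ) ^ (k - 1)) ∣ (lucasK k i : ℤ) - (-1) ^ q * bb q r ∧ 2 ^ (r - 2) ∣ lucasK k i := by
  have e : i = (k + 1) * (i / (k + 1)) + i % (k + 1) := (Nat.div_add_mod _ _).symm
  have hr : i % (k + 1) ≤ k := Nat.lt_succ_iff.mp (Nat.mod_lt _ (by omega))
  refine ⟨i / (k + 1), i % (k + 1), e, hr, ?_, ?_⟩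
  · have := lucas_bb hk (i / (k + 1)) (i % (k + 1)) hr
    rwa [← e] at this
  · have h1 := lucas_bb hk (i / (k + 1)) (i % (k + 1)) hr
    rw [← e] at h1
    have h2 : ((2 : ℤ) ^ (i % (k + 1) - 2)) ∣ (2 : ℤ) ^ (k - 1) := pow_dvd_pow 2 (by omega)
    have h3 : ((2 : ℤ) ^ (i % (k + 1) - 2)) ∣ bb (i / (k + 1)) (i % (k + 1)) := by exact_mod_cast bb_dvd _ _
    have h4 := dvd_add (h2.trans h1) (Dvd.dvd.mul_left h3 ((-1) ^ (i / (k + 1))))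
    rw [sub_add_cancel] at h4
    exact_mod_cast h4

theorem two_adic (k n m l d a D : ℕ) (hk : 2 ≤ k) (hnm : m ≤ n) (hml : l ≤ m) (ha1 : 1 ≤ a) (ha9 : a ≤ 9) (hd : 4 ≤ d) (hnk : k + 1 ≤ n)
    (heq : 9 * (lucasK k n * lucasK k m * lucasK k l) + a = a * 10 ^ d) (hD : D ≤ d) (hDk : D ≤ k - 1) :
    2 ^ D ≤ 2 ^ 16 * n ^ 9 := by
  obtain ⟨q1, r1, i1, s1, c1, v1⟩ := lucas_form hk n
  obtain ⟨q2, r2, i2, s2, c2, v2⟩ := lucas_form hk m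
  obtain ⟨q3, r3, i3, s3, c3, v3⟩ := lucas_form hk l
  have h10 : ∀ e ≤ d, 2 ^ e ∣ a * 10 ^ d := by
    intro e he
    have : 2 ^ e ∣ 2 ^ d := pow_dvd_pow 2 he
    have h2 : 2 ^ d ∣ 10 ^ d := pow_dvd_pow_of_dvd (by norm_num) d
    exact Dvd.dvd.mul_left (this.trans h2) a
  have hv : (r1 - 2) + (r2 - 2) + (r3 - 2) ≤ 3 := by
    by_contra hlt
    push Not at hlt
    have h1 : 2 ^ ((r1 - 2) + (r2 - 2) + (r3 - 2)) ∣ lucasK k n * lucasK k m * lucasK k l := by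
      rw [pow_add, pow_add]; exact Nat.mul_dvd_mul (Nat.mul_dvd_mul v1 v2) v3
    have h2 : 2 ^ 4 ∣ lucasK k n * lucasK k m * lucasK k l := (pow_dvd_pow 2 hlt).trans h1
    have h3 : 2 ^ 4 ∣ a := by
      have := h10 4 hd
      rw [← heq] at this
      exact (Nat.dvd_add_right (Dvd.dvd.mul_left h2 9)).mp this
    have := Nat.le_of_dvd (by omega) h3
    omega
  have hq1 : 1 ≤ q1 := by
    by_contra h0
    have : q1 = 0 := by omega
    subst this; omega
  have hq2 : q2 ≤ q1 := by
    by_contra hlt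
    have : (k + 1) * (q1 + 1) ≤ (k + 1) * q2 := Nat.mul_le_mul_left _ (by omega)
    rw [mul_add] at this; omega
  have hq3 : q3 ≤ q1 := by
    by_contra hlt
    have : (k + 1) * (q1 + 1) ≤ (k + 1) * q3 := Nat.mul_le_mul_left _ (by omega)
    rw [mul_add] at this; omega
  have hq1n : q1 + 1 ≤ n := by
    have : 3 * q1 ≤ (k + 1) * q1 := Nat.mul_le_mul_right _ (by omega)
    omega
  set B := bb q1 r1 * bb q2 r2 * bb q3 r3 with hB
  have hBle : B ≤ 2 ^ 12 * n ^ 9 := by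
    have g : ∀ q r, q ≤ q1 → bb q r ≤ 2 ^ (r + 1) * n ^ r := by
      intro q r hq
      refine (bb_le q r).trans ?_
      gcongr; omega
    calc B ≤ (2 ^ (r1 + 1) * n ^ r1) * (2 ^ (r2 + 1) * n ^ r2) * (2 ^ (r3 + 1) * n ^ r3) :=
          Nat.mul_le_mul (Nat.mul_le_mul (g q1 r1 le_rfl) (g q2 r2 hq2)) (g q3 r3 hq3)
      _ = 2 ^ (r1 + r2 + r3 + 3) * n ^ (r1 + r2 + r3) := by ring
      _ ≤ 2 ^ 12 * n ^ 9 := by gcongr <;> omega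
  have hB2 : 2 ≤ B := by
    obtain ⟨q, rfl⟩ : ∃ q, q1 = q + 1 := ⟨q1 - 1, by omega⟩
    calc 2 = 2 * 1 * 1 := by norm_num
      _ ≤ B := Nat.mul_le_mul (Nat.mul_le_mul (bb_two q r1) (bb_pos q2 r2)) (bb_pos q3 r3)
  have hDd : (2 : ℤ) ^ D ∣ (2 : ℤ) ^ (k - 1) := pow_dvd_pow 2 hDk
  have hcong : (2 : ℤ) ^ D ∣ ((lucasK k n * lucasK k m * lucasK k l : ℕ) : ℤ) - (-1) ^ (q1 + q2 + q3) * B := by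
    have e : ((lucasK k n * lucasK k m * lucasK k l : ℕ) : ℤ) - (-1) ^ (q1 + q2 + q3) * B =
      ((lucasK k n : ℤ) - (-1) ^ q1 * bb q1 r1) * (lucasK k m * lucasK k l) + (-1) ^ q1 * bb q1 r1 * lucasK k l * ((lucasK k m : ℤ) - (-1) ^ q2 * bb q2 r2)
        + (-1) ^ q1 * bb q1 r1 * ((-1) ^ q2 * bb q2 r2) * ((lucasK k l : ℤ) - (-1) ^ q3 * bb q3 r3) := by
      rw [hB, pow_add, pow_add]; push_cast; ring
    rw [e]
    exact dvd_add (dvd_add (Dvd.dvd.mul_right (hDd.trans c1) _) (Dvd.dvd.mul_left (hDd.trans c2) _)) (Dvd.dvd.mul_left (hDd.trans c3) _)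
  have hsum : (2 : ℤ) ^ D ∣ 9 * ((lucasK k n * lucasK k m * lucasK k l : ℕ) : ℤ) + a := by
    have := h10 D hD
    rw [← heq] at this
    exact_mod_cast this
  have hfin : (2 : ℤ) ^ D ∣ 9 * ((-1) ^ (q1 + q2 + q3) * B) + a := by
    have := dvd_sub hsum (Dvd.dvd.mul_left hcong 9)
    have e5 : 9 * ((-1) ^ (q1 + q2 + q3) * (B : ℤ)) + (a : ℤ) = 9 * ((lucasK k n * lucasK k m * lucasK k l : ℕ) : ℤ) + a - 9 * (((lucasK k n * lucasK k m * lucasK k l : ℕ) : ℤ) - (-1) ^ (q1 + q2 + q3) * (B : ℤ)) := by ring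
    rw [e5]; exact this
  have hle : (2 : ℤ) ^ D ≤ 9 * B + 9 := by
    have hB2' : (2 : ℤ) ≤ B := by exact_mod_cast hB2
    have ha9' : (a : ℤ) ≤ 9 := by exact_mod_cast ha9
    have ha1' : (1 : ℤ) ≤ a := by exact_mod_cast ha1
    rcases neg_one_pow_eq_or ℤ (q1 + q2 + q3) with h | h
    · rw [h, one_mul] at hfin
      have := Int.le_of_dvd (by linarith) hfin
      linarith
    · rw [h] at hfin
      have h5 : (2 : ℤ) ^ D ∣ 9 * B - a := by
        have := (dvd_neg).mpr hfin
        have e5 : 9 * (B : ℤ) - (a : ℤ) = -(9 * (-1 * (B : ℤ)) + (a : ℤ)) := by ring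
        rw [e5]; exact this
      have := Int.le_of_dvd (by linarith) h5
      linarith
  have hle' : 2 ^ D ≤ 9 * B + 9 := by exact_mod_cast hle
  have hn9 : 1 ≤ n ^ 9 := Nat.one_le_pow _ _ (by omega)
  calc 2 ^ D ≤ 9 * B + 9 := hle'
    _ ≤ 9 * (2 ^ 12 * n ^ 9) + 9 * n ^ 9 := by omega
    _ ≤ 2 ^ 16 * n ^ 9 := by omega

theorem d_lower (k n m l d a : ℕ) (hk : 2 ≤ k) (hn : 1000 ≤ n) (ha1 : 1 ≤ a) (ha9 : a ≤ 9)
    (heq : 9 * (lucasK k n * lucasK k m * lucasK k l) + a = a * 10 ^ d) : n ≤ 100 * d := by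
  obtain ⟨α, h1, h2, hr⟩ := exists_root k hk
  have hα0 : 0 < α := by linarith
  have hLp : ∀ i, (1 : ℝ) ≤ lucasK k i := fun i => by exact_mod_cast lucas_pos hk i
  have hlow := lucas_lower hk h1 h2 hr
  have haR : (1 : ℝ) ≤ a := by exact_mod_cast ha1
  have haR9 : (a : ℝ) ≤ 9 := by exact_mod_cast ha9
  have hnR : (1000 : ℝ) ≤ n := by exact_mod_cast hn
  have heqR : 9 * ((lucasK k n : ℝ) * lucasK k m * lucasK k l) + a = a * 10 ^ d := by exact_mod_cast heq
  have h10d : α ^ n ≤ 8 * 10 ^ d := by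
    have e1 : (lucasK k n : ℝ) * 1 * 1 ≤ (lucasK k n : ℝ) * lucasK k m * lucasK k l := by
      gcongr
      · exact hLp m
      · exact hLp l
    have e2 : (a : ℝ) * 10 ^ d ≤ 9 * 10 ^ d := by gcongr
    have := hlow n
    linarith
  have ha0 : 0.375 ≤ Real.log α := by
    have := Real.one_sub_inv_le_log_of_pos hα0
    have h3 : α⁻¹ ≤ (1.6 : ℝ)⁻¹ := inv_anti₀ (by norm_num) h1.le
    norm_num at h3
    linarith
  have e1 := Real.log_le_log (by positivity) h10d
  rw [Real.log_pow, Real.log_mul (by norm_num) (by positivity), Real.log_pow] at e1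
  have e2 : Real.log 8 ≤ 7 := (Real.log_le_sub_one_of_pos (by norm_num)).trans (by norm_num)
  have e3 : Real.log 10 ≤ 9 := (Real.log_le_sub_one_of_pos (by norm_num)).trans (by norm_num)
  have e4 : (n : ℝ) * 0.375 ≤ n * Real.log α := by gcongr
  have e5 : (d : ℝ) * Real.log 10 ≤ d * 9 := by gcongr
  have : (n : ℝ) ≤ 100 * d := by linarith
  exact_mod_cast this

theorem k_le (k n m l d a : ℕ) (hk : 2 ≤ k) (hnm : m ≤ n) (hml : l ≤ m) (ha1 : 1 ≤ a) (ha9 : a ≤ 9) (hn : 1000 ≤ n) (hnk : 100 * k ≤ n)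
    (heq : 9 * (lucasK k n * lucasK k m * lucasK k l) + a = a * 10 ^ d) : (k : ℝ) ≤ 13 * Real.log n + 17 := by
  have hd := d_lower k n m l d a hk hn ha1 ha9 heq
  have h := two_adic k n m l d a (k - 1) hk hnm hml ha1 ha9 (by omega) (by omega) heq (by omega) le_rfl
  have hR : (2 : ℝ) ^ (k - 1) ≤ 2 ^ 16 * n ^ 9 := by exact_mod_cast h
  have hn0 : (0 : ℝ) < n := by have : 0 < n := by omega
                               exact_mod_cast this
  have h2 := Real.log_le_log (by positivity) hR
  rw [Real.log_mul (by positivity) (by positivity), Real.log_pow, Real.log_pow, Real.log_pow, Nat.cast_sub (by omega)] at h2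
  push_cast at h2
  have hl2 := Real.log_two_gt_d9
  have hln : 0 ≤ Real.log n := Real.log_nonneg (by have : 1 ≤ n := by omega
                                                   exact_mod_cast this)
  by_contra hcon
  push Not at hcon
  have : (13 * Real.log n) * 0.6931471803 ≤ ((k : ℝ) - 17) * Real.log 2 := by
    gcongr
    · linarith
    · linarith
  nlinarith

end

section

set_option exponentiation.threshold 1000

theorem log_up {y : ℝ} (p q : ℕ) (hy : 0 < y) (hq : 0 < q) (h : y ^ q ≤ 2.7182818283 ^ p) : Real.log y ≤ (p : ℝ) / q := by
  have hq' : (0 : ℝ) < q := by exact_mod_cast hq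
  rw [le_div_iff₀ hq']
  have h1 : y ^ q ≤ Real.exp 1 ^ p := h.trans (pow_le_pow_left₀ (by norm_num) Real.exp_one_gt_d9.le p)
  have h2 := Real.log_le_log (pow_pos hy q) h1
  rw [Real.log_pow, Real.log_pow, Real.log_exp] at h2
  linarith

theorem log_lo {y : ℝ} (p q : ℕ) (hq : 0 < q) (h : 2.7182818286 ^ p ≤ y ^ q) : (p : ℝ) / q ≤ Real.log y := by
  have hq' : (0 : ℝ) < q := by exact_mod_cast hq
  rw [div_le_iff₀ hq']
  have h1 : Real.exp 1 ^ p ≤ y ^ q := (pow_le_pow_left₀ (Real.exp_pos 1).le Real.exp_one_lt_d9.le p).trans h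
  have h2 := Real.log_le_log (pow_pos (Real.exp_pos 1) p) h1
  rw [Real.log_pow, Real.log_pow, Real.log_exp] at h2
  linarith

theorem log_tan {y c : ℝ} (hy : 0 < y) (hc : 0 < c) : Real.log y ≤ Real.log c + y / c - 1 := by
  have h := Real.log_le_sub_one_of_pos (div_pos hy hc)
  rw [Real.log_div hy.ne' hc.ne'] at h
  linarith

/-- bounds in logarithmic form: `x = log k`, `t = log n`. -/
theorem num_bounds (k : ℕ) (hk : 2 ≤ k) (t : ℝ) (ht : 104.2 + 12 * Real.log k + 7 * Real.log (Real.log k) ≤ t)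
    (hkt : 4097 ≤ k → (k : ℝ) ≤ 13 * t + 17) :
    (6.59 + Real.log (k + 6) + 2 * (Real.log 5.01 + Real.log k + Real.log t) ≤ 0.25 * t) ∧
    (0.92 + 3 * (7.28 + 2 * Real.log (k + 6) + 3 * (Real.log 5.01 + Real.log k + Real.log t)) + 0.002 + (3.03 + 0.1 * Real.log k) < t) ∧ 100 ≤ t := by
  have hkR : (2 : ℝ) ≤ k := by exact_mod_cast hk
  set x := Real.log k with hx
  have hx2 : 0.693 ≤ x := by
    have := Real.log_le_log (by norm_num) hkR
    have := Real.log_two_gt_d9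
    linarith
  have l501 : Real.log 5.01 ≤ 1.612 := by
    have := log_up (y := 5.01) 108 67 (by norm_num) (by norm_num) (by norm_num)
    norm_num at this ⊢; linarith
  have hlx0 : -0.368 ≤ Real.log x := by
    have h1 := Real.log_le_log (by norm_num) hx2
    have h2 := log_up (y := 1 / 0.693) 46 125 (by norm_num) (by norm_num) (by norm_num)
    rw [Real.log_div (by norm_num) (by norm_num), Real.log_one] at h2
    norm_num at h1 h2 ⊢; linarith
  have ht0 : 100 ≤ t := by linarith
  have htp : 0 < t := by linarith
  rcases Nat.lt_or_ge k 4097 with hk1 | hk1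
  · have hx8 : x ≤ 8.32 := by
      have h1 : (k : ℝ) ≤ 4096 := by exact_mod_cast Nat.lt_succ_iff.mp hk1
      have h2 := Real.log_le_log (by linarith) h1
      have h3 : Real.log 4096 = 12 * Real.log 2 := by
        rw [show (4096 : ℝ) = 2 ^ 12 by norm_num, Real.log_pow]; norm_num
      have := Real.log_two_lt_d9
      rw [h3] at h2
      linarith
    have lt := log_tan htp (show (0 : ℝ) < 150 by norm_num)
    have l150 : Real.log 150 ≤ 5.011 := by
      have := log_up (y := 150) 461 92 (by norm_num) (by norm_num) (by norm_num)
      norm_num at this ⊢; linarith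
    have lk6 : Real.log (k + 6) ≤ x + 1.3864 := by
      have h1 := Real.log_le_log (show (0 : ℝ) < k + 6 by linarith) (show (k : ℝ) + 6 ≤ 2 ^ 2 * k by linarith)
      rw [Real.log_mul (by norm_num) (by linarith), Real.log_pow] at h1
      have := Real.log_two_lt_d9
      push_cast at h1
      linarith
    refine ⟨by linarith, ?_, ht0⟩
    rcases Nat.lt_or_ge k 21 with hk2 | hk2
    · have h1 : (k : ℝ) + 6 ≤ 26 := by
        have : (k : ℝ) ≤ 20 := by exact_mod_cast Nat.lt_succ_iff.mp hk2
        linarith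
      have h2 := Real.log_le_log (show (0 : ℝ) < k + 6 by linarith) h1
      have l26 : Real.log 26 ≤ 3.26 := by
        have := log_up (y := 26) 163 50 (by norm_num) (by norm_num) (by norm_num)
        norm_num at this ⊢; linarith
      linarith
    · have h21 : (21 : ℝ) ≤ k := by exact_mod_cast hk2
      have hx3 : 3 ≤ x := by
        have h1 := Real.log_le_log (by norm_num) h21
        have := log_lo (y := 21) 3 1 (by norm_num) (by norm_num)
        norm_num at this; linarith
      have l6 : Real.log (k + 6) ≤ x + 0.286 := by
        have h1 := log_tan (show (0 : ℝ) < k + 6 by linarith) (show (0 : ℝ) < k by linarith)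
        have h2 : ((k : ℝ) + 6) / k ≤ 1.286 := by
          rw [div_le_iff₀ (by linarith)]; linarith
        linarith
      have lx3 : 1.09 ≤ Real.log x := by
        have h1 := Real.log_le_log (by norm_num) hx3
        have := log_lo (y := 3) 109 100 (by norm_num) (by norm_num)
        norm_num at this ⊢; linarith
      rcases le_total x 5 with h5 | h5
      · linarith
      · have lx5 : 1.6 ≤ Real.log x := by
          have h1 := Real.log_le_log (by norm_num) h5
          have := log_lo (y := 5) 16 10 (by norm_num) (by norm_num)
          norm_num at this ⊢; linarith
        rcases le_total x 7 with h7 | h7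
        · linarith
        · have lx7 : 1.945 ≤ Real.log x := by
            have h1 := Real.log_le_log (by norm_num) h7
            have := log_lo (y := 7) 107 55 (by norm_num) (by norm_num)
            norm_num at this ⊢; linarith
          linarith
  · have hk2 := hkt hk1
    have hx8 : 8.31 ≤ x := by
      have h1 : (2 : ℝ) ^ 12 ≤ k := by
        have : ((2 ^ 12 : ℕ) : ℝ) ≤ k := by exact_mod_cast (by omega : 2 ^ 12 ≤ k)
        exact_mod_cast this
      have h2 := Real.log_le_log (by norm_num) h1
      rw [Real.log_pow] at h2
      have := Real.log_two_gt_d9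
      push_cast at h2
      linarith
    have lx8 : 2.1 ≤ Real.log x := by
      have h1 := Real.log_le_log (by norm_num) hx8
      have := log_lo (y := 8.31) 21 10 (by norm_num) (by norm_num)
      norm_num at this h1 ⊢; linarith
    have ht2 : 218 ≤ t := by linarith
    have lt := log_tan htp (show (0 : ℝ) < 220 by norm_num)
    have l220 : Real.log 220 ≤ 5.4 := by
      have := log_up (y := 220) 54 10 (by norm_num) (by norm_num) (by norm_num)
      norm_num at this ⊢; linarith
    have l13 : Real.log 13.2 ≤ 2.581 := by
      have := log_up (y := 13.2) 80 31 (by norm_num) (by norm_num) (by norm_num)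
      norm_num at this ⊢; linarith
    have lk6 : Real.log (k + 6) ≤ 2.581 + Real.log t := by
      have h1 := Real.log_le_log (show (0 : ℝ) < k + 6 by linarith) (show (k : ℝ) + 6 ≤ 13.2 * t by linarith)
      rw [Real.log_mul (by norm_num) (by linarith)] at h1
      linarith
    have lk : x ≤ 2.581 + Real.log t := by
      have h1 := Real.log_le_log (show (0 : ℝ) < k by linarith) (show (k : ℝ) ≤ 13.2 * t by linarith)
      rw [Real.log_mul (by norm_num) (by linarith)] at h1
      linarith
    exact ⟨by linarith, by linarith, ht0⟩

theorem S_bounds (k : ℕ) (hkR : (2 : ℝ) ≤ k) {S : ℝ} (hS : S = Real.log 1944 + Real.log (9 * (3 * k + 1) ^ 3) + 5) :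
    0 < S ∧ Real.log S ≤ 3.03 + 0.1 * Real.log k := by
  have hk0 : (0 : ℝ) < k := by linarith
  have hSle : S ≤ 18.6 + 3 * Real.log k := by
    have h1 : Real.log (9 * (3 * (k : ℝ) + 1) ^ 3) ≤ Real.log (386 * (k : ℝ) ^ 3) := by
      refine Real.log_le_log (by positivity) ?_
      have : (3 * (k : ℝ) + 1) ^ 3 ≤ (3.5 * k) ^ 3 := pow_le_pow_left₀ (by positivity) (by linarith) 3
      have h3 : (0 : ℝ) < (k : ℝ) ^ 3 := by positivity
      rw [mul_pow] at this
      norm_num at this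
      linarith
    rw [show Real.log (386 * (k : ℝ) ^ 3) = Real.log 386 + 3 * Real.log k by
      rw [Real.log_mul (by norm_num) (by positivity), Real.log_pow]; norm_num] at h1
    have h2 : Real.log (1944 * 386) ≤ 13.6 := by
      have := log_up (y := 1944 * 386) 136 10 (by norm_num) (by norm_num) (by norm_num)
      norm_num at this ⊢; linarith
    rw [Real.log_mul (by norm_num) (by norm_num)] at h2
    rw [hS]; linarith
  have hS0 : 0 < S := by
    have h1 : 0 ≤ Real.log 1944 := Real.log_nonneg (by norm_num)
    have h2 : 0 ≤ Real.log (9 * (3 * (k : ℝ) + 1) ^ 3) := Real.log_nonneg (by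
      have : (1 : ℝ) ≤ (3 * (k : ℝ) + 1) ^ 3 := one_le_pow₀ (by linarith)
      linarith)
    linarith
  have hlogS : Real.log S ≤ 3.03 + 0.1 * Real.log k := by
    have h1 := log_tan hS0 (show (0 : ℝ) < 30 by norm_num)
    have l30 : Real.log 30 ≤ 3.405 := by
      have := log_up (y := 30) 681 200 (by norm_num) (by norm_num) (by norm_num)
      norm_num at this ⊢; linarith
    linarith
  exact ⟨hS0, hlogS⟩

set_option maxHeartbeats 800000 in
theorem bound_aux (k n m l d a : ℕ) (hk : 2 ≤ k) (hnm : m ≤ n) (hml : l ≤ m) (ha1 : 1 ≤ a) (ha9 : a ≤ 9)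
    (heq : 9 * (lucasK k n * lucasK k m * lucasK k l) + a = a * 10 ^ d) :
    (n : ℝ) < 1.8 * 10 ^ 45 * k ^ 12 * Real.log k ^ 7 := by
  by_contra hcon
  push Not at hcon
  have hkR : (2 : ℝ) ≤ k := by exact_mod_cast hk
  have hk0 : (0 : ℝ) < k := by linarith
  have hx2 : 0.69 ≤ Real.log k := by
    have := Real.log_le_log (by norm_num) hkR
    have := Real.log_two_gt_d9
    linarith
  have hx0 : 0 < Real.log k := by linarith
  have hbig : (10 : ℝ) ^ 40 * k ≤ n := by
    refine le_trans ?_ hcon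
    have h1 : (0.07 : ℝ) ≤ Real.log k ^ 7 := le_trans (by norm_num) (pow_le_pow_left₀ (by norm_num) hx2 7)
    have h2 : (k : ℝ) ≤ k ^ 12 := le_self_pow₀ (by linarith) (by norm_num)
    calc (10 : ℝ) ^ 40 * k ≤ (1.8 * 10 ^ 45 * k) * 0.07 := by nlinarith
      _ ≤ 1.8 * 10 ^ 45 * k ^ 12 * Real.log k ^ 7 := by gcongr
  have hn0 : (0 : ℝ) < n := by nlinarith
  have hn1000 : 1000 ≤ n := by
    have : (1000 : ℝ) ≤ n := by nlinarith
    exact_mod_cast this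
  have hn100 : 100 * k ≤ n := by
    have : (100 : ℝ) * k ≤ n := by nlinarith
    exact_mod_cast this
  set t := Real.log n with ht
  have htlow : 104.2 + 12 * Real.log k + 7 * Real.log (Real.log k) ≤ t := by
    have h1 := Real.log_le_log (by positivity) hcon
    rw [Real.log_mul (by positivity) (by positivity), Real.log_mul (by positivity) (by positivity), Real.log_pow, Real.log_pow] at h1
    have h2 := log_lo (y := 1.8 * 10 ^ 45) 521 5 (by norm_num) (by norm_num)
    norm_num at h1 h2 ⊢; linarith
  obtain ⟨b1, b2, ht100⟩ := num_bounds k hk t htlow (fun _ => k_le k n m l d a hk hnm hml ha1 ha9 hn1000 hn100 heq)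
  have ht0 : 0 < t := by linarith
  set L := ⌈5 * k * t⌉₊ with hL
  have hLlo : 5 * k * t ≤ (L : ℝ) := Nat.le_ceil _
  have hkt : 200 ≤ k * t := by nlinarith
  have hLhi : (L : ℝ) ≤ 5.01 * (k * t) := by
    have := (Nat.ceil_lt_add_one (show 0 ≤ 5 * k * t by positivity)).le
    linarith
  have hL1000R : (1000 : ℝ) ≤ L := by linarith
  have hL1000 : 1000 ≤ L := by exact_mod_cast hL1000R
  have hL0 : (0 : ℝ) < L := by linarith
  have hlogL : Real.log L ≤ Real.log 5.01 + Real.log k + Real.log t := by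
    have h1 := Real.log_le_log hL0 hLhi
    rw [Real.log_mul (by norm_num) (by positivity), Real.log_mul (by positivity) (by positivity)] at h1
    linarith
  have l721 : Real.log 721 ≤ 6.59 := by
    have := log_up (y := 721) 659 100 (by norm_num) (by norm_num) (by norm_num)
    norm_num at this ⊢; linarith
  have l1440 : Real.log 1440 ≤ 7.28 := by
    have := log_up (y := 1440) 182 25 (by norm_num) (by norm_num) (by norm_num)
    norm_num at this ⊢; linarith
  have l25 : Real.log 2.5 ≤ 0.92 := by
    have := log_up (y := 2.5) 23 25 (by norm_num) (by norm_num) (by norm_num)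
    norm_num at this ⊢; linarith
  have hlX : k * Real.log (n * (721 * (k + 6) * L ^ 2)) ≤ L / 4 := by
    have e : Real.log (n * (721 * (k + 6) * L ^ 2)) = t + (Real.log 721 + Real.log (k + 6) + 2 * Real.log L) := by
      rw [Real.log_mul (by positivity) (by positivity), Real.log_mul (by positivity) (by positivity), Real.log_mul (by positivity) (by positivity), Real.log_pow]
      norm_num [ht]
    have h2 : Real.log (n * (721 * (k + 6) * L ^ 2)) ≤ 1.25 * t := by rw [e]; linarith
    have := mul_le_mul_of_nonneg_left h2 hk0.le
    linarith
  have hch := chain k n m l d a L hk hL1000 hnm hml ha1 ha9 heq rfl rfl hlX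
  set G : ℝ := 1440 * ((k + 6 : ℕ) : ℝ) ^ 2 * L ^ 3 with hG
  set S : ℝ := Real.log 1944 + Real.log (9 * (3 * k + 1) ^ 3) + 5 with hS
  have hG1 : 1000 ≤ G := by
    have h1 : (1 : ℝ) ≤ ((k + 6 : ℕ) : ℝ) ^ 2 := one_le_pow₀ (by push_cast; linarith)
    have h2 : (1 : ℝ) ≤ (L : ℝ) ^ 3 := one_le_pow₀ (by linarith)
    nlinarith
  have hG0 : 0 < G := by linarith
  have eG : Real.log G = Real.log 1440 + 2 * Real.log (k + 6) + 3 * Real.log L := by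
    rw [hG, Real.log_mul (by positivity) (by positivity), Real.log_mul (by positivity) (by positivity), Real.log_pow, Real.log_pow]
    push_cast; ring
  have eG1 : Real.log (G + 1) ≤ Real.log G + 0.001 := by
    have h1 := log_tan (show (0 : ℝ) < G + 1 by linarith) hG0
    have h2 : (G + 1) / G ≤ 1.001 := by rw [div_le_iff₀ hG0]; linarith
    linarith
  obtain ⟨hS0, hlogS⟩ := S_bounds k hkR hS
  have hfin := Real.log_le_log hn0 hch
  rw [Real.log_mul (by positivity) (by positivity), Real.log_mul (by positivity) (by positivity), Real.log_mul (by positivity) (by positivity), Real.log_pow] at hfin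
  push_cast at hfin
  rw [← ht] at hfin
  linarith

end

theorem bound_on_n
    (k n m l d a : ℕ) (hk : 2 ≤ k) (hnm : m ≤ n) (hml : l ≤ m)
    (hd : 2 ≤ d) (ha1 : 1 ≤ a) (ha9 : a ≤ 9)
    (heq : lucasK k n * lucasK k m * lucasK k l = a * ((10 ^ d - 1) / 9))
    (hnk : k + 1 ≤ n) (hmax : 25 < max k n) :
    (n : ℝ) < 1.8 * 10 ^ 45 * k ^ 12 * Real.log k ^ 7 := by
  refine bound_aux k n m l d a hk hnm hml ha1 ha9 ?_
  have h1 : 9 ∣ 10 ^ d - 1 := by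
    have := Nat.sub_dvd_pow_sub_pow 10 1 d
    simpa using this
  obtain ⟨c, hc⟩ := h1
  have h2 : 1 ≤ 10 ^ d := Nat.one_le_pow _ _ (by norm_num)
  have h3 : 10 ^ d = 9 * c + 1 := by omega
  rw [heq, hc, Nat.mul_div_cancel_left _ (by norm_num), h3]
  ring
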